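/- arXiv:math/0407016 — 2 statements merged into one kernel-verified Lean document; each statement's English description precedes it below -/
import Mathlib

section
/- Let q ≥ 2 and for each n ≥ 2 let R_n denote the length of the standard right factor of a uniformly random Lyndon word of length n over a totally ordered alphabet with q letters. Then for every integer k ≥ 1, the k-th moment E[(R_n/n)^k] converges, as n → ∞, to 1/q + (q−1)/(q(k+1)). -/
open scoped Classical

/-- A Lyndon word: strictly smaller, in lexicographic order, than each of its
proper (nonempty) suffixes. -/
def IsLyndon {α : Type*} [LinearOrder α] (w : List α) : Prop :=
  ∀ i, 0 < i → i < w.length → List.Lex (· < ·) w (w.drop i)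

/-- The finite set of Lyndon words of length `n` over a totally ordered alphabet
with `q` letters, encoded as functions `Fin n → Fin q`. -/
noncomputable def lyndonWords (q n : ℕ) : Finset (Fin n → Fin q) :=
  Finset.univ.filter fun w => IsLyndon (List.ofFn w)

/-- The length of the standard right factor of a word: the length of its smallest
proper suffix for the lexicographic order. -/
noncomputable def srfLen {α : Type*} [LinearOrder α] (w : List α) : ℕ :=
  w.length - sInf {i | 0 < i ∧ i < w.length ∧
    ∀ j, 0 < j → j < w.length → ¬ List.Lex (· < ·) (w.drop j) (w.drop i)}


/-! ### Cyclic words and windows -/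

namespace LW

variable {n q ℓ : ℕ}

/-- The window of length `ℓ` of the cyclic word `x` at position `p`. -/
noncomputable def win (ℓ : ℕ) (x : ZMod n → Fin q) (p : ZMod n) : Lex (Fin ℓ → Fin q) :=
  toLex fun t => x (p + ((t : ℕ) : ZMod n))

/-- All windows are distinct. -/
def Good (ℓ : ℕ) (x : ZMod n → Fin q) : Prop := Function.Injective (win ℓ x)

/-- `i` is the position of the smallest window, `j` of the second smallest one. -/
def IsAB (ℓ : ℕ) (x : ZMod n → Fin q) (i j : ZMod n) : Prop :=
  i ≠ j ∧ (∀ m, m ≠ i → win ℓ x i < win ℓ x m) ∧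
    (∀ m, m ≠ i → m ≠ j → win ℓ x j < win ℓ x m)

theorem IsAB.unique {x : ZMod n → Fin q} {i j i' j' : ZMod n} (h : IsAB ℓ x i j)
    (h' : IsAB ℓ x i' j') : i = i' ∧ j = j' := by
  obtain ⟨h1, h2, h3⟩ := h
  obtain ⟨h1', h2', h3'⟩ := h'
  have hi : i = i' := by
    by_contra hne
    exact lt_asymm (h2 i' (Ne.symm hne)) (h2' i hne)
  refine ⟨hi, ?_⟩
  by_contra hne
  exact lt_asymm (h3 j' (by rw [hi]; exact h1'.symm) (Ne.symm hne))
    (h3' j (by rw [← hi]; exact h1.symm) hne)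

theorem Good.exists [Fact (1 < n)] {x : ZMod n → Fin q} (hG : Good ℓ x) :
    ∃ ab : ZMod n × ZMod n, IsAB ℓ x ab.1 ab.2 := by
  haveI : NeZero n := ⟨by have := Fact.out (p := 1 < n); omega⟩
  obtain ⟨i, -, hi⟩ := Finset.exists_min_image (Finset.univ : Finset (ZMod n)) (win ℓ x)
    ⟨0, Finset.mem_univ _⟩
  have hne : (Finset.univ.erase i : Finset (ZMod n)).Nonempty := by
    obtain ⟨j, hj⟩ := exists_ne i
    exact ⟨j, by simp [hj]⟩
  obtain ⟨j, hj, hj'⟩ := Finset.exists_min_image (Finset.univ.erase i : Finset (ZMod n))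
    (win ℓ x) hne
  have hji : j ≠ i := by simpa using hj
  refine ⟨(i, j), hji.symm, ?_, ?_⟩
  · intro m hm
    exact lt_of_le_of_ne (hi m (Finset.mem_univ _)) (fun h => hm (hG h).symm)
  · intro m hm hm'
    exact lt_of_le_of_ne (hj' m (by simp [hm])) (fun h => hm' (hG h).symm)

/-- The pair of positions of the two smallest windows. -/
noncomputable def AB (ℓ : ℕ) (x : ZMod n → Fin q) : ZMod n × ZMod n :=
  if h : ∃ ab : ZMod n × ZMod n, IsAB ℓ x ab.1 ab.2 then h.choose else (0, 0)

theorem AB_spec [Fact (1 < n)] {x : ZMod n → Fin q} (hG : Good ℓ x) :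
    IsAB ℓ x (AB ℓ x).1 (AB ℓ x).2 := by
  have h := hG.exists
  rw [AB, dif_pos h]
  exact h.choose_spec

theorem AB_eq [Fact (1 < n)] {x : ZMod n → Fin q} (hG : Good ℓ x) {i j : ZMod n}
    (h : IsAB ℓ x i j) : AB ℓ x = (i, j) := by
  have := (AB_spec hG).unique h
  exact Prod.ext this.1 this.2

/-- Rotation of cyclic words. -/
def rot (p : ZMod n) : (ZMod n → Fin q) ≃ (ZMod n → Fin q) where
  toFun x := fun c => x (c + p)
  invFun x := fun c => x (c - p)
  left_inv x := by ext c; simp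
  right_inv x := by ext c; simp

@[simp] theorem rot_apply (p : ZMod n) (x : ZMod n → Fin q) (c : ZMod n) :
    rot p x c = x (c + p) := rfl

theorem win_rot (p : ZMod n) (x : ZMod n → Fin q) (i : ZMod n) :
    win ℓ (rot p x) i = win ℓ x (i + p) := by
  unfold win
  congr 1
  ext t
  simp [add_right_comm]

theorem good_rot (p : ZMod n) (x : ZMod n → Fin q) : Good ℓ (rot p x) ↔ Good ℓ x := by
  unfold Good
  constructor
  · intro h i j hij
    have := @h (i - p) (j - p) (by simpa [win_rot] using hij)
    simpa using this
  · intro h i j hij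
    have := @h (i + p) (j + p) (by simpa [win_rot] using hij)
    simpa using this

theorem isAB_rot (p : ZMod n) (x : ZMod n → Fin q) (i j : ZMod n) (h : IsAB ℓ x i j) :
    IsAB ℓ (rot p x) (i - p) (j - p) := by
  obtain ⟨h1, h2, h3⟩ := h
  refine ⟨by simpa using h1, ?_, ?_⟩
  · intro m hm
    rw [win_rot, win_rot, sub_add_cancel]
    exact h2 _ (fun h => hm (by rw [← h]; simp))
  · intro m hm hm'
    rw [win_rot, win_rot, sub_add_cancel]
    exact h3 _ (fun h => hm (by rw [← h]; simp)) (fun h => hm' (by rw [← h]; simp))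

theorem AB_rot [Fact (1 < n)] (p : ZMod n) {x : ZMod n → Fin q} (hG : Good ℓ x) :
    AB ℓ (rot p x) = ((AB ℓ x).1 - p, (AB ℓ x).2 - p) :=
  AB_eq ((good_rot p x).2 hG) (isAB_rot p x _ _ (AB_spec hG))

/-- The set of good words. -/
noncomputable def GoodS (n q ℓ : ℕ) [NeZero n] : Finset (ZMod n → Fin q) :=
  Finset.univ.filter (Good ℓ)

@[simp] theorem mem_GoodS [NeZero n] {x : ZMod n → Fin q} : x ∈ GoodS n q ℓ ↔ Good ℓ x := by
  simp [GoodS]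

/-- Good words whose smallest window is at `0`. -/
noncomputable def Good0 (n q ℓ : ℕ) [NeZero n] : Finset (ZMod n → Fin q) :=
  (GoodS n q ℓ).filter fun x => (AB ℓ x).1 = 0

theorem sum_a_eq [NeZero n] [Fact (1 < n)] (f : ZMod n → ℝ) (p : ZMod n) :
    ∑ x ∈ (GoodS n q ℓ).filter (fun x => (AB ℓ x).1 = p), f ((AB ℓ x).2 - (AB ℓ x).1)
      = ∑ x ∈ Good0 n q ℓ, f ((AB ℓ x).2) := by
  refine Finset.sum_equiv (rot p) ?_ ?_
  · intro x
    simp only [Good0, Finset.mem_filter, mem_GoodS, good_rot]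
    constructor
    · rintro ⟨h1, h2⟩
      exact ⟨h1, by rw [AB_rot p h1]; simp [h2]⟩
    · rintro ⟨h1, h2⟩
      rw [AB_rot p h1] at h2
      exact ⟨h1, sub_eq_zero.1 h2⟩
  · intro x hx
    simp only [Finset.mem_filter, mem_GoodS] at hx
    rw [AB_rot p hx.1, hx.2]

theorem sum_a_mem [NeZero n] [Fact (1 < n)] (f : ZMod n → ℝ) (I : Finset (ZMod n)) :
    ∑ x ∈ (GoodS n q ℓ).filter (fun x => (AB ℓ x).1 ∈ I), f ((AB ℓ x).2 - (AB ℓ x).1)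
      = I.card * ∑ x ∈ Good0 n q ℓ, f ((AB ℓ x).2) := by
  have h1 : ∑ x ∈ (GoodS n q ℓ).filter (fun x => (AB ℓ x).1 ∈ I), f ((AB ℓ x).2 - (AB ℓ x).1)
      = ∑ p ∈ I, ∑ x ∈ (GoodS n q ℓ).filter (fun x => (AB ℓ x).1 = p),
          f ((AB ℓ x).2 - (AB ℓ x).1) := by
    rw [← Finset.sum_fiberwise_of_maps_to (s := (GoodS n q ℓ).filter (fun x => (AB ℓ x).1 ∈ I))
      (t := I) (g := fun x => (AB ℓ x).1)]
    · refine Finset.sum_congr rfl fun p hp => ?_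
      refine Finset.sum_congr ?_ fun _ _ => rfl
      ext x
      simp only [Finset.mem_filter]
      constructor
      · rintro ⟨⟨h1, -⟩, h3⟩; exact ⟨h1, h3⟩
      · rintro ⟨h1, h3⟩; exact ⟨⟨h1, by rw [h3]; exact hp⟩, h3⟩
    · intro x hx
      exact (Finset.mem_filter.1 hx).2
  rw [h1, Finset.sum_congr rfl (fun p _ => sum_a_eq f p)]
  simp

theorem card_a_mem [NeZero n] [Fact (1 < n)] (I : Finset (ZMod n)) :
    (((GoodS n q ℓ).filter (fun x => (AB ℓ x).1 ∈ I)).card : ℝ)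
      = I.card * (Good0 n q ℓ).card := by
  have := sum_a_mem (n := n) (q := q) (ℓ := ℓ) (fun _ => 1) I
  simpa using this

theorem card_good [NeZero n] [Fact (1 < n)] :
    ((GoodS n q ℓ).card : ℝ) = n * (Good0 n q ℓ).card := by
  have := card_a_mem (n := n) (q := q) (ℓ := ℓ) Finset.univ
  simpa [ZMod.card] using this

theorem card_b_eq [NeZero n] [Fact (1 < n)] (p : ZMod n) :
    ((GoodS n q ℓ).filter (fun x => (AB ℓ x).2 = p)).card
      = ((GoodS n q ℓ).filter (fun x => (AB ℓ x).2 = 0)).card := by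
  refine Finset.card_equiv (rot p) ?_
  intro x
  simp only [Finset.mem_filter, mem_GoodS, good_rot]
  constructor
  · rintro ⟨h1, h2⟩
    exact ⟨h1, by rw [AB_rot p h1]; simp [h2]⟩
  · rintro ⟨h1, h2⟩
    rw [AB_rot p h1] at h2
    exact ⟨h1, sub_eq_zero.1 h2⟩

theorem card_b_mem_aux [NeZero n] [Fact (1 < n)] (I : Finset (ZMod n)) :
    ((GoodS n q ℓ).filter (fun x => (AB ℓ x).2 ∈ I)).card
      = I.card * ((GoodS n q ℓ).filter (fun x => (AB ℓ x).2 = 0)).card := by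
  rw [Finset.card_eq_sum_card_fiberwise (f := fun x => (AB ℓ x).2) (t := I)]
  · rw [Finset.sum_congr rfl (g := fun _ =>
      ((GoodS n q ℓ).filter (fun x => (AB ℓ x).2 = 0)).card)]
    · simp
    · intro p hp
      rw [← card_b_eq p]
      congr 1
      ext x
      simp only [Finset.mem_filter]
      constructor
      · rintro ⟨⟨h1, -⟩, h3⟩; exact ⟨h1, h3⟩
      · rintro ⟨h1, h3⟩; exact ⟨⟨h1, by rw [h3]; exact hp⟩, h3⟩
  · intro x hx
    exact (Finset.mem_filter.1 hx).2

theorem card_b_mem [NeZero n] [Fact (1 < n)] (I : Finset (ZMod n)) :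
    (((GoodS n q ℓ).filter (fun x => (AB ℓ x).2 ∈ I)).card : ℝ)
      = I.card * (Good0 n q ℓ).card := by
  have h1 := card_b_mem_aux (n := n) (q := q) (ℓ := ℓ) I
  have h2 := card_b_mem_aux (n := n) (q := q) (ℓ := ℓ) Finset.univ
  have h3 := card_good (n := n) (q := q) (ℓ := ℓ)
  simp only [Finset.mem_univ, Finset.filter_true, Finset.card_univ, ZMod.card] at h2
  have hn : (n : ℝ) ≠ 0 := Nat.cast_ne_zero.2 (NeZero.ne n)
  rw [h2] at h3
  push_cast at h3
  rw [h1]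
  push_cast
  rw [mul_left_cancel₀ hn h3]

/-- First-difference criterion for the order on windows. -/
theorem win_le {x : ZMod n → Fin q} {i j : ZMod n} {t : ℕ}
    (h1 : ∀ s < t, x (i + (s : ZMod n)) = x (j + (s : ZMod n)))
    (h2 : x (i + (t : ZMod n)) < x (j + (t : ZMod n))) : win ℓ x i ≤ win ℓ x j := by
  by_cases ht : t < ℓ
  · apply le_of_lt
    refine ⟨⟨t, ht⟩, ?_, h2⟩
    intro s hs
    exact h1 s hs
  · apply le_of_eq
    unfold win
    congr 1
    ext s
    rw [h1 s (by omega)]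

theorem win_lt_iff {x : ZMod n → Fin q} {i j : ZMod n} : win ℓ x i < win ℓ x j ↔
    ∃ t < ℓ, (∀ s < t, x (i + (s : ZMod n)) = x (j + (s : ZMod n))) ∧
      x (i + (t : ZMod n)) < x (j + (t : ZMod n)) := by
  constructor
  · rintro ⟨t, h1, h2⟩
    exact ⟨t, t.2, fun s hs => h1 ⟨s, hs.trans t.2⟩ hs, h2⟩
  · rintro ⟨t, ht, h1, h2⟩
    exact ⟨⟨t, ht⟩, fun s hs => h1 s hs, h2⟩

theorem win_eq_iff {x : ZMod n → Fin q} {y : ZMod n → Fin q} {i j : ZMod n} :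
    win ℓ x i = win ℓ y j ↔
    ∀ s < ℓ, x (i + (s : ZMod n)) = y (j + (s : ZMod n)) := by
  constructor
  · intro h s hs
    exact congrFun (toLex.injective h) ⟨s, hs⟩
  · intro h
    unfold win
    congr 1
    ext s
    rw [h s s.2]

end LW


/-! ### Counting lemmas -/

namespace LW

variable {n q ℓ : ℕ}

theorem card_le_of_det [NeZero n] (S : Finset (ZMod n)) (P : Finset (ZMod n → Fin q))
    (h : ∀ x ∈ P, ∀ y ∈ P, (∀ c, c ∉ S → x c = y c) → x = y) :
    P.card ≤ q ^ (n - S.card) := by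
  have h1 : P.card ≤ (Finset.univ : Finset ({c : ZMod n // c ∉ S} → Fin q)).card := by
    refine Finset.card_le_card_of_injOn (fun x c => x c.1) (fun _ _ => Finset.mem_coe.2 (Finset.mem_univ _)) ?_
    intro x hx y hy hxy
    exact h x hx y hy (fun c hc => congrFun hxy ⟨c, hc⟩)
  refine h1.trans (le_of_eq ?_)
  rw [Finset.card_univ, Fintype.card_fun, Fintype.card_fin]
  congr 1
  rw [Fintype.card_subtype_compl, ZMod.card]
  simp

theorem natCast_inj_lt {a b : ℕ} (ha : a < n) (hb : b < n) (h : (a : ZMod n) = b) : a = b := by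
  have := congrArg ZMod.val h
  rwa [ZMod.val_cast_of_lt ha, ZMod.val_cast_of_lt hb] at this

/-- The interval of positions `[j, j + ℓ)`. -/
noncomputable def itv (j : ZMod n) (ℓ : ℕ) : Finset (ZMod n) :=
  (Finset.range ℓ).image fun s : ℕ => j + (s : ZMod n)

theorem mem_itv {j : ZMod n} {c : ZMod n} : c ∈ itv j ℓ ↔ ∃ s < ℓ, j + (s : ZMod n) = c := by
  simp [itv]

theorem card_itv (j : ZMod n) (h : ℓ ≤ n) : (itv j ℓ).card = ℓ := by
  unfold itv
  rw [Finset.card_image_of_injOn, Finset.card_range]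
  intro a ha b hb hab
  simp only [Finset.coe_range, Set.mem_Iio] at ha hb
  exact natCast_inj_lt (ha.trans_le h) (hb.trans_le h) (add_left_cancel hab)

theorem card_itv_le (j : ZMod n) : (itv j ℓ).card ≤ ℓ := by
  unfold itv
  exact Finset.card_image_le.trans (by simp)

theorem card_same_win [NeZero n] (hℓ : 2 * ℓ ≤ n) {i j : ZMod n} (hij : i ≠ j)
    (hd : 2 * (j - i).val ≤ n) :
    (Finset.univ.filter fun x : ZMod n → Fin q => win ℓ x i = win ℓ x j).card ≤ q ^ (n - ℓ) := by
  have key := card_le_of_det (itv j ℓ)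
    (Finset.univ.filter fun x : ZMod n → Fin q => win ℓ x i = win ℓ x j) ?_
  · rwa [card_itv j (by omega)] at key
  intro x hx y hy hxy
  simp only [Finset.mem_filter, Finset.mem_univ, true_and, win_eq_iff] at hx hy
  set D := (j - i).val with hD
  have hDi : j = i + (D : ZMod n) := by rw [hD, ZMod.natCast_zmod_val]; ring
  have hD0 : 0 < D := by
    rw [Nat.pos_iff_ne_zero]
    intro h0
    rw [h0] at hDi
    simp at hDi
    exact hij hDi.symm
  have key : ∀ s < ℓ, x (j + (s : ZMod n)) = y (j + (s : ZMod n)) := by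
    intro s
    induction s using Nat.strong_induction_on with
    | _ s ih =>
      intro hs
      rw [← hx s hs, ← hy s hs]
      by_cases hsD : D ≤ s
      · have : i + (s : ZMod n) = j + ((s - D : ℕ) : ZMod n) := by
          rw [hDi, Nat.cast_sub hsD]; ring
        rw [this]
        exact ih (s - D) (by omega) (by omega)
      · apply hxy
        rw [mem_itv]
        rintro ⟨s', hs', h⟩
        rw [hDi, add_assoc] at h
        have h2 := add_left_cancel h
        have h3 := natCast_inj_lt (n := n) (a := D + s') (b := s) (by omega) (by omega)
          (by push_cast; exact h2)
        omega
  ext1 c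
  by_cases hc : c ∈ itv j ℓ
  · obtain ⟨s, hs, rfl⟩ := mem_itv.1 hc
    exact key s hs
  · exact hxy c hc

theorem card_not_good [NeZero n] (hℓ : 2 * ℓ ≤ n) :
    (Finset.univ.filter fun x : ZMod n → Fin q => ¬ Good ℓ x).card ≤ n ^ 2 * q ^ (n - ℓ) := by
  have hsub : (Finset.univ.filter fun x : ZMod n → Fin q => ¬ Good ℓ x) ⊆
      ((Finset.univ : Finset (ZMod n × ZMod n)).filter
        (fun p => p.1 ≠ p.2 ∧ 2 * (p.2 - p.1).val ≤ n)).biUnion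
        (fun p => Finset.univ.filter fun x : ZMod n → Fin q => win ℓ x p.1 = win ℓ x p.2) := by
    intro x hx
    have hx := (Finset.mem_filter.1 hx).2
    unfold Good Function.Injective at hx
    push Not at hx
    obtain ⟨i, j, h1, h2⟩ := hx
    simp only [Finset.mem_biUnion, Finset.mem_filter, Finset.mem_univ, true_and]
    by_cases hd : 2 * (j - i).val ≤ n
    · exact ⟨(i, j), ⟨h2, hd⟩, h1⟩
    · refine ⟨(j, i), ⟨h2.symm, ?_⟩, h1.symm⟩
      have h3 : j - i ≠ 0 := sub_ne_zero.2 h2.symm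
      have : (i - j).val = n - (j - i).val := by
        rw [← neg_sub j i, ZMod.neg_val, if_neg h3]
      simp only [this]
      omega
  refine (Finset.card_le_card hsub).trans ?_
  refine (Finset.card_biUnion_le_card_mul _ _ (q ^ (n - ℓ)) ?_).trans ?_
  · intro p hp
    simp only [Finset.mem_filter, Finset.mem_univ, true_and] at hp
    exact card_same_win hℓ hp.1 hp.2
  · gcongr
    refine (Finset.card_filter_le _ _).trans (le_of_eq ?_)
    rw [Finset.card_univ, Fintype.card_prod, ZMod.card, sq]

theorem card_zeros [NeZero n] [NeZero q] (S : Finset (ZMod n)) :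
    (Finset.univ.filter fun x : ZMod n → Fin q => ∀ c ∈ S, x c = 0).card ≤ q ^ (n - S.card) := by
  apply card_le_of_det
  intro x hx y hy hxy
  simp only [Finset.mem_filter, Finset.mem_univ, true_and] at hx hy
  ext1 c
  by_cases hc : c ∈ S
  · rw [hx c hc, hy c hc]
  · exact hxy c hc

/-- Words with no run of `T` zeros. -/
theorem card_no_run [NeZero n] [NeZero q] (T K : ℕ) (hT : 0 < T) (hK : K * T ≤ n) :
    (Finset.univ.filter fun x : ZMod n → Fin q =>
      ¬ ∃ p : ZMod n, ∀ s < T, x (p + (s : ZMod n)) = 0).card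
      ≤ (q ^ T - 1) ^ K * q ^ (n - K * T) := by
  have h1 : (Finset.univ.filter fun x : ZMod n → Fin q =>
      ¬ ∃ p : ZMod n, ∀ s < T, x (p + (s : ZMod n)) = 0).card ≤
      ((Fintype.piFinset fun _ : Fin K =>
        (Finset.univ.erase 0 : Finset (Fin T → Fin q))) ×ˢ
        (Finset.univ : Finset (Fin (n - K * T) → Fin q))).card := by
    refine Finset.card_le_card_of_injOn
      (fun x => (fun c s => x (((c : ℕ) * T + (s : ℕ) : ℕ) : ZMod n),
        fun s => x ((K * T + (s : ℕ) : ℕ) : ZMod n))) ?_ ?_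
    · intro x hx
      simp only [Finset.coe_filter, Finset.mem_univ, true_and, Set.mem_ofPred_eq] at hx
      simp only [Finset.coe_product, Set.mem_prod, Finset.mem_coe, Fintype.mem_piFinset,
        Finset.mem_erase, Finset.mem_univ, and_true]
      intro c h0
      apply hx
      refine ⟨((c : ℕ) * T : ℕ), fun s hs => ?_⟩
      have := congrFun h0 ⟨s, hs⟩
      simpa using this
    · intro x _ y _ hxy
      simp only [Prod.mk.injEq] at hxy
      obtain ⟨e1, e2⟩ := hxy
      ext1 c
      rw [← ZMod.natCast_zmod_val c]
      have hc := ZMod.val_lt c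
      set v := c.val
      by_cases hv : v < K * T
      · have h3 := congrFun (congrFun e1 ⟨v / T, (Nat.div_lt_iff_lt_mul hT).2 hv⟩)
          ⟨v % T, Nat.mod_lt _ hT⟩
        simp only [Nat.div_add_mod'] at h3
        exact h3
      · have h3 := congrFun e2 ⟨v - K * T, by omega⟩
        simp only [Nat.add_sub_cancel' (not_lt.1 hv)] at h3
        exact h3
  refine h1.trans (le_of_eq ?_)
  rw [Finset.card_product, Fintype.card_piFinset]
  simp

theorem win_le_succ [NeZero q] {x : ZMod n → Fin q} {p : ZMod n} (h : x p = 0) :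
    win ℓ x p ≤ win ℓ x (p + 1) := by
  by_contra hlt
  obtain ⟨t, ht, h1, h2⟩ := win_lt_iff.1 (not_le.1 hlt)
  have key : ∀ s ≤ t, x (p + (s : ZMod n)) = 0 := by
    intro s
    induction s with
    | zero => intro _; simpa using h
    | succ s ih =>
      intro hs
      have := h1 s (by omega)
      rw [ih (by omega)] at this
      rw [← this]
      congr 1
      push_cast
      ring
  rw [key t le_rfl] at h2
  exact absurd h2 (by simp)

theorem win_le_add [NeZero q] {x : ZMod n → Fin q} {p : ZMod n} (d : ℕ)
    (h : ∀ s < d, x (p + (s : ZMod n)) = 0) : win ℓ x p ≤ win ℓ x (p + (d : ZMod n)) := by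
  induction d with
  | zero => simp
  | succ d ih =>
    refine (ih fun s hs => h s (by omega)).trans ?_
    have := win_le_succ (ℓ := ℓ) (h d (by omega))
    refine this.trans (le_of_eq ?_)
    congr 1
    push_cast
    ring

/-- a window not larger than one starting with zeros starts with zeros -/
theorem zeros_of_win_le [NeZero q] {x : ZMod n → Fin q} {i j : ZMod n} {t : ℕ} (ht : t ≤ ℓ)
    (hle : win ℓ x i ≤ win ℓ x j) (h : ∀ s < t, x (j + (s : ZMod n)) = 0) :
    ∀ s < t, x (i + (s : ZMod n)) = 0 := by
  rcases hle.lt_or_eq with hlt | heq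
  · obtain ⟨u, hu, h1, h2⟩ := win_lt_iff.1 hlt
    have hut : t ≤ u := by
      by_contra hc
      rw [h u (by omega)] at h2
      exact absurd h2 (by simp)
    intro s hs
    rw [h1 s (by omega), h s hs]
  · rw [win_eq_iff] at heq
    intro s hs
    rw [heq s (by omega), h s hs]

/-- Good words with both smallest windows in `[0, h)`, not shifted by one. -/
noncomputable def Near (n q ℓ h : ℕ) [NeZero n] : Finset (ZMod n → Fin q) :=
  (GoodS n q ℓ).filter fun x => (AB ℓ x).1.val < h ∧ (AB ℓ x).2.val < h ∧
    (AB ℓ x).2 ≠ (AB ℓ x).1 + 1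

theorem card_near [NeZero n] [Fact (1 < n)] [NeZero q] {t h K : ℕ} (ht : t + 1 ≤ ℓ)
    (hh : h + t ≤ n) (hK : K * (t + 1) ≤ n) :
    (Near n q ℓ h).card ≤ h ^ 2 * q ^ (n - 2 * t) +
      (q ^ (t + 1) - 1) ^ K * q ^ (n - K * (t + 1)) := by
  let E : ℕ × ℕ → Finset (ZMod n → Fin q) := fun p =>
    Finset.univ.filter fun x : ZMod n → Fin q => ∀ c ∈ itv (p.1 : ZMod n) t ∪ itv (p.2 : ZMod n) t,
      x c = 0
  let Q := (Finset.range h ×ˢ Finset.range h).filter fun p : ℕ × ℕ => p.1 + t ≤ p.2 ∨ p.2 + t ≤ p.1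
  have hsub : Near n q ℓ h ⊆ Q.biUnion E ∪ (Finset.univ.filter fun x : ZMod n → Fin q =>
      ¬ ∃ p : ZMod n, ∀ s < t + 1, x (p + (s : ZMod n)) = 0) := by
    intro x hx
    simp only [Near, Finset.mem_filter, mem_GoodS] at hx
    obtain ⟨hG, ha, hb, hab⟩ := hx
    rw [Finset.mem_union]
    by_cases hrun : ∃ p : ZMod n, ∀ s < t + 1, x (p + (s : ZMod n)) = 0
    swap
    · right; simp only [Finset.mem_filter, Finset.mem_univ, true_and]; exact hrun
    left
    obtain ⟨h1, h2, h3⟩ := AB_spec hG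
    set a := (AB ℓ x).1
    set b := (AB ℓ x).2
    obtain ⟨p, hp⟩ := hrun
    have hap : win ℓ x a ≤ win ℓ x p := by
      by_cases hpa : p = a
      · rw [hpa]
      · exact (h2 p hpa).le
    have za := zeros_of_win_le ht hap hp
    have za1 : ∀ s < t, x (a + 1 + (s : ZMod n)) = 0 := by
      intro s hs
      have := za (s + 1) (by omega)
      rw [← this]; congr 1; push_cast; ring
    have hba : win ℓ x b ≤ win ℓ x (a + 1) := (h3 (a + 1) (by simp) (Ne.symm hab)).le
    have zb := zeros_of_win_le (by omega) hba za1
    have hav : ((a.val : ℕ) : ZMod n) = a := ZMod.natCast_zmod_val a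
    have hbv : ((b.val : ℕ) : ZMod n) = b := ZMod.natCast_zmod_val b
    rw [Finset.mem_biUnion]
    refine ⟨(a.val, b.val), ?_, ?_⟩
    · simp only [Q, Finset.mem_filter, Finset.mem_product, Finset.mem_range]
      refine ⟨⟨ha, hb⟩, ?_⟩
      by_contra hcon
      push Not at hcon
      rcases lt_trichotomy a.val b.val with hlt | heq | hgt
      · have hb' : b = a + 1 + ((b.val - a.val - 1 : ℕ) : ZMod n) := by
          have e : b.val = a.val + 1 + (b.val - a.val - 1) := by omega
          calc b = ((b.val : ℕ) : ZMod n) := hbv.symm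
            _ = ((a.val + 1 + (b.val - a.val - 1) : ℕ) : ZMod n) := by rw [← e]
            _ = _ := by push_cast; rw [hav]
        have := win_le_add (ℓ := ℓ) (p := a + 1) (x := x) (b.val - a.val - 1)
          (fun s hs => za1 s (by omega))
        rw [← hb'] at this
        exact absurd (h3 (a + 1) (by simp) (Ne.symm hab)) (not_lt.2 this)
      · exact h1 (ZMod.val_injective n heq)
      · have ha' : a = b + ((a.val - b.val : ℕ) : ZMod n) := by
          have e : a.val = b.val + (a.val - b.val) := by omega
          calc a = ((a.val : ℕ) : ZMod n) := hav.symm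
            _ = ((b.val + (a.val - b.val) : ℕ) : ZMod n) := by rw [← e]
            _ = _ := by push_cast; rw [hbv]
        have := win_le_add (ℓ := ℓ) (p := b) (x := x) (a.val - b.val)
          (fun s hs => zb s (by omega))
        rw [← ha'] at this
        exact absurd (h2 b (Ne.symm h1)) (not_lt.2 this)
    · simp only [E, Finset.mem_filter, Finset.mem_univ, true_and, Finset.mem_union, hav, hbv]
      rintro c (hc | hc)
      · obtain ⟨s, hs, rfl⟩ := mem_itv.1 hc
        exact za s (by omega)
      · obtain ⟨s, hs, rfl⟩ := mem_itv.1 hc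
        exact zb s hs
  refine (Finset.card_le_card hsub).trans ((Finset.card_union_le _ _).trans ?_)
  refine Nat.add_le_add ?_ (card_no_run (t + 1) K (by omega) hK)
  refine (Finset.card_biUnion_le_card_mul _ _ (q ^ (n - 2 * t)) ?_).trans ?_
  · rintro ⟨i, j⟩ hp
    simp only [Q, Finset.mem_filter, Finset.mem_product, Finset.mem_range] at hp
    refine (card_zeros _).trans (le_of_eq ?_)
    rw [Finset.card_union_of_disjoint, card_itv _ (by omega), card_itv _ (by omega), two_mul]
    rw [Finset.disjoint_left]
    intro c hc hc'
    obtain ⟨s, hs, rfl⟩ := mem_itv.1 hc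
    obtain ⟨s', hs', h'⟩ := mem_itv.1 hc'
    have := natCast_inj_lt (n := n) (a := j + s') (b := i + s) (by omega) (by omega)
      (by push_cast; exact h')
    omega
  · gcongr
    refine (Finset.card_filter_le _ _).trans (le_of_eq ?_)
    rw [Finset.card_product, Finset.card_range, sq]

end LW


/-! ### Block rotation -/

namespace LW

variable {n q ℓ h r : ℕ}

/-- Positions are permuted by fixing `[0, h)` and rotating `[h, n)` by `r`. -/
noncomputable def tauF (n h r : ℕ) (p : ZMod n) : ZMod n :=
  if p.val < h then p else ((h + (p.val - h + r) % (n - h) : ℕ) : ZMod n)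

theorem tauF_lt {p : ZMod n} (hp : p.val < h) : tauF n h r p = p := by simp [tauF, hp]

theorem tauF_val_ge (hh : h < n) {p : ZMod n} (hp : h ≤ p.val) :
    (tauF n h r p).val = h + (p.val - h + r) % (n - h) := by
  have h1 : (p.val - h + r) % (n - h) < n - h := Nat.mod_lt _ (by omega)
  rw [tauF, if_neg (by omega), ZMod.val_cast_of_lt (by omega)]

theorem tauF_val_lt_iff (hh : h < n) {p : ZMod n} : (tauF n h r p).val < h ↔ p.val < h := by
  by_cases hp : p.val < h
  · simp [tauF_lt hp, hp]
  · rw [tauF_val_ge hh (by omega)]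
    omega

theorem tauF_inj [NeZero n] (hh : h < n) : Function.Injective (tauF n h r) := by
  intro p p' hpp
  have hv := congrArg ZMod.val hpp
  by_cases hp : p.val < h
  · have hp' : p'.val < h := by
      rw [← tauF_val_lt_iff (r := r) hh, ← hpp, tauF_val_lt_iff hh]; exact hp
    rwa [tauF_lt hp, tauF_lt hp'] at hpp
  · have hp' : ¬ p'.val < h := by
      rw [← tauF_val_lt_iff (r := r) hh, ← hpp, tauF_val_lt_iff hh]; exact hp
    rw [tauF_val_ge hh (by omega), tauF_val_ge hh (by omega)] at hv
    have h1 : (p.val - h + r) ≡ (p'.val - h + r) [MOD (n - h)] := by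
      unfold Nat.ModEq; omega
    have h2 := Nat.ModEq.add_right_cancel' r h1
    have l1 := ZMod.val_lt p
    have l2 := ZMod.val_lt p'
    have h3 := Nat.ModEq.eq_of_lt_of_lt h2 (by omega) (by omega)
    exact ZMod.val_injective n (by omega)

/-- The permutation of positions. -/
noncomputable def tau [NeZero n] (hh : h < n) (r : ℕ) : ZMod n ≃ ZMod n :=
  Equiv.ofBijective (tauF n h r) (Finite.injective_iff_bijective.1 (tauF_inj hh))

theorem tau_apply [NeZero n] (hh : h < n) (p : ZMod n) : tau hh r p = tauF n h r p := rfl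

/-- Positions whose window is broken by the permutation. -/
noncomputable def Bd (n h r ℓ : ℕ) : Finset (ZMod n) :=
  itv ((h - ℓ : ℕ) : ZMod n) ℓ ∪ itv ((n - ℓ : ℕ) : ZMod n) ℓ ∪ itv ((n - r - ℓ : ℕ) : ZMod n) ℓ

theorem card_Bd : (Bd n h r ℓ).card ≤ 3 * ℓ := by
  unfold Bd
  have h1 := Finset.card_union_le (itv ((h - ℓ : ℕ) : ZMod n) ℓ ∪ itv ((n - ℓ : ℕ) : ZMod n) ℓ)
    (itv ((n - r - ℓ : ℕ) : ZMod n) ℓ)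
  have h2 := Finset.card_union_le (itv ((h - ℓ : ℕ) : ZMod n) ℓ) (itv ((n - ℓ : ℕ) : ZMod n) ℓ)
  have a1 := card_itv_le (ℓ := ℓ) ((h - ℓ : ℕ) : ZMod n)
  have a2 := card_itv_le (ℓ := ℓ) ((n - ℓ : ℕ) : ZMod n)
  have a3 := card_itv_le (ℓ := ℓ) ((n - r - ℓ : ℕ) : ZMod n)
  omega

theorem mem_itv_of_val [NeZero n] {p : ZMod n} {m : ℕ} (h1 : m ≤ p.val) (h2 : p.val < m + ℓ) :
    p ∈ itv (m : ZMod n) ℓ := by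
  rw [mem_itv]
  refine ⟨p.val - m, by omega, ?_⟩
  rw [← Nat.cast_add, Nat.add_sub_cancel' h1, ZMod.natCast_zmod_val]

theorem tau_add [NeZero n] (hh : h < n) (hℓ : ℓ ≤ h) (hr : r < n - h) {p : ZMod n}
    (hp : p ∉ Bd n h r ℓ) : ∀ s < ℓ, tau hh r (p + (s : ZMod n)) = tau hh r p + (s : ZMod n) := by
  intro s hs
  simp only [Bd, Finset.mem_union, not_or] at hp
  obtain ⟨⟨b1, b2⟩, b3⟩ := hp
  have hpl := ZMod.val_lt p
  have c1 : ¬ (h - ℓ ≤ p.val ∧ p.val < h - ℓ + ℓ) := fun hc => b1 (mem_itv_of_val hc.1 hc.2)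
  have c2 : ¬ (n - ℓ ≤ p.val ∧ p.val < n - ℓ + ℓ) := fun hc => b2 (mem_itv_of_val hc.1 hc.2)
  have c3 : ¬ (n - r - ℓ ≤ p.val ∧ p.val < n - r - ℓ + ℓ) :=
    fun hc => b3 (mem_itv_of_val hc.1 hc.2)
  have hv : (p + (s : ZMod n)).val = p.val + s := by
    have e : p + (s : ZMod n) = ((p.val + s : ℕ) : ZMod n) := by
      push_cast; rw [ZMod.natCast_zmod_val]
    rw [e, ZMod.val_cast_of_lt (by omega)]
  rw [tau_apply, tau_apply]
  by_cases hph : p.val < h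
  · rw [tauF_lt hph, tauF_lt (by omega)]
  · rw [tauF, tauF, if_neg hph, if_neg (by omega), hv]
    rw [← Nat.cast_add]
    congr 1
    rw [add_assoc]
    congr 1
    by_cases hc : p.val - h + r < n - h
    · rw [Nat.mod_eq_of_lt hc, Nat.mod_eq_of_lt (by omega)]
      omega
    · rw [Nat.mod_eq_sub_mod (by omega), Nat.mod_eq_sub_mod (a := p.val - h + r) (by omega),
        Nat.mod_eq_of_lt (by omega), Nat.mod_eq_of_lt (by omega)]
      omega

/-- Action on words. -/
def act (e : ZMod n ≃ ZMod n) : (ZMod n → Fin q) ≃ (ZMod n → Fin q) where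
  toFun x := fun c => x (e.symm c)
  invFun x := fun c => x (e c)
  left_inv x := by ext c; simp
  right_inv x := by ext c; simp

theorem act_apply (e : ZMod n ≃ ZMod n) (x : ZMod n → Fin q) (c : ZMod n) :
    act e x c = x (e.symm c) := rfl

theorem win_act (e : ZMod n ≃ ZMod n) (x : ZMod n → Fin q) {p : ZMod n}
    (hp : ∀ s < ℓ, e (p + (s : ZMod n)) = e p + (s : ZMod n)) :
    win ℓ (act e x) (e p) = win ℓ x p := by
  rw [win_eq_iff]
  intro s hs
  rw [← hp s hs, act_apply, Equiv.symm_apply_apply]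

theorem AB_act [Fact (1 < n)] (e : ZMod n ≃ ZMod n) (B : Finset (ZMod n))
    (hB : ∀ p, p ∉ B → ∀ s < ℓ, e (p + (s : ZMod n)) = e p + (s : ZMod n))
    {x : ZMod n → Fin q} (hG : Good ℓ x) (hG' : Good ℓ (act e x))
    (h1 : (AB ℓ x).1 ∉ B) (h2 : (AB ℓ x).2 ∉ B)
    (h3 : (AB ℓ (act e x)).1 ∉ B.image e) (h4 : (AB ℓ (act e x)).2 ∉ B.image e) :
    (AB ℓ (act e x)).1 = e (AB ℓ x).1 ∧ (AB ℓ (act e x)).2 = e (AB ℓ x).2 := by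
  obtain ⟨s1, s2, s3⟩ := AB_spec hG
  obtain ⟨t1, t2, t3⟩ := AB_spec hG'
  set a := (AB ℓ x).1
  set b := (AB ℓ x).2
  set a' := (AB ℓ (act e x)).1
  set b' := (AB ℓ (act e x)).2
  obtain ⟨c, hc⟩ := e.surjective a'
  obtain ⟨d, hd⟩ := e.surjective b'
  have hcB : c ∉ B := fun hcB => h3 (Finset.mem_image.2 ⟨c, hcB, hc⟩)
  have hdB : d ∉ B := fun hdB => h4 (Finset.mem_image.2 ⟨d, hdB, hd⟩)
  have wa := win_act (ℓ := ℓ) e x (hB a h1)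
  have wb := win_act (ℓ := ℓ) e x (hB b h2)
  have wc := win_act (ℓ := ℓ) e x (hB c hcB)
  have wd := win_act (ℓ := ℓ) e x (hB d hdB)
  rw [hc] at wc
  rw [hd] at wd
  have hac : c = a := by
    by_contra hne
    have u1 := s2 c hne
    have u2 := t2 (e a) (fun hh => hne (e.injective (hc.trans hh.symm)))
    rw [wa, wc] at u2
    exact lt_asymm u1 u2
  have hbd : d = b := by
    by_contra hne
    have hda : d ≠ a := by
      intro hda
      apply t1
      rw [← hc, ← hd, hac, hda]
    have u1 := s3 d hda hne
    have u2 := t3 (e b) (fun hh => s1 (by rw [← hac]; exact e.injective (hc.trans hh.symm)))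
      (fun hh => hne (e.injective (hd.trans hh.symm)))
    rw [wb, wd] at u2
    exact lt_asymm u1 u2
  exact ⟨by rw [← hc, hac], by rw [← hd, hbd]⟩

/-- Words for which the block rotation does not act as expected. -/
noncomputable def BadS [NeZero n] (ℓ : ℕ) (e : ZMod n ≃ ZMod n) : Finset (ZMod n → Fin q) :=
  Finset.univ.filter fun x => ¬ (Good ℓ x ∧ Good ℓ (act e x) ∧
    (AB ℓ (act e x)).1 = e (AB ℓ x).1 ∧ (AB ℓ (act e x)).2 = e (AB ℓ x).2)

theorem card_BadS [NeZero n] [Fact (1 < n)] (e : ZMod n ≃ ZMod n) (B : Finset (ZMod n))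
    (hB : ∀ p, p ∉ B → ∀ s < ℓ, e (p + (s : ZMod n)) = e p + (s : ZMod n)) :
    ((BadS (q := q) ℓ e).card : ℝ) ≤
      2 * (Finset.univ.filter fun x : ZMod n → Fin q => ¬ Good ℓ x).card
        + 4 * B.card * (Good0 n q ℓ).card := by
  let U := (Finset.univ.filter fun x : ZMod n → Fin q => ¬ Good ℓ x)
  let V := fun S : Finset (ZMod n) => (GoodS n q ℓ).filter (fun x => (AB ℓ x).1 ∈ S)
  let W := fun S : Finset (ZMod n) => (GoodS n q ℓ).filter (fun x => (AB ℓ x).2 ∈ S)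
  let m : (ZMod n → Fin q) ↪ (ZMod n → Fin q) := (act e).symm.toEmbedding
  have hsub : BadS (q := q) ℓ e ⊆ (U ∪ U.map m) ∪
      ((V B ∪ W B) ∪ ((V (B.image e)).map m ∪ (W (B.image e)).map m)) := by
    intro x hx
    by_contra hcon
    have hm : ∀ S : Finset (ZMod n → Fin q), x ∈ S.map m ↔ act e x ∈ S := by
      intro S
      simp only [m, Finset.mem_map_equiv, Equiv.symm_symm]
    simp only [Finset.mem_union, not_or, hm] at hcon
    obtain ⟨⟨u1, u2⟩, ⟨v1, v2⟩, v3, v4⟩ := hcon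
    have g1 : Good ℓ x := by
      by_contra hg; exact u1 (Finset.mem_filter.2 ⟨Finset.mem_univ _, hg⟩)
    have g2 : Good ℓ (act e x) := by
      by_contra hg; exact u2 (Finset.mem_filter.2 ⟨Finset.mem_univ _, hg⟩)
    have w1 : (AB ℓ x).1 ∉ B := fun hh => v1 (Finset.mem_filter.2 ⟨mem_GoodS.2 g1, hh⟩)
    have w2 : (AB ℓ x).2 ∉ B := fun hh => v2 (Finset.mem_filter.2 ⟨mem_GoodS.2 g1, hh⟩)
    have w3 : (AB ℓ (act e x)).1 ∉ B.image e :=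
      fun hh => v3 (Finset.mem_filter.2 ⟨mem_GoodS.2 g2, hh⟩)
    have w4 : (AB ℓ (act e x)).2 ∉ B.image e :=
      fun hh => v4 (Finset.mem_filter.2 ⟨mem_GoodS.2 g2, hh⟩)
    exact (Finset.mem_filter.1 hx).2 ⟨g1, g2, AB_act e B hB g1 g2 w1 w2 w3 w4⟩
  have hc : (BadS (q := q) ℓ e).card ≤ (U.card + U.card) +
      (((V B).card + (W B).card) + ((V (B.image e)).card + (W (B.image e)).card)) := by
    refine (Finset.card_le_card hsub).trans ?_
    refine (Finset.card_union_le _ _).trans (Nat.add_le_add ?_ ?_)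
    · exact (Finset.card_union_le _ _).trans (by simp)
    · refine (Finset.card_union_le _ _).trans (Nat.add_le_add (Finset.card_union_le _ _) ?_)
      exact (Finset.card_union_le _ _).trans (by simp)
  have hc' : ((BadS (q := q) ℓ e).card : ℝ) ≤ (U.card + U.card) +
      (((V B).card + (W B).card) + ((V (B.image e)).card + (W (B.image e)).card)) := by
    exact_mod_cast hc
  have e1 := card_a_mem (n := n) (q := q) (ℓ := ℓ) B
  have e2 := card_b_mem (n := n) (q := q) (ℓ := ℓ) B
  have e3 := card_a_mem (n := n) (q := q) (ℓ := ℓ) (B.image e)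
  have e4 := card_b_mem (n := n) (q := q) (ℓ := ℓ) (B.image e)
  rw [Finset.card_image_of_injective _ e.injective] at e3 e4
  simp only [V, W] at hc'
  rw [e1, e2, e3, e4] at hc'
  linarith

/-- Good words with smallest window in `[0, h)` and second smallest in `[h, n)`. -/
noncomputable def Cross (n q ℓ h : ℕ) [NeZero n] : Finset (ZMod n → Fin q) :=
  (GoodS n q ℓ).filter fun x => (AB ℓ x).1.val < h ∧ ¬ (AB ℓ x).2.val < h

theorem sum_tau [NeZero n] (hh : h < n) (f : ZMod n → ℝ) {b : ZMod n} (hb : ¬ b.val < h) :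
    ∑ r ∈ Finset.range (n - h), f (tau hh r b)
      = ∑ z ∈ Finset.univ.filter (fun z : ZMod n => ¬ z.val < h), f z := by
  have hbl := ZMod.val_lt b
  have hinj : Set.InjOn (fun r => tau hh r b) (Finset.range (n - h) : Set ℕ) := by
    intro r hr r' hr' hrr
    simp only [Finset.coe_range, Set.mem_Iio] at hr hr'
    have hv := congrArg ZMod.val hrr
    simp only [tau_apply] at hv
    rw [tauF_val_ge hh (by omega), tauF_val_ge hh (by omega)] at hv
    have h1 : (b.val - h + r) ≡ (b.val - h + r') [MOD (n - h)] := by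
      unfold Nat.ModEq; omega
    exact Nat.ModEq.eq_of_lt_of_lt (Nat.ModEq.add_left_cancel' _ h1) hr hr'
  have hmaps : ∀ r ∈ Finset.range (n - h), tau hh r b ∈
      Finset.univ.filter (fun z : ZMod n => ¬ z.val < h) := by
    intro r _
    simp only [Finset.mem_filter, Finset.mem_univ, true_and, tau_apply]
    rw [tauF_val_lt_iff hh]
    exact hb
  have hcard : (Finset.univ.filter (fun z : ZMod n => ¬ z.val < h)).card
      ≤ (Finset.range (n - h)).card := by
    rw [Finset.card_range]
    have : (Finset.univ.filter (fun z : ZMod n => ¬ z.val < h)).card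
        ≤ (Finset.Ico h n).card := by
      refine Finset.card_le_card_of_injOn ZMod.val ?_ (fun _ _ _ _ h => ZMod.val_injective n h)
      intro z hz
      have hz := (Finset.mem_filter.1 hz).2
      have := ZMod.val_lt z
      simp only [Finset.coe_Ico, Set.mem_Ico]
      omega
    simpa using this
  refine Finset.sum_nbij (fun r => tau hh r b) hmaps hinj ?_ (fun _ _ => rfl)
  exact Finset.surjOn_of_injOn_of_card_le _ hmaps hinj hcard

theorem card_val_lt [NeZero n] (hh : h ≤ n) :
    (Finset.univ.filter (fun z : ZMod n => z.val < h)).card = h := by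
  have : (Finset.univ.filter (fun z : ZMod n => z.val < h)) = itv 0 h := by
    ext z
    simp only [Finset.mem_filter, Finset.mem_univ, true_and, mem_itv, zero_add]
    constructor
    · intro hz; exact ⟨z.val, hz, ZMod.natCast_zmod_val z⟩
    · rintro ⟨s, hs, rfl⟩
      rwa [ZMod.val_cast_of_lt (by omega)]
  rw [this, card_itv _ hh]

theorem sum_J [NeZero n] (hh : h < n) (g : ZMod n → ℝ) (g0 : ∀ z, 0 ≤ g z) (g1 : ∀ z, g z ≤ 1)
    (a : ZMod n) :
    |∑ z ∈ Finset.univ.filter (fun z : ZMod n => ¬ z.val < h), g (z - a) - ∑ z, g z| ≤ h := by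
  have e1 : ∑ z, g z = ∑ z, g (z - a) := (Equiv.sum_comp (Equiv.subRight a) g).symm
  have e2 := Finset.sum_filter_add_sum_filter_not Finset.univ (fun z : ZMod n => z.val < h)
    (fun z => g (z - a))
  have e3 : ∑ z ∈ Finset.univ.filter (fun z : ZMod n => z.val < h), g (z - a) ≤ h := by
    have := Finset.sum_le_card_nsmul (Finset.univ.filter (fun z : ZMod n => z.val < h))
      (fun z => g (z - a)) 1 (fun z _ => g1 _)
    rw [card_val_lt hh.le] at this
    simpa using this
  have e4 : 0 ≤ ∑ z ∈ Finset.univ.filter (fun z : ZMod n => z.val < h), g (z - a) :=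
    Finset.sum_nonneg (fun z _ => g0 _)
  rw [e1, ← e2, abs_le]
  constructor <;> linarith

theorem sum_cross_r [NeZero n] [Fact (1 < n)] (hh : h < n) (g : ZMod n → ℝ)
    (g0 : ∀ z, 0 ≤ g z) (g1 : ∀ z, g z ≤ 1) (r : ℕ) :
    |∑ x ∈ Cross n q ℓ h, g ((AB ℓ x).2 - (AB ℓ x).1)
      - ∑ x ∈ Cross n q ℓ h, g (tau hh r (AB ℓ x).2 - (AB ℓ x).1)|
      ≤ (BadS (q := q) ℓ (tau hh r)).card := by
  let F : (ZMod n → Fin q) → ℝ := fun x => if x ∈ Cross n q ℓ h then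
    g ((AB ℓ x).2 - (AB ℓ x).1) else 0
  let F' : (ZMod n → Fin q) → ℝ := fun x => if x ∈ Cross n q ℓ h then
    g (tau hh r (AB ℓ x).2 - (AB ℓ x).1) else 0
  have e1 : ∑ x ∈ Cross n q ℓ h, g ((AB ℓ x).2 - (AB ℓ x).1) = ∑ x, F (act (tau hh r) x) := by
    rw [Equiv.sum_comp (act (tau hh r)) F]
    simp [F]
  have e2 : ∑ x ∈ Cross n q ℓ h, g (tau hh r (AB ℓ x).2 - (AB ℓ x).1) = ∑ x, F' x := by
    simp [F']
  have hF : ∀ x, 0 ≤ F x ∧ F x ≤ 1 := by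
    intro x; simp only [F]; split_ifs
    · exact ⟨g0 _, g1 _⟩
    · simp
  have hF' : ∀ x, 0 ≤ F' x ∧ F' x ≤ 1 := by
    intro x; simp only [F']; split_ifs
    · exact ⟨g0 _, g1 _⟩
    · simp
  rw [e1, e2, ← Finset.sum_sub_distrib]
  refine (Finset.abs_sum_le_sum_abs _ _).trans ?_
  have e3 : ((BadS (q := q) ℓ (tau hh r)).card : ℝ) =
      ∑ x, if x ∈ BadS (q := q) ℓ (tau hh r) then (1 : ℝ) else 0 := by simp
  rw [e3]
  refine Finset.sum_le_sum fun x _ => ?_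
  by_cases hx : x ∈ BadS (q := q) ℓ (tau hh r)
  · rw [if_pos hx, abs_le]
    have := hF (act (tau hh r) x)
    have := hF' x
    constructor <;> linarith
  · rw [if_neg hx]
    simp only [BadS, Finset.mem_filter, Finset.mem_univ, true_and, not_not] at hx
    obtain ⟨h1, h2, h3, h4⟩ := hx
    apply le_of_eq
    rw [abs_eq_zero, sub_eq_zero]
    simp only [F, F', Cross, Finset.mem_filter, mem_GoodS, h1, h2, true_and, h3, h4]
    simp only [tau_apply, tauF_val_lt_iff hh]
    split_ifs with hc
    · rw [tauF_lt hc.1]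
    · rfl

theorem sum_cross [NeZero n] [Fact (1 < n)] (hh : h < n) (hℓ : ℓ ≤ h) (g : ZMod n → ℝ)
    (g0 : ∀ z, 0 ≤ g z) (g1 : ∀ z, g z ≤ 1) :
    |((n : ℝ) - h) * ∑ x ∈ Cross n q ℓ h, g ((AB ℓ x).2 - (AB ℓ x).1)
      - (Cross n q ℓ h).card * ∑ z, g z|
      ≤ (Cross n q ℓ h).card * h + ((n : ℝ) - h) *
        (2 * (Finset.univ.filter fun x : ZMod n → Fin q => ¬ Good ℓ x).card
          + 12 * ℓ * (Good0 n q ℓ).card) := by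
  set A := ∑ x ∈ Cross n q ℓ h, g ((AB ℓ x).2 - (AB ℓ x).1) with hA
  set bad : ℝ := (2 * (Finset.univ.filter fun x : ZMod n → Fin q => ¬ Good ℓ x).card
          + 12 * ℓ * (Good0 n q ℓ).card) with hbad
  have hN : (n : ℝ) - h = ((n - h : ℕ) : ℝ) := by rw [Nat.cast_sub hh.le]
  have s1 : |((n : ℝ) - h) * A - ∑ r ∈ Finset.range (n - h),
      ∑ x ∈ Cross n q ℓ h, g (tau hh r (AB ℓ x).2 - (AB ℓ x).1)| ≤ ((n : ℝ) - h) * bad := by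
    have : ((n : ℝ) - h) * A = ∑ r ∈ Finset.range (n - h), A := by
      rw [Finset.sum_const, Finset.card_range, nsmul_eq_mul, hN]
    rw [this, ← Finset.sum_sub_distrib]
    refine (Finset.abs_sum_le_sum_abs _ _).trans ?_
    have h2 := Finset.sum_le_card_nsmul (Finset.range (n - h)) (fun r => |A -
      ∑ x ∈ Cross n q ℓ h, g (tau hh r (AB ℓ x).2 - (AB ℓ x).1)|) bad ?_
    · rwa [Finset.card_range, nsmul_eq_mul, ← hN] at h2
    intro r hr
    refine (sum_cross_r hh g g0 g1 r).trans ?_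
    refine (card_BadS (tau hh r) (Bd n h r ℓ)
      (fun p hp => tau_add hh hℓ (Finset.mem_range.1 hr) hp)).trans ?_
    have h3 : ((Bd n h r ℓ).card : ℝ) ≤ 3 * ℓ := by exact_mod_cast card_Bd
    have h4 : (0 : ℝ) ≤ (Good0 n q ℓ).card := Nat.cast_nonneg _
    rw [hbad]
    nlinarith
  have s2 : |∑ r ∈ Finset.range (n - h),
      ∑ x ∈ Cross n q ℓ h, g (tau hh r (AB ℓ x).2 - (AB ℓ x).1)
        - (Cross n q ℓ h).card * ∑ z, g z| ≤ (Cross n q ℓ h).card * h := by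
    rw [Finset.sum_comm]
    have : (Cross n q ℓ h).card * ∑ z, g z = ∑ x ∈ Cross n q ℓ h, ∑ z, g z := by
      rw [Finset.sum_const, nsmul_eq_mul]
    rw [this, ← Finset.sum_sub_distrib]
    refine (Finset.abs_sum_le_sum_abs _ _).trans ?_
    have h2 := Finset.sum_le_card_nsmul (Cross n q ℓ h) (fun x =>
      |∑ r ∈ Finset.range (n - h), g (tau hh r (AB ℓ x).2 - (AB ℓ x).1) - ∑ z, g z|) h ?_
    · rwa [nsmul_eq_mul] at h2
    intro x hx
    have hx2 := (Finset.mem_filter.1 hx).2.2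
    have h3 := sum_tau hh (fun z => g (z - (AB ℓ x).1)) hx2
    rw [h3]
    exact sum_J hh g g0 g1 _
  have := abs_sub_le (((n : ℝ) - h) * A) (∑ r ∈ Finset.range (n - h),
      ∑ x ∈ Cross n q ℓ h, g (tau hh r (AB ℓ x).2 - (AB ℓ x).1)) ((Cross n q ℓ h).card * ∑ z, g z)
  linarith

end LW


/-! ### Decomposition -/

namespace LW

variable {n q ℓ h : ℕ}

/-- `g` modified to vanish at `1`. -/
noncomputable def til (g : ZMod n → ℝ) (z : ZMod n) : ℝ := if z = 1 then 0 else g z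

theorem decomp [NeZero n] [Fact (1 < n)] (hh : h < n) (g : ZMod n → ℝ) :
    (h : ℝ) * ∑ x ∈ Good0 n q ℓ, til g (AB ℓ x).2 =
      ∑ x ∈ Near n q ℓ h, g ((AB ℓ x).2 - (AB ℓ x).1) +
      ∑ x ∈ Cross n q ℓ h, til g ((AB ℓ x).2 - (AB ℓ x).1) := by
  have h1 := sum_a_mem (n := n) (q := q) (ℓ := ℓ) (til g)
    (Finset.univ.filter (fun z : ZMod n => z.val < h))
  rw [card_val_lt hh.le] at h1
  rw [← h1]
  simp only [Finset.mem_filter, Finset.mem_univ, true_and]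
  rw [← Finset.sum_filter_add_sum_filter_not _ (fun x => (AB ℓ x).2.val < h)]
  congr 1
  · rw [Finset.filter_filter]
    have : Near n q ℓ h = ((GoodS n q ℓ).filter fun x => (AB ℓ x).1.val < h ∧
        (AB ℓ x).2.val < h).filter (fun x => ¬ (AB ℓ x).2 - (AB ℓ x).1 = 1) := by
      rw [Finset.filter_filter]
      ext x
      simp only [Near, Finset.mem_filter, sub_eq_iff_eq_add, and_assoc, ne_eq, add_comm]
    rw [this]
    symm
    rw [Finset.sum_filter]
    refine Finset.sum_congr rfl fun x _ => ?_
    unfold til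
    split_ifs <;> simp_all
  · rw [Finset.filter_filter]
    rfl

theorem til_one_sum [NeZero n] : ∑ x ∈ Good0 n q ℓ, til (fun _ => (1 : ℝ)) (AB ℓ x).2
    = (Good0 n q ℓ).card - ((Good0 n q ℓ).filter fun x => (AB ℓ x).2 = 1).card := by
  have : ∀ z : ZMod n, til (fun _ => (1 : ℝ)) z = 1 - if z = 1 then 1 else 0 := by
    intro z; unfold til; split_ifs <;> simp
  simp_rw [this]
  rw [Finset.sum_sub_distrib]
  simp

theorem cross_bounds [NeZero n] [Fact (1 < n)] (hh : h < n) :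
    (h : ℝ) * ((Good0 n q ℓ).card - ((Good0 n q ℓ).filter fun x => (AB ℓ x).2 = 1).card)
        - (Near n q ℓ h).card ≤ (Cross n q ℓ h).card ∧
    ((Cross n q ℓ h).card : ℝ) ≤
      (h : ℝ) * ((Good0 n q ℓ).card - ((Good0 n q ℓ).filter fun x => (AB ℓ x).2 = 1).card)
        + (Good0 n q ℓ).card := by
  have h1 := decomp (n := n) (q := q) (ℓ := ℓ) hh (fun _ => (1 : ℝ))
  rw [til_one_sum] at h1
  have h2 : ∑ x ∈ Cross n q ℓ h, til (fun _ => (1 : ℝ)) ((AB ℓ x).2 - (AB ℓ x).1)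
      = (Cross n q ℓ h).card -
        ((Cross n q ℓ h).filter fun x => (AB ℓ x).2 - (AB ℓ x).1 = 1).card := by
    have : ∀ z : ZMod n, til (fun _ => (1 : ℝ)) z = 1 - if z = 1 then 1 else 0 := by
      intro z; unfold til; split_ifs <;> simp
    simp_rw [this]
    rw [Finset.sum_sub_distrib]
    simp
  have h3 : (((Cross n q ℓ h).filter fun x => (AB ℓ x).2 - (AB ℓ x).1 = 1).card : ℝ)
      ≤ (Good0 n q ℓ).card := by
    have e := card_a_mem (n := n) (q := q) (ℓ := ℓ) {((h - 1 : ℕ) : ZMod n)}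
    rw [Finset.card_singleton] at e
    rw [← one_mul ((Good0 n q ℓ).card : ℝ)]
    push_cast at e
    rw [← e]
    rw [Nat.cast_le]
    apply Finset.card_le_card
    intro x hx
    simp only [Cross, Finset.mem_filter, mem_GoodS, Finset.mem_singleton] at hx ⊢
    obtain ⟨⟨hG, ha, hb⟩, hab⟩ := hx
    refine ⟨hG, ?_⟩
    rw [sub_eq_iff_eq_add] at hab
    have hb2 : (AB ℓ x).2 = (((AB ℓ x).1.val + 1 : ℕ) : ZMod n) := by
      push_cast; rw [ZMod.natCast_zmod_val, hab]; ring
    rw [hb2, ZMod.val_cast_of_lt (by omega)] at hb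
    have : (AB ℓ x).1.val = h - 1 := by omega
    rw [← this, ZMod.natCast_zmod_val]
  rw [h2] at h1
  simp only [Finset.sum_const, nsmul_eq_mul, mul_one] at h1
  have h4 : (0 : ℝ) ≤ ((Cross n q ℓ h).filter fun x => (AB ℓ x).2 - (AB ℓ x).1 = 1).card :=
    Nat.cast_nonneg _
  have h5 : (0 : ℝ) ≤ (Near n q ℓ h).card := Nat.cast_nonneg _
  constructor <;> linarith

theorem near_sum_bounds [NeZero n] (g : ZMod n → ℝ) (g0 : ∀ z, 0 ≤ g z) (g1 : ∀ z, g z ≤ 1) :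
    0 ≤ ∑ x ∈ Near n q ℓ h, g ((AB ℓ x).2 - (AB ℓ x).1) ∧
    ∑ x ∈ Near n q ℓ h, g ((AB ℓ x).2 - (AB ℓ x).1) ≤ (Near n q ℓ h).card := by
  constructor
  · exact Finset.sum_nonneg fun _ _ => g0 _
  · have := Finset.sum_le_card_nsmul (Near n q ℓ h)
      (fun x => g ((AB ℓ x).2 - (AB ℓ x).1)) 1 (fun _ _ => g1 _)
    simpa using this

end LW


/-! ### Lyndon words as cyclic words -/

namespace LW

variable {n q ℓ : ℕ}

/-- Cyclic words as functions on `Fin n`. -/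
def toW [NeZero n] : (ZMod n → Fin q) ≃ (Fin n → Fin q) where
  toFun x := fun i => x ((i : ℕ) : ZMod n)
  invFun w := fun c => w ⟨c.val, ZMod.val_lt c⟩
  left_inv x := by ext c; simp
  right_inv w := by ext i; simp [ZMod.val_cast_of_lt i.2]

theorem lex_drop [NeZero n] (x : ZMod n → Fin q) {i j : ℕ} (hi : i < n) (hj : j < n) :
    List.Lex (· < ·) ((List.ofFn (toW x)).drop i) ((List.ofFn (toW x)).drop j) ↔
      (j < i ∧ ∀ s, i + s < n → x ((i + s : ℕ) : ZMod n) = x ((j + s : ℕ) : ZMod n)) ∨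
      ∃ t, i + t < n ∧ j + t < n ∧
        (∀ s < t, x ((i + s : ℕ) : ZMod n) = x ((j + s : ℕ) : ZMod n)) ∧
        x ((i + t : ℕ) : ZMod n) < x ((j + t : ℕ) : ZMod n) := by
  change (List.ofFn (toW x)).drop i < (List.ofFn (toW x)).drop j ↔ _
  rw [List.lt_iff_exists]
  simp only [List.length_drop, List.length_ofFn, List.getElem_drop, List.getElem_ofFn]
  apply or_congr
  · constructor
    · rintro ⟨h1, h2⟩
      refine ⟨by omega, fun s hs => ?_⟩
      have h3 := congrArg (fun l => l[s]?) h1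
      simp only [List.getElem?_drop, List.getElem?_take, List.getElem?_ofFn] at h3
      rw [dif_pos hs, if_pos (by omega), dif_pos (by omega)] at h3
      simpa [toW] using h3
    · rintro ⟨h1, h2⟩
      refine ⟨?_, by omega⟩
      apply List.ext_getElem
      · simp; omega
      · intro s hs hs'
        simp only [List.length_drop, List.length_ofFn] at hs
        simp only [List.getElem_drop, List.getElem_ofFn, List.getElem_take]
        exact h2 s (by omega)
  · constructor
    · rintro ⟨t, h1, h2, h3, h4⟩
      exact ⟨t, by omega, by omega, h3, h4⟩
    · rintro ⟨t, h1, h2, h3, h4⟩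
      exact ⟨t, by omega, by omega, h3, h4⟩

/-- Index form of the Lyndon property. -/
def LynX (x : ZMod n → Fin q) : Prop := ∀ i : ℕ, 0 < i → i < n → ∃ t, i + t < n ∧
  (∀ s < t, x (s : ZMod n) = x ((i + s : ℕ) : ZMod n)) ∧
  x (t : ZMod n) < x ((i + t : ℕ) : ZMod n)

theorem isLyndon_iff [NeZero n] (x : ZMod n → Fin q) :
    IsLyndon (List.ofFn (toW x)) ↔ LynX x := by
  unfold IsLyndon LynX
  simp only [List.length_ofFn]
  refine forall_congr' fun i => forall_congr' fun hi => forall_congr' fun hin => ?_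
  have := lex_drop x (i := 0) (j := i) (by omega) hin
  rw [List.drop_zero] at this
  rw [this]
  constructor
  · rintro (h | ⟨t, h1, h2, h3, h4⟩)
    · omega
    · exact ⟨t, h2, by simpa using h3, by simpa using h4⟩
  · rintro ⟨t, h1, h2, h3⟩
    exact Or.inr ⟨t, by omega, h1, by simpa using h2, by simpa using h3⟩

theorem LynX.a_eq [NeZero n] [Fact (1 < n)] {x : ZMod n → Fin q} (hL : LynX x) (hG : Good ℓ x) :
    (AB ℓ x).1 = 0 := by
  by_contra h0
  have h1 := (AB_spec hG).2.1 0 (Ne.symm h0)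
  have hpos : 0 < (AB ℓ x).1.val := Nat.pos_of_ne_zero (fun h => h0 ((ZMod.val_eq_zero _).1 h))
  obtain ⟨t, ht, h2, h3⟩ := hL _ hpos (ZMod.val_lt _)
  have h4 : win ℓ x 0 ≤ win ℓ x (AB ℓ x).1 := by
    apply win_le (t := t)
    · intro s hs
      have := h2 s hs
      push_cast at this
      rw [ZMod.natCast_zmod_val] at this
      simpa using this
    · push_cast at h3
      rw [ZMod.natCast_zmod_val] at h3
      simpa using h3
  exact absurd h1 (not_lt.2 h4)

theorem lynX_of_a [NeZero n] [Fact (1 < n)] {x : ZMod n → Fin q} (hG : Good ℓ x)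
    (ha : (AB ℓ x).1 = 0) : LynX x := by
  intro i hi hin
  have hmin := (AB_spec hG).2.1
  rw [ha] at hmin
  have hi0 : (i : ZMod n) ≠ 0 := by
    intro h
    have := natCast_inj_lt (n := n) (a := i) (b := 0) hin (by omega) (by simpa using h)
    omega
  obtain ⟨t, ht, h1, h2⟩ := win_lt_iff.1 (hmin _ hi0)
  by_cases hit : i + t < n
  · refine ⟨t, hit, ?_, ?_⟩
    · intro s hs; simpa using h1 s hs
    · simpa using h2
  exfalso
  have hc0 : ((n - i : ℕ) : ZMod n) ≠ 0 := by
    intro h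
    have := natCast_inj_lt (n := n) (a := n - i) (b := 0) (by omega) (by omega) (by simpa using h)
    omega
  have key : ∀ s : ℕ, (i : ZMod n) + ((n - i + s : ℕ) : ZMod n) = (s : ZMod n) := by
    intro s
    rw [← Nat.cast_add, show i + (n - i + s) = n + s by omega]
    simp
  have hle : win ℓ x ((n - i : ℕ) : ZMod n) ≤ win ℓ x 0 := by
    apply win_le (t := t - (n - i))
    · intro s hs
      have := h1 (n - i + s) (by omega)
      rw [key] at this
      simpa using this
    · have e : t = n - i + (t - (n - i)) := by omega
      rw [e, key] at h2
      simpa using h2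
  exact absurd (hmin _ hc0) (not_lt.2 hle)

theorem srf_eq [NeZero n] [Fact (1 < n)] {x : ZMod n → Fin q} (hL : LynX x) (hG : Good ℓ x) :
    srfLen (List.ofFn (toW x)) = n - (AB ℓ x).2.val := by
  have ha := hL.a_eq hG
  obtain ⟨s1, s2, s3⟩ := AB_spec hG
  rw [ha] at s1 s2 s3
  set b := (AB ℓ x).2 with hb
  have hbl := ZMod.val_lt b
  have hbpos : 0 < b.val := Nat.pos_of_ne_zero (fun h => s1 ((ZMod.val_eq_zero _).1 h).symm)
  have hnot : ∀ j, 0 < j → j < n → j ≠ b.val → ¬ List.Lex (· < ·)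
      ((List.ofFn (toW x)).drop j) ((List.ofFn (toW x)).drop b.val) := by
    intro j hj hjn hjb hlex
    have hj0 : (j : ZMod n) ≠ 0 := by
      intro h
      have := natCast_inj_lt (n := n) (a := j) (b := 0) hjn (by omega) (by simpa using h)
      omega
    have hjb' : (j : ZMod n) ≠ b := by
      intro h
      apply hjb
      rw [← h, ZMod.val_cast_of_lt hjn]
    have hlt := s3 _ hj0 hjb'
    rw [lex_drop x hjn hbl] at hlex
    refine absurd hlt (not_lt.2 ?_)
    rcases hlex with ⟨h1, h2⟩ | ⟨t, h1, h2, h3, h4⟩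
    · obtain ⟨t, t1, t2, t3⟩ := hL (b.val + (n - j)) (by omega) (by omega)
      have key : ∀ s : ℕ, (j : ZMod n) + ((n - j + s : ℕ) : ZMod n) = (s : ZMod n) := by
        intro s
        rw [← Nat.cast_add, show j + (n - j + s) = n + s by omega]
        simp
      have key2 : ∀ s : ℕ, ((b.val + (n - j) + s : ℕ) : ZMod n) =
          b + ((n - j + s : ℕ) : ZMod n) := by
        intro s
        rw [add_assoc, Nat.cast_add, ZMod.natCast_zmod_val]
      apply win_le (t := n - j + t)
      · intro s hs
        by_cases hsj : s < n - j
        · have := h2 s (by omega)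
          rw [Nat.cast_add, Nat.cast_add, ZMod.natCast_zmod_val] at this
          exact this
        · have e : s = n - j + (s - (n - j)) := by omega
          rw [e, key, ← key2]
          exact t2 _ (by omega)
      · rw [key, ← key2]
        exact t3
    · apply win_le (t := t)
      · intro s hs
        have := h3 s hs
        rw [Nat.cast_add, Nat.cast_add, ZMod.natCast_zmod_val] at this
        exact this
      · rw [Nat.cast_add, Nat.cast_add, ZMod.natCast_zmod_val] at h4
        exact h4
  have hset : {i | 0 < i ∧ i < (List.ofFn (toW x)).length ∧
    ∀ j, 0 < j → j < (List.ofFn (toW x)).length → ¬ List.Lex (· < ·)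
      ((List.ofFn (toW x)).drop j) ((List.ofFn (toW x)).drop i)} = {b.val} := by
    ext i
    simp only [List.length_ofFn, Set.mem_ofPred_eq, Set.mem_singleton_iff]
    constructor
    · rintro ⟨h1, h2, h3⟩
      by_contra hne
      have e1 := hnot i h1 h2 hne
      have e2 := h3 b.val hbpos hbl
      have e1' : ¬ ((List.ofFn (toW x)).drop i < (List.ofFn (toW x)).drop b.val) := e1
      have e2' : ¬ ((List.ofFn (toW x)).drop b.val < (List.ofFn (toW x)).drop i) := e2
      have e3 := le_antisymm (not_lt.1 e1') (not_lt.1 e2')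
      have e4 := congrArg List.length e3
      simp only [List.length_drop, List.length_ofFn] at e4
      omega
    · rintro rfl
      refine ⟨hbpos, hbl, ?_⟩
      intro j h1 h2
      by_cases hj : j = b.val
      · rw [hj]
        exact lt_irrefl ((List.ofFn (toW x)).drop b.val)
      · exact hnot j h1 h2 hj
  unfold srfLen
  rw [hset, csInf_singleton, List.length_ofFn]

/-- Lyndon words as cyclic words. -/
noncomputable def LynS (n q : ℕ) [NeZero n] : Finset (ZMod n → Fin q) :=
  Finset.univ.filter LynX

theorem sum_lyndon [NeZero n] (f : List (Fin q) → ℝ) :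
    ∑ w ∈ lyndonWords q n, f (List.ofFn w) = ∑ x ∈ LynS n q, f (List.ofFn (toW x)) := by
  symm
  refine Finset.sum_equiv toW ?_ (fun _ _ => rfl)
  intro x
  simp [LynS, lyndonWords, isLyndon_iff]

theorem card_lyndon [NeZero n] : (lyndonWords q n).card = (LynS n q).card := by
  symm
  refine Finset.card_equiv toW ?_
  intro x
  simp [LynS, lyndonWords, isLyndon_iff]

theorem lynS_good [NeZero n] [Fact (1 < n)] :
    (LynS n q).filter (Good ℓ) = Good0 n q ℓ := by
  ext x
  simp only [LynS, Good0, Finset.mem_filter, Finset.mem_univ, true_and, mem_GoodS]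
  constructor
  · rintro ⟨h1, h2⟩; exact ⟨h2, h1.a_eq h2⟩
  · rintro ⟨h1, h2⟩; exact ⟨lynX_of_a h1 h2, h1⟩

theorem rot_lyn_inj [NeZero n] {x y : ZMod n → Fin q} (hx : LynX x) (hy : LynX y) {d : ZMod n}
    (h : y = rot d x) : d = 0 := by
  by_contra h0
  have hpos : ∀ d : ZMod n, d ≠ 0 → 0 < d.val :=
    fun d h0 => Nat.pos_of_ne_zero (fun h => h0 ((ZMod.val_eq_zero _).1 h))
  obtain ⟨t, -, t1, t2⟩ := hx d.val (hpos d h0) (ZMod.val_lt d)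
  obtain ⟨u, -, u1, u2⟩ := hy (-d).val (hpos (-d) (neg_ne_zero.2 h0)) (ZMod.val_lt (-d))
  have e1 : ∀ s : ℕ, x ((d.val + s : ℕ) : ZMod n) = y (s : ZMod n) := by
    intro s
    rw [h, rot_apply, Nat.cast_add, ZMod.natCast_zmod_val, add_comm]
  have e2 : ∀ s : ℕ, y (((-d).val + s : ℕ) : ZMod n) = x (s : ZMod n) := by
    intro s
    rw [h, rot_apply, Nat.cast_add, ZMod.natCast_zmod_val]
    congr 1
    ring
  simp only [e1] at t1 t2
  simp only [e2] at u1 u2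
  rcases lt_trichotomy t u with hl | he | hg
  · rw [u1 t hl] at t2; exact lt_irrefl _ t2
  · rw [he] at t2; exact lt_asymm t2 u2
  · rw [t1 u hg] at u2; exact lt_irrefl _ u2

theorem card_lyn_bad [NeZero n] :
    n * ((LynS n q).filter fun x => ¬ Good ℓ x).card ≤
      (Finset.univ.filter fun x : ZMod n → Fin q => ¬ Good ℓ x).card := by
  have h1 : ((Finset.univ : Finset (ZMod n)) ×ˢ
      ((LynS n q).filter fun x => ¬ Good ℓ x)).card ≤
      (Finset.univ.filter fun x : ZMod n → Fin q => ¬ Good ℓ x).card := by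
    refine Finset.card_le_card_of_injOn (fun p => rot p.1 p.2) ?_ ?_
    · rintro ⟨p, x⟩ hx
      have hx := (Finset.mem_filter.1 (Finset.mem_product.1 hx).2).2
      refine Finset.mem_coe.2 (Finset.mem_filter.2 ⟨Finset.mem_univ _, ?_⟩)
      change ¬ Good ℓ (rot p x)
      rw [good_rot]
      exact hx
    · rintro ⟨p, x⟩ hx ⟨p', y⟩ hy hxy
      have hx := (Finset.mem_filter.1 (Finset.mem_filter.1 (Finset.mem_product.1 hx).2).1).2
      have hy := (Finset.mem_filter.1 (Finset.mem_filter.1 (Finset.mem_product.1 hy).2).1).2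
      simp only at hxy hx hy
      have e : y = rot (p - p') x := by
        ext1 c
        have := congrFun hxy (c - p')
        simp only [rot_apply, sub_add_cancel] at this
        rw [rot_apply, ← this]
        congr 1
        ring
      have e0 := rot_lyn_inj hx hy e
      have e1 : p = p' := sub_eq_zero.1 e0
      rw [e0] at e
      have e2 : y = x := by
        rw [e]; ext1 c; simp
      rw [e1, e2]
  rw [Finset.card_product, Finset.card_univ, ZMod.card] at h1
  exact h1

end LW


/-! ### Words whose standard right factor has length `n - 1` -/

namespace LW

theorem isLyndon_tail {α : Type*} [LinearOrder α] {c : α} {v : List α}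
    (h2 : srfLen (c :: v) = v.length) : IsLyndon v := by
  unfold srfLen at h2
  set S := {i | 0 < i ∧ i < (c :: v).length ∧
    ∀ j, 0 < j → j < (c :: v).length → ¬ List.Lex (· < ·) ((c :: v).drop j) ((c :: v).drop i)}
    with hS
  intro i hi hiv
  have h3 : sInf S = 1 := by
    rw [List.length_cons] at h2
    omega
  have hne : S.Nonempty := Nat.nonempty_of_sInf_eq_succ h3
  have hmem := Nat.sInf_mem hne
  rw [h3] at hmem
  have h4 := hmem.2.2 (i + 1) (by omega) (by rw [List.length_cons]; omega)
  rw [List.drop_succ_cons, List.drop_succ_cons, List.drop_zero] at h4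
  have h5 : v ≤ v.drop i := not_lt.1 h4
  refine lt_of_le_of_ne h5 ?_
  intro he
  have := congrArg List.length he
  rw [List.length_drop] at this
  omega

theorem isLyndon_cons {q : ℕ} [NeZero q] {v : List (Fin q)} (hv : IsLyndon v)
    (h2 : 2 ≤ v.length) : IsLyndon (0 :: v) ∧ srfLen (0 :: v) = v.length := by
  have hlt : (0 :: v) < v := by
    cases v with
    | nil => simp at h2
    | cons c v' =>
      rcases (Fin.zero_le c).lt_or_eq with hc | hc
      · exact List.Lex.rel hc
      · rw [← hc]
        have := hv 1 (by omega) (by omega)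
        rw [List.drop_succ_cons, List.drop_zero, ← hc] at this
        exact List.Lex.cons this
  have hle : ∀ j, 0 < j → j < (0 :: v).length → v ≤ (0 :: v).drop j := by
    intro j hj hjv
    obtain ⟨i, rfl⟩ : ∃ i, j = i + 1 := ⟨j - 1, by omega⟩
    rw [List.drop_succ_cons]
    rcases Nat.eq_zero_or_pos i with rfl | hi
    · simp
    · rw [List.length_cons] at hjv
      have : v < v.drop i := hv i hi (by omega)
      exact this.le
  constructor
  · intro j hj hjv
    exact lt_of_lt_of_le hlt (hle j hj hjv)
  · unfold srfLen
    set S := {i | 0 < i ∧ i < (0 :: v).length ∧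
      ∀ j, 0 < j → j < (0 :: v).length → ¬ List.Lex (· < ·) ((0 :: v).drop j) ((0 :: v).drop i)}
      with hS
    have h1 : 1 ∈ S := by
      refine ⟨by omega, by rw [List.length_cons]; omega, ?_⟩
      intro j hj hjv
      rw [List.drop_succ_cons, List.drop_zero]
      exact not_lt.2 (hle j hj hjv)
    have h3 := Nat.sInf_le h1
    have h4 := (Nat.sInf_mem ⟨1, h1⟩).1
    rw [List.length_cons]
    omega

variable {m q ℓ : ℕ}

/-- Good Lyndon words with second smallest window at `1`. -/
noncomputable def Sh (n q ℓ : ℕ) [NeZero n] : Finset (ZMod n → Fin q) :=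
  (Good0 n q ℓ).filter fun x => (AB ℓ x).2 = 1

theorem ofFn_toW_cons (x : ZMod (m + 1) → Fin q) :
    List.ofFn (toW x) = toW x 0 :: List.ofFn (fun i : Fin m => toW x i.succ) := by
  rw [List.ofFn_succ]

theorem LynX.nonzero {n : ℕ} [NeZero n] [NeZero q] {x : ZMod n → Fin q} (hx : LynX x) (h0 : x 0 ≠ 0)
    (c : ZMod n) : x c ≠ 0 := by
  by_cases hc : c = 0
  · rw [hc]; exact h0
  obtain ⟨t, -, h1, h2⟩ := hx c.val
    (Nat.pos_of_ne_zero (fun h => hc ((ZMod.val_eq_zero _).1 h))) (ZMod.val_lt c)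
  rcases Nat.eq_zero_or_pos t with rfl | ht
  · simp only [Nat.cast_zero, add_zero, ZMod.natCast_zmod_val] at h2
    intro h
    rw [h] at h2
    exact absurd h2 (by simp)
  · have := h1 0 ht
    simp only [Nat.cast_zero, add_zero, ZMod.natCast_zmod_val] at this
    rw [← this]; exact h0

theorem card_Sh_le [NeZero q] (hm : 1 ≤ m) [Fact (1 < m + 1)] :
    (Sh (m + 1) q ℓ).card ≤ (lyndonWords q m).card + (q - 1) ^ (m + 1) := by
  rw [← Finset.card_filter_add_card_filter_not (s := Sh (m + 1) q ℓ) (fun x => x 0 = 0)]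
  have hL : ∀ x ∈ Sh (m + 1) q ℓ, LynX x ∧ srfLen (List.ofFn (toW x)) = m := by
    intro x hx
    simp only [Sh, Good0, Finset.mem_filter, mem_GoodS] at hx
    obtain ⟨⟨hG, ha⟩, hb⟩ := hx
    have hl := lynX_of_a hG ha
    refine ⟨hl, ?_⟩
    rw [srf_eq hl hG, hb, ZMod.val_one]
    omega
  refine Nat.add_le_add ?_ ?_
  · refine Finset.card_le_card_of_injOn (fun x => fun i : Fin m => toW x i.succ) ?_ ?_
    · intro x hx
      have hx := (Finset.mem_filter.1 hx).1
      obtain ⟨h1, h2⟩ := hL x hx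
      simp only [lyndonWords, Finset.coe_filter, Finset.mem_univ, true_and, Set.mem_ofPred_eq]
      rw [ofFn_toW_cons] at h2
      apply isLyndon_tail (c := toW x 0)
      rw [h2, List.length_ofFn]
    · intro x hx y hy hxy
      have hx := (Finset.mem_filter.1 hx).2
      have hy := (Finset.mem_filter.1 hy).2
      apply toW.injective
      ext1 i
      refine Fin.cases ?_ (fun i => congrFun hxy i) i
      simp only [toW, Equiv.coe_fn_mk, Fin.val_zero, Nat.cast_zero]
      rw [hx, hy]
  · have : (Fintype.piFinset fun _ : ZMod (m + 1) => (Finset.univ.erase 0 : Finset (Fin q))).card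
        = (q - 1) ^ (m + 1) := by
      rw [Fintype.card_piFinset]
      simp [ZMod.card]
    rw [← this]
    apply Finset.card_le_card
    intro x hx
    obtain ⟨hx, h0⟩ := Finset.mem_filter.1 hx
    rw [Fintype.mem_piFinset]
    intro c
    simpa using (hL x hx).1.nonzero h0 c

theorem le_card_Sh [NeZero q] (hm : 2 ≤ m) [Fact (1 < m + 1)] :
    (lyndonWords q m).card ≤ (Sh (m + 1) q ℓ).card +
      ((LynS (m + 1) q).filter fun x => ¬ Good ℓ x).card := by
  refine le_trans ?_ (Finset.card_union_le _ _)
  refine Finset.card_le_card_of_injOn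
    (fun w => toW.symm (Fin.cons 0 w : Fin (m + 1) → Fin q)) ?_ ?_
  · intro w hw
    have hw := (Finset.mem_filter.1 hw).2
    obtain ⟨h1, h2⟩ := isLyndon_cons hw (by simpa using hm)
    set x : ZMod (m + 1) → Fin q := toW.symm (Fin.cons 0 w : Fin (m + 1) → Fin q) with hx
    have hxl : List.ofFn (toW x) = 0 :: List.ofFn w := by
      rw [hx, Equiv.apply_symm_apply, List.ofFn_cons]
    rw [← hxl] at h1 h2
    rw [isLyndon_iff] at h1
    rw [Finset.mem_coe, Finset.mem_union]
    by_cases hG : Good ℓ x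
    · left
      have ha := h1.a_eq hG
      rw [srf_eq h1 hG, List.length_ofFn] at h2
      simp only [Sh, Good0, Finset.mem_filter, mem_GoodS]
      refine ⟨⟨hG, ha⟩, ?_⟩
      have hv := ZMod.val_lt (AB ℓ x).2
      have h3 : (AB ℓ x).2.val = 1 := by
        clear_value x
        omega
      exact ZMod.val_injective (m + 1) (by rw [h3, ZMod.val_one])
    · right
      simp only [LynS, Finset.mem_filter, Finset.mem_univ, true_and]
      exact ⟨h1, hG⟩
  · intro w _ w' _ h
    have := toW.symm.injective h
    exact Fin.cons_right_injective _ this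

end LW

namespace LW

theorem sum_zmod (m k : ℕ) :
    ∑ z : ZMod (m + 1), (1 - (z.val : ℝ) / ((m + 1 : ℕ) : ℝ)) ^ k
      = ∑ i ∈ Finset.range (m + 1), (1 - (i : ℝ) / ((m + 1 : ℕ) : ℝ)) ^ k :=
  Fin.sum_univ_eq_sum_range (fun i => (1 - (i : ℝ) / ((m + 1 : ℕ) : ℝ)) ^ k) (m + 1)

theorem finite_pack (q k n ℓ h t K : ℕ) (hq : 2 ≤ q) (hn : 3 ≤ n) (h2l : 2 * ℓ ≤ n)
    (hh : h < n) (hlh : ℓ ≤ h) (htl : t + 1 ≤ ℓ) (hht : h + t ≤ n) (hK : K * (t + 1) ≤ n) :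
    ∃ L' s G Nr C A B S : ℝ,
      0 ≤ G ∧ G ≤ (n : ℝ) ^ 2 * (q : ℝ) ^ (n - ℓ) ∧
      (n : ℝ) * L' = (q : ℝ) ^ n - G ∧
      L' ≤ (lyndonWords q n).card ∧ (n : ℝ) * ((lyndonWords q n).card - L') ≤ G ∧
      s ≤ (lyndonWords q (n - 1)).card + ((q : ℝ) - 1) ^ n ∧
      ((lyndonWords q (n - 1)).card : ℝ) ≤ s + ((lyndonWords q n).card - L') ∧
      0 ≤ Nr ∧ Nr ≤ (h : ℝ) ^ 2 * (q : ℝ) ^ (n - 2 * t)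
        + ((q : ℝ) ^ (t + 1) - 1) ^ K * (q : ℝ) ^ (n - K * (t + 1)) ∧
      h * (L' - s) - Nr ≤ C ∧ C ≤ h * (L' - s) + L' ∧
      |((n : ℝ) - h) * A - C * S| ≤ C * h + ((n : ℝ) - h) * (2 * G + 12 * ℓ * L') ∧
      A ≤ h * B ∧ h * B ≤ A + Nr ∧
      |S - ∑ i ∈ Finset.range n, (1 - (i : ℝ) / (n : ℝ)) ^ k| ≤ 1 ∧
      s * (1 - 1 / (n : ℝ)) ^ k + B ≤
        ∑ w ∈ lyndonWords q n, ((srfLen (List.ofFn w) : ℝ) / n) ^ k ∧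
      ∑ w ∈ lyndonWords q n, ((srfLen (List.ofFn w) : ℝ) / n) ^ k ≤
        s * (1 - 1 / (n : ℝ)) ^ k + B + ((lyndonWords q n).card - L') := by
  obtain ⟨m, rfl⟩ : ∃ m, n = m + 1 := ⟨n - 1, by omega⟩
  have : Fact (1 < m + 1) := ⟨by omega⟩
  have : NeZero q := ⟨by omega⟩
  have hm : 2 ≤ m := by omega
  set n := m + 1 with hnm
  have hn0 : (0 : ℝ) < n := by exact_mod_cast (by omega : 0 < n)
  let g : ZMod n → ℝ := fun z => (1 - (z.val : ℝ) / (n : ℝ)) ^ k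
  have hgb : ∀ z : ZMod n, 0 ≤ 1 - (z.val : ℝ) / (n : ℝ) ∧ 1 - (z.val : ℝ) / (n : ℝ) ≤ 1 := by
    intro z
    have h1 : (z.val : ℝ) ≤ n := by exact_mod_cast (ZMod.val_lt z).le
    have h2 : (z.val : ℝ) / n ≤ 1 := by rw [div_le_one hn0]; exact h1
    have h3 : 0 ≤ (z.val : ℝ) / n := by positivity
    constructor <;> linarith
  have g0 : ∀ z, 0 ≤ g z := fun z => pow_nonneg (hgb z).1 _
  have g1 : ∀ z, g z ≤ 1 := fun z => pow_le_one₀ (hgb z).1 (hgb z).2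
  have t0 : ∀ z, 0 ≤ til g z := by
    intro z; unfold til; split_ifs; exacts [le_rfl, g0 z]
  have t1 : ∀ z, til g z ≤ 1 := by
    intro z; unfold til; split_ifs; exacts [zero_le_one, g1 z]
  have hgone : g 1 = (1 - 1 / (n : ℝ)) ^ k := by
    simp only [g]
    rw [ZMod.val_one n, Nat.cast_one]
  -- sum over Good0
  have hT0 : ∑ x ∈ Good0 n q ℓ, g (AB ℓ x).2 =
      (Sh n q ℓ).card * (1 - 1 / (n : ℝ)) ^ k + ∑ x ∈ Good0 n q ℓ, til g (AB ℓ x).2 := by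
    rw [← hgone, Sh, ← nsmul_eq_mul, ← Finset.sum_const, Finset.sum_filter,
      ← Finset.sum_add_distrib]
    apply Finset.sum_congr rfl
    intro x _
    unfold til
    split_ifs with h1
    · rw [h1, add_zero]
    · rw [zero_add]
  have hsplit : ∀ f : (ZMod n → Fin q) → ℝ, ∑ x ∈ LynS n q, f x =
      ∑ x ∈ Good0 n q ℓ, f x + ∑ x ∈ (LynS n q).filter (fun x => ¬ Good ℓ x), f x := by
    intro f
    rw [← lynS_good (ℓ := ℓ)]
    exact (Finset.sum_filter_add_sum_filter_not _ _ _).symm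
  have hcard : ((lyndonWords q n).card : ℝ) = (Good0 n q ℓ).card +
      ((LynS n q).filter fun x => ¬ Good ℓ x).card := by
    rw [card_lyndon]
    have := hsplit (fun _ => 1)
    simpa using this
  have hT : ∑ w ∈ lyndonWords q n, ((srfLen (List.ofFn w) : ℝ) / n) ^ k =
      ∑ x ∈ Good0 n q ℓ, g (AB ℓ x).2 + ∑ x ∈ (LynS n q).filter (fun x => ¬ Good ℓ x),
        ((srfLen (List.ofFn (toW x)) : ℝ) / n) ^ k := by
    rw [sum_lyndon (fun w => ((srfLen w : ℝ) / n) ^ k), hsplit]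
    congr 1
    apply Finset.sum_congr rfl
    intro x hx
    rw [← lynS_good (ℓ := ℓ), Finset.mem_filter] at hx
    have hL : LynX x := by simpa [LynS] using hx.1
    rw [srf_eq hL hx.2, Nat.cast_sub (ZMod.val_lt _).le]
    simp only [g]
    congr 1
    field_simp
  have hbad0 : 0 ≤ ∑ x ∈ (LynS n q).filter (fun x => ¬ Good ℓ x),
        ((srfLen (List.ofFn (toW x)) : ℝ) / n) ^ k := by positivity
  have hbad1 : ∑ x ∈ (LynS n q).filter (fun x => ¬ Good ℓ x),
        ((srfLen (List.ofFn (toW x)) : ℝ) / n) ^ k ≤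
        ((LynS n q).filter (fun x => ¬ Good ℓ x)).card := by
    have : ∀ x ∈ (LynS n q).filter (fun x => ¬ Good ℓ x),
        ((srfLen (List.ofFn (toW x)) : ℝ) / n) ^ k ≤ 1 := by
      intro x _
      apply pow_le_one₀ (by positivity)
      rw [div_le_one hn0]
      have : srfLen (List.ofFn (toW x)) ≤ n := by
        unfold srfLen
        rw [List.length_ofFn]
        exact Nat.sub_le _ _
      exact_mod_cast this
    simpa using Finset.sum_le_sum this
  have hcg := card_good (n := n) (q := q) (ℓ := ℓ)
  have hsum : ((GoodS n q ℓ).card : ℝ) + (Finset.univ.filter fun x : ZMod n → Fin q => ¬ Good ℓ x).card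
      = (q : ℝ) ^ n := by
    have := Finset.card_filter_add_card_filter_not (s := (Finset.univ : Finset (ZMod n → Fin q)))
      (fun x => Good ℓ x)
    rw [Finset.card_univ, Fintype.card_fun, ZMod.card, Fintype.card_fin] at this
    exact_mod_cast this
  have hlb := card_lyn_bad (n := n) (q := q) (ℓ := ℓ)
  have hdec := decomp (q := q) (ℓ := ℓ) hh g
  have hnb := near_sum_bounds (q := q) (ℓ := ℓ) (h := h) g g0 g1
  have hcb := cross_bounds (q := q) (ℓ := ℓ) hh
  have hsc := sum_cross (q := q) hh hlh (til g) t0 t1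
  have hnear := card_near (q := q) htl hht hK
  have hng := card_not_good (q := q) h2l
  have hs1 := card_Sh_le (q := q) (ℓ := ℓ) (m := m) (by omega)
  have hs2 := le_card_Sh (q := q) (ℓ := ℓ) (m := m) hm
  have hq1 : 1 ≤ q := by omega
  have hqt : 1 ≤ q ^ (t + 1) := Nat.one_le_pow _ _ (by omega)
  refine ⟨(Good0 n q ℓ).card, (Sh n q ℓ).card,
    (Finset.univ.filter fun x : ZMod n → Fin q => ¬ Good ℓ x).card, (Near n q ℓ h).card,
    (Cross n q ℓ h).card, ∑ x ∈ Cross n q ℓ h, til g ((AB ℓ x).2 - (AB ℓ x).1),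
    ∑ x ∈ Good0 n q ℓ, til g (AB ℓ x).2, ∑ z, til g z,
    by positivity, ?_, ?_, ?_, ?_, ?_, ?_, by positivity, ?_, hcb.1, hcb.2, hsc, ?_, ?_, ?_, ?_, ?_⟩
  · exact_mod_cast hng
  · linarith
  · rw [hcard]; linarith [Nat.cast_nonneg (α := ℝ) ((LynS n q).filter fun x => ¬ Good ℓ x).card]
  · rw [hcard, add_sub_cancel_left]; exact_mod_cast hlb
  · have : ((Sh n q ℓ).card : ℝ) ≤ ((lyndonWords q m).card + (q - 1) ^ (m + 1) : ℕ) := by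
      exact_mod_cast hs1
    push_cast [Nat.cast_sub hq1] at this
    exact this
  · rw [hcard, add_sub_cancel_left]; exact_mod_cast hs2
  · have : ((Near n q ℓ h).card : ℝ) ≤
      (h ^ 2 * q ^ (n - 2 * t) + (q ^ (t + 1) - 1) ^ K * q ^ (n - K * (t + 1)) : ℕ) := by
      exact_mod_cast hnear
    push_cast [Nat.cast_sub hqt] at this
    exact this
  · linarith [hnb.1]
  · linarith [hnb.2]
  · have hz : ∑ z, g z = ∑ i ∈ Finset.range n, (1 - (i : ℝ) / (n : ℝ)) ^ k := sum_zmod m k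
    rw [← hz]
    have : ∑ z, g z - ∑ z, til g z = g 1 := by
      rw [← Finset.sum_sub_distrib, Finset.sum_eq_single (1 : ZMod n)]
      · simp [til]
      · intro b _ hb; simp [til, hb]
      · simp
    rw [abs_sub_comm, this, abs_of_nonneg (g0 1)]
    exact g1 1
  · rw [hT, hT0]; linarith
  · rw [hT, hT0, hcard]; linarith

end LW

namespace LW

open Filter Topology

theorem pow_step1 (j : ℝ) (hj : 0 ≤ j) (k : ℕ) :
    j ^ (k + 1) + (k + 1) * j ^ k ≤ (j + 1) ^ (k + 1) := by
  induction k with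
  | zero => simp
  | succ k ih =>
    have h1 := mul_le_mul_of_nonneg_left ih (by linarith : 0 ≤ j + 1)
    have h2 : 0 ≤ j ^ k := by positivity
    have h3 : (0 : ℝ) ≤ k * j ^ k := by positivity
    push_cast
    rw [pow_succ (j + 1) (k + 1)]
    have e1 : j ^ (k + 1) = j * j ^ k := by ring
    have e2 : j ^ (k + 1 + 1) = j * (j * j ^ k) := by ring
    rw [e1] at h1
    rw [e2, e1]
    nlinarith

theorem pow_step2 (j : ℝ) (hj : 0 ≤ j) (k : ℕ) :
    (j + 1) ^ (k + 1) ≤ j ^ (k + 1) + (k + 1) * (j + 1) ^ k := by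
  induction k with
  | zero => simp
  | succ k ih =>
    have h1 := mul_le_mul_of_nonneg_left ih hj
    have h2 : 0 ≤ (j + 1) ^ k := by positivity
    have h3 : (0 : ℝ) ≤ k * (j + 1) ^ k := by positivity
    push_cast
    have e1 : (j + 1) ^ (k + 1) = (j + 1) * (j + 1) ^ k := by ring
    have e2 : (j + 1) ^ (k + 1 + 1) = (j + 1) * ((j + 1) * (j + 1) ^ k) := by ring
    have e3 : j ^ (k + 1 + 1) = j * j ^ (k + 1) := by ring
    rw [e1] at h1
    rw [e2, e1, e3]
    nlinarith

theorem psum_lb (k n : ℕ) :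
    (n : ℝ) ^ (k + 1) ≤ (k + 1) * ∑ j ∈ Finset.range n, ((j : ℝ) + 1) ^ k := by
  induction n with
  | zero => simp
  | succ n ih =>
    rw [Finset.sum_range_succ, mul_add]
    have := pow_step2 n (by positivity) k
    push_cast
    linarith

theorem psum_ub (k n : ℕ) :
    (k + 1) * ∑ j ∈ Finset.range n, ((j : ℝ) + 1) ^ k ≤ ((n : ℝ) + 1) ^ (k + 1) := by
  induction n with
  | zero => simp
  | succ n ih =>
    rw [Finset.sum_range_succ, mul_add]
    have := pow_step1 ((n : ℝ) + 1) (by positivity) k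
    push_cast
    linarith

theorem riemann (k : ℕ) : Tendsto (fun n : ℕ =>
    (∑ i ∈ Finset.range n, (1 - (i : ℝ) / (n : ℝ)) ^ k) / n) atTop (𝓝 (1 / ((k : ℝ) + 1))) := by
  have hk : (0 : ℝ) < k + 1 := by positivity
  have key : ∀ n : ℕ, 1 ≤ n → (∑ i ∈ Finset.range n, (1 - (i : ℝ) / (n : ℝ)) ^ k) / n
      = (∑ j ∈ Finset.range n, ((j : ℝ) + 1) ^ k) / (n : ℝ) ^ (k + 1) := by
    intro n hn
    have hn0 : (n : ℝ) ≠ 0 := by positivity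
    rw [← Finset.sum_range_reflect, pow_succ, ← div_div]
    congr 1
    rw [Finset.sum_div]
    apply Finset.sum_congr rfl
    intro j hj
    have hj := Finset.mem_range.1 hj
    rw [Nat.cast_sub (by omega), Nat.cast_sub hn, ← div_pow]
    congr 1
    field_simp
    push_cast
    ring
  have hub : Tendsto (fun n : ℕ => (1 + 1 / (n : ℝ)) ^ (k + 1) / ((k : ℝ) + 1)) atTop
      (𝓝 (1 / ((k : ℝ) + 1))) := by
    have := ((tendsto_one_div_atTop_nhds_zero_nat (𝕜 := ℝ)).const_add 1).pow (k + 1)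
    simpa using this.div_const ((k : ℝ) + 1)
  refine tendsto_of_tendsto_of_tendsto_of_le_of_le' tendsto_const_nhds hub ?_ ?_
  · filter_upwards [eventually_ge_atTop 1] with n hn
    have hn0 : (0 : ℝ) < n := by positivity
    rw [key n hn, div_le_div_iff₀ hk (by positivity)]
    linarith [psum_lb k n]
  · filter_upwards [eventually_ge_atTop 1] with n hn
    have hn0 : (0 : ℝ) < n := by positivity
    have e : (1 + 1 / (n : ℝ)) ^ (k + 1) = ((n : ℝ) + 1) ^ (k + 1) / (n : ℝ) ^ (k + 1) := by
      rw [← div_pow]; congr 1; field_simp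
    rw [key n hn, e, div_div, div_le_div_iff₀ (by positivity) (by positivity)]
    have h2 : (0 : ℝ) < (n : ℝ) ^ (k + 1) := by positivity
    have := mul_le_mul_of_nonneg_left (psum_ub k n) h2.le
    linarith

theorem asym (q k : ℕ) (hq : 2 ≤ q) (L T h ℓ L' s G Nr C A B S : ℕ → ℝ)
    (hh : ∀ᶠ n in atTop, 0 < h n) (hℓ : Tendsto (fun n => ℓ n / h n) atTop (𝓝 0))
    (h1h : Tendsto (fun n => 1 / h n) atTop (𝓝 0))
    (hhn : Tendsto (fun n => h n / n) atTop (𝓝 0))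
    (hG : Tendsto (fun n : ℕ => (n : ℝ) / (q : ℝ) ^ n * G n) atTop (𝓝 0))
    (hNr : Tendsto (fun n : ℕ => (n : ℝ) / (q : ℝ) ^ n * Nr n / h n) atTop (𝓝 0))
    (hev : ∀ᶠ n : ℕ in atTop, 
      0 ≤ G n ∧
      (n : ℝ) * L' n = (q : ℝ) ^ n - G n ∧
      L' n ≤ L n ∧ (n : ℝ) * (L n - L' n) ≤ G n ∧
      s n ≤ L (n - 1) + ((q : ℝ) - 1) ^ n ∧
      (L (n - 1) : ℝ) ≤ s n + (L n - L' n) ∧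
      0 ≤ Nr n ∧
      h n * (L' n - s n) - Nr n ≤ C n ∧ C n ≤ h n * (L' n - s n) + L' n ∧
      |((n : ℝ) - h n) * A n - C n * S n| ≤
        C n * h n + ((n : ℝ) - h n) * (2 * G n + 12 * ℓ n * L' n) ∧
      A n ≤ h n * B n ∧ h n * B n ≤ A n + Nr n ∧
      |S n - ∑ i ∈ Finset.range n, (1 - (i : ℝ) / (n : ℝ)) ^ k| ≤ 1 ∧
      s n * (1 - 1 / (n : ℝ)) ^ k + B n ≤ T n ∧
      T n ≤ s n * (1 - 1 / (n : ℝ)) ^ k + B n + (L n - L' n)) :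
    Tendsto (fun n => T n / L n) atTop
      (𝓝 (1 / (q : ℝ) + ((q : ℝ) - 1) / ((q : ℝ) * ((k : ℝ) + 1)))) := by
  have hq0 : (0 : ℝ) < q := by exact_mod_cast (by omega : 0 < q)
  have hq1 : (1 : ℝ) ≤ q := by exact_mod_cast (by omega : 1 ≤ q)
  have hinv := tendsto_one_div_atTop_nhds_zero_nat (𝕜 := ℝ)
  set u : ℕ → ℝ := fun n => (n : ℝ) / (q : ℝ) ^ n with hu
  have hun : ∀ n : ℕ, 0 ≤ u n := fun n => by simp only [hu]; positivity
  have hup : ∀ n : ℕ, 1 ≤ n → 0 < u n := fun n hn => by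
    have : (0 : ℝ) < n := by positivity
    simp only [hu]; positivity
  have hGq : Tendsto (fun n : ℕ => G n / (q : ℝ) ^ n) atTop (𝓝 0) := by
    have := hinv.mul hG
    rw [mul_zero] at this
    refine this.congr' ?_
    filter_upwards [eventually_ge_atTop 1] with n hn
    have : (n : ℝ) ≠ 0 := by positivity
    field_simp
  have hL' : Tendsto (fun n => u n * L' n) atTop (𝓝 1) := by
    have := hGq.const_sub 1
    rw [sub_zero] at this
    refine this.congr' ?_
    filter_upwards [hev] with n hn
    have e : u n * L' n = ((n : ℝ) * L' n) / (q : ℝ) ^ n := by simp only [hu]; ring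
    rw [e, hn.2.1, sub_div, div_self (by positivity)]
  have hd : Tendsto (fun n => u n * (L n - L' n)) atTop (𝓝 0) := by
    refine squeeze_zero' ?_ ?_ hGq
    · filter_upwards [hev] with n hn
      exact mul_nonneg (hun n) (by linarith [hn.2.2.1])
    · filter_upwards [hev] with n hn
      have e : u n * (L n - L' n) = ((n : ℝ) * (L n - L' n)) / (q : ℝ) ^ n := by
        simp only [hu]; ring
      rw [e]
      have := hn.2.2.2.1
      gcongr
  have hL : Tendsto (fun n => u n * L n) atTop (𝓝 1) := by
    have := hL'.add hd
    rw [add_zero] at this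
    exact this.congr fun n => by ring
  have hLp : Tendsto (fun n => u n * L (n - 1)) atTop (𝓝 (1 / (q : ℝ))) := by
    have h1 := hL.comp (tendsto_sub_atTop_nat 1)
    have h2 : Tendsto (fun n : ℕ => 1 / (1 - 1 / (n : ℝ)) / q) atTop (𝓝 (1 / (q : ℝ))) := by
      have := ((hinv.const_sub 1).inv₀ (by norm_num)).div_const (q : ℝ)
      simpa using this
    have h3 := h1.mul h2
    rw [one_mul] at h3
    refine h3.congr' ?_
    filter_upwards [eventually_ge_atTop 2] with n hn
    obtain ⟨m, rfl⟩ : ∃ m, n = m + 1 := ⟨n - 1, by omega⟩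
    have hm : (m : ℝ) ≠ 0 := by
      have : 1 ≤ m := by omega
      positivity
    have hm1 : (m : ℝ) + 1 ≠ 0 := by positivity
    simp only [hu, Function.comp, Nat.add_sub_cancel]
    push_cast
    have e : 1 - 1 / ((m : ℝ) + 1) = m / (m + 1) := by field_simp; ring
    rw [e, pow_succ]
    field_simp
  have hgeo : Tendsto (fun n => u n * ((q : ℝ) - 1) ^ n) atTop (𝓝 0) := by
    have hr : |((q : ℝ) - 1) / q| < 1 := by
      rw [abs_of_nonneg (div_nonneg (by linarith) hq0.le), div_lt_one hq0]
      linarith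
    have := tendsto_pow_const_mul_const_pow_of_abs_lt_one 1 hr
    refine this.congr fun n => ?_
    simp only [hu]
    rw [div_pow]; ring
  have hs : Tendsto (fun n => u n * s n) atTop (𝓝 (1 / (q : ℝ))) := by
    have hl := hLp.sub hd
    have hr := hLp.add hgeo
    rw [sub_zero] at hl
    rw [add_zero] at hr
    refine tendsto_of_tendsto_of_tendsto_of_le_of_le' hl hr ?_ ?_
    · filter_upwards [hev] with n hn
      have := mul_le_mul_of_nonneg_left hn.2.2.2.2.2.1 (hun n)
      linarith
    · filter_upwards [hev] with n hn
      have := mul_le_mul_of_nonneg_left hn.2.2.2.2.1 (hun n)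
      linarith
  have hLs : Tendsto (fun n => u n * (L' n - s n)) atTop (𝓝 (1 - 1 / (q : ℝ))) :=
    (hL'.sub hs).congr fun n => by ring
  have hC : Tendsto (fun n => u n * C n / h n) atTop (𝓝 (1 - 1 / (q : ℝ))) := by
    have hl := hLs.sub hNr
    have hr := hLs.add (hL'.mul h1h)
    rw [sub_zero] at hl
    rw [mul_zero, add_zero] at hr
    refine tendsto_of_tendsto_of_tendsto_of_le_of_le' hl hr ?_ ?_
    · filter_upwards [hev, hh] with n hn hp
      have := mul_le_mul_of_nonneg_left hn.2.2.2.2.2.2.2.1 (hun n)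
      rw [le_div_iff₀ hp]
      refine le_trans (le_of_eq ?_) this
      simp only [hu]
      field_simp
    · filter_upwards [hev, hh] with n hn hp
      have := mul_le_mul_of_nonneg_left hn.2.2.2.2.2.2.2.2.1 (hun n)
      rw [div_le_iff₀ hp]
      refine le_trans this (le_of_eq ?_)
      field_simp
  have hS : Tendsto (fun n => S n / n) atTop (𝓝 (1 / ((k : ℝ) + 1))) := by
    have h1 : Tendsto (fun n : ℕ => (S n - ∑ i ∈ Finset.range n, (1 - (i : ℝ) / (n : ℝ)) ^ k) / n)
        atTop (𝓝 0) := by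
      refine squeeze_zero_norm' ?_ hinv
      filter_upwards [hev] with n hn
      rw [Real.norm_eq_abs, abs_div, Nat.abs_cast]
      have := hn.2.2.2.2.2.2.2.2.2.2.2.2.1
      gcongr
    have := h1.add (riemann k)
    rw [zero_add] at this
    exact this.congr fun n => by ring
  have hw : Tendsto (fun n : ℕ => (1 - h n / n)⁻¹) atTop (𝓝 1) := by
    have := (hhn.const_sub 1).inv₀ (by norm_num)
    simpa using this
  have hnh : ∀ᶠ n : ℕ in atTop, h n < n := by
    filter_upwards [hhn.eventually (gt_mem_nhds zero_lt_one), eventually_ge_atTop 1] with n h1 hn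
    have : (0 : ℝ) < n := by positivity
    rwa [div_lt_one this] at h1
  have hA : Tendsto (fun n => u n * A n / h n) atTop
      (𝓝 ((1 - 1 / (q : ℝ)) * (1 / ((k : ℝ) + 1)))) := by
    have hmain := (hC.mul hS).mul hw
    rw [mul_one] at hmain
    have herr := ((hC.mul hhn).mul hw).add (((hG.mul h1h).const_mul 2).add
      ((hℓ.mul hL').const_mul 12))
    simp only [mul_zero, zero_mul, add_zero] at herr
    have hdiff : Tendsto (fun n : ℕ => u n * A n / h n - u n * C n / h n * (S n / n) *
        (1 - h n / n)⁻¹) atTop (𝓝 0) := by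
      refine squeeze_zero_norm' ?_ herr
      filter_upwards [hev, hh, hnh, eventually_ge_atTop 1] with n hn hp hlt hn1
      have hn0 : (0 : ℝ) < n := by positivity
      have hsub : 0 < (n : ℝ) - h n := by linarith
      have hb := hn.2.2.2.2.2.2.2.2.2.1
      have e0 : 1 - h n / n = ((n : ℝ) - h n) / n := by field_simp
      have e1 : u n * A n / h n - u n * C n / h n * (S n / n) * (1 - h n / n)⁻¹
          = u n / (h n * (n - h n)) * (((n : ℝ) - h n) * A n - C n * S n) := by
        rw [e0]
        field_simp
      have hc : 0 ≤ u n / (h n * (n - h n)) := div_nonneg (hun n) (by positivity)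
      rw [Real.norm_eq_abs, e1, abs_mul, abs_of_nonneg hc]
      refine le_trans (mul_le_mul_of_nonneg_left hb hc) (le_of_eq ?_)
      rw [e0]
      change _ = u n * C n / h n * (h n / n) * (((n : ℝ) - h n) / n)⁻¹ +
        (2 * (u n * G n * (1 / h n)) + 12 * (ℓ n / h n * (u n * L' n)))
      field_simp
    have := hdiff.add hmain
    rw [zero_add] at this
    exact this.congr fun n => by ring
  have hB : Tendsto (fun n => u n * B n) atTop
      (𝓝 ((1 - 1 / (q : ℝ)) * (1 / ((k : ℝ) + 1)))) := by
    have hr := hA.add hNr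
    rw [add_zero] at hr
    refine tendsto_of_tendsto_of_tendsto_of_le_of_le' hA hr ?_ ?_
    · filter_upwards [hev, hh] with n hn hp
      have := mul_le_mul_of_nonneg_left hn.2.2.2.2.2.2.2.2.2.2.1 (hun n)
      rw [div_le_iff₀ hp]
      linarith
    · filter_upwards [hev, hh] with n hn hp
      have := mul_le_mul_of_nonneg_left hn.2.2.2.2.2.2.2.2.2.2.2.1 (hun n)
      rw [← add_div, le_div_iff₀ hp]
      change _ ≤ u n * A n + u n * Nr n
      linarith
  have hg1 : Tendsto (fun n : ℕ => (1 - 1 / (n : ℝ)) ^ k) atTop (𝓝 1) := by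
    have := (hinv.const_sub 1).pow k
    simpa using this
  have hT : Tendsto (fun n => u n * T n) atTop
      (𝓝 (1 / (q : ℝ) + (1 - 1 / (q : ℝ)) * (1 / ((k : ℝ) + 1)))) := by
    have hl := (hs.mul hg1).add hB
    rw [mul_one] at hl
    have hr := hl.add hd
    rw [add_zero] at hr
    refine tendsto_of_tendsto_of_tendsto_of_le_of_le' hl hr ?_ ?_
    · filter_upwards [hev] with n hn
      have := mul_le_mul_of_nonneg_left hn.2.2.2.2.2.2.2.2.2.2.2.2.2.1 (hun n)
      linarith
    · filter_upwards [hev] with n hn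
      have := mul_le_mul_of_nonneg_left hn.2.2.2.2.2.2.2.2.2.2.2.2.2.2 (hun n)
      linarith
  have hfin := hT.div hL one_ne_zero
  have e : (1 / (q : ℝ) + (1 - 1 / (q : ℝ)) * (1 / ((k : ℝ) + 1))) / 1 =
      1 / (q : ℝ) + ((q : ℝ) - 1) / ((q : ℝ) * ((k : ℝ) + 1)) := by
    have : (k : ℝ) + 1 ≠ 0 := by positivity
    field_simp
  rw [e] at hfin
  refine hfin.congr' ?_
  filter_upwards [eventually_ge_atTop 1] with n hn
  exact mul_div_mul_left _ _ (hup n hn).ne'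

end LW

namespace LW

open Filter Topology

/-- integer ninth root -/
noncomputable def M9 (n : ℕ) : ℕ := Nat.findGreatest (fun m => m ^ 9 ≤ n) n

theorem M9_le (n : ℕ) : M9 n ^ 9 ≤ n :=
  Nat.findGreatest_spec (P := fun m => m ^ 9 ≤ n) (m := 0) (Nat.zero_le _) (by simp)

theorem le_M9 {b n : ℕ} (h : b ^ 9 ≤ n) : b ≤ M9 n :=
  Nat.le_findGreatest (P := fun m => m ^ 9 ≤ n) (le_trans (Nat.le_self_pow (by norm_num) b) h) h

theorem lt_M9 (n : ℕ) : n < (M9 n + 1) ^ 9 := by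
  by_contra hc
  have := le_M9 (not_lt.1 hc)
  omega

theorem tendsto_M9 : Tendsto M9 atTop atTop :=
  tendsto_atTop.2 fun b => (eventually_ge_atTop (b ^ 9)).mono fun _ hn => le_M9 hn

theorem n_le (n : ℕ) (h : 1 ≤ M9 n) : (n : ℝ) ≤ 512 * (M9 n : ℝ) ^ 9 := by
  have h1 : n ≤ (M9 n + M9 n) ^ 9 :=
    (lt_M9 n).le.trans (Nat.pow_le_pow_left (by omega) 9)
  have h2 : (n : ℝ) ≤ ((M9 n : ℝ) + M9 n) ^ 9 := by exact_mod_cast h1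
  refine h2.trans (le_of_eq ?_)
  ring

theorem ev_small (q : ℕ) (hq : 2 ≤ q) : ∀ᶠ m : ℕ in atTop, m ^ 6 < q ^ (m - 1) := by
  have := tendsto_pow_const_mul_const_pow_of_abs_lt_one (r := (1 / 2 : ℝ)) 6
    (by rw [abs_of_pos] <;> norm_num)
  filter_upwards [this.eventually (gt_mem_nhds (by norm_num : (0 : ℝ) < 1 / 2)),
    eventually_ge_atTop 1] with m hm h1
  obtain ⟨j, rfl⟩ : ∃ j, m = j + 1 := ⟨m - 1, by omega⟩
  rw [Nat.add_sub_cancel]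
  have h2 : (j + 1) ^ 6 < 2 ^ j := by
    rw [one_div, inv_pow, ← div_eq_mul_inv, div_lt_iff₀ (by positivity), pow_succ (2 : ℝ)] at hm
    have : ((j + 1 : ℕ) : ℝ) ^ 6 < 2 ^ j := by linarith
    exact_mod_cast this
  exact h2.trans_le (Nat.pow_le_pow_left hq j)

theorem G_bound (q n : ℕ) (G : ℝ) (hq : 2 ≤ q) (hM : 1 ≤ M9 n)
    (hG : G ≤ (n : ℝ) ^ 2 * (q : ℝ) ^ (n - M9 n)) :
    (n : ℝ) / (q : ℝ) ^ n * G ≤ 512 ^ 3 * ((M9 n : ℝ) ^ 27 * (1 / 2 : ℝ) ^ M9 n) := by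
  have hq0 : (0 : ℝ) < q := by exact_mod_cast (by omega : 0 < q)
  have hMn : M9 n ≤ n := (Nat.le_self_pow (by norm_num) _).trans (M9_le n)
  have hn := n_le n hM
  have e : (n : ℝ) / (q : ℝ) ^ n * ((n : ℝ) ^ 2 * (q : ℝ) ^ (n - M9 n))
      = (n : ℝ) ^ 3 * (1 / (q : ℝ)) ^ M9 n := by
    have : (q : ℝ) ^ n = (q : ℝ) ^ (n - M9 n) * (q : ℝ) ^ M9 n := by
      rw [← pow_add, Nat.sub_add_cancel hMn]
    rw [this, one_div, inv_pow]
    field_simp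
  have hq2 : (2 : ℝ) ≤ q := by exact_mod_cast hq
  calc (n : ℝ) / (q : ℝ) ^ n * G
      ≤ (n : ℝ) / (q : ℝ) ^ n * ((n : ℝ) ^ 2 * (q : ℝ) ^ (n - M9 n)) := by gcongr
    _ = (n : ℝ) ^ 3 * (1 / (q : ℝ)) ^ M9 n := e
    _ ≤ (512 * (M9 n : ℝ) ^ 9) ^ 3 * (1 / 2 : ℝ) ^ M9 n := by gcongr
    _ = 512 ^ 3 * ((M9 n : ℝ) ^ 27 * (1 / 2 : ℝ) ^ M9 n) := by ring

theorem N_bound (q n t K : ℕ) (Nr : ℝ) (hq : 2 ≤ q) (hM : 1 ≤ M9 n)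
    (ht1 : q ^ t ≤ M9 n ^ 6) (ht2 : M9 n ^ 6 < q ^ (t + 1))
    (htn : 2 * t ≤ n) (hK : K * (t + 1) ≤ n) (hK8 : M9 n ^ 8 ≤ K)
    (hN : Nr ≤ ((M9 n ^ 2 : ℕ) : ℝ) ^ 2 * (q : ℝ) ^ (n - 2 * t)
        + ((q : ℝ) ^ (t + 1) - 1) ^ K * (q : ℝ) ^ (n - K * (t + 1))) :
    (n : ℝ) / (q : ℝ) ^ n * Nr / ((M9 n ^ 2 : ℕ) : ℝ) ≤
      512 * (q : ℝ) ^ 2 * (1 / (M9 n : ℝ)) +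
      512 * ((M9 n : ℝ) ^ 9 * (Real.exp (-(1 / (q : ℝ)))) ^ M9 n) := by
  have hq0 : (0 : ℝ) < q := by exact_mod_cast (by omega : 0 < q)
  have hn := n_le n hM
  set m := M9 n with hm
  have hm0 : (0 : ℝ) < m := by exact_mod_cast hM
  have hm1 : (1 : ℝ) ≤ m := by exact_mod_cast hM
  have ht1' : (q : ℝ) ^ t ≤ (m : ℝ) ^ 6 := by exact_mod_cast ht1
  have ht2' : (m : ℝ) ^ 6 ≤ (q : ℝ) ^ t * q := by rw [← pow_succ]; exact_mod_cast ht2.le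
  have hK' : (m : ℝ) ^ 8 ≤ K := by exact_mod_cast hK8
  have hQ1 : (1 : ℝ) ≤ (q : ℝ) ^ (t + 1) := one_le_pow₀ (by exact_mod_cast (by omega : 1 ≤ q))
  set Q : ℝ := (q : ℝ) ^ (t + 1) with hQ
  have hQ0 : 0 < Q := by linarith
  push_cast at hN ⊢
  have e1 : (q : ℝ) ^ n = (q : ℝ) ^ (n - 2 * t) * (q : ℝ) ^ (2 * t) := by
    rw [← pow_add, Nat.sub_add_cancel htn]
  have e2 : (q : ℝ) ^ n = (q : ℝ) ^ (n - K * (t + 1)) * Q ^ K := by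
    rw [hQ, ← pow_mul, ← pow_add, mul_comm (t + 1) K, Nat.sub_add_cancel hK]
  have E : (n : ℝ) / (q : ℝ) ^ n * (((m : ℝ) ^ 2) ^ 2 * (q : ℝ) ^ (n - 2 * t)
        + (Q - 1) ^ K * (q : ℝ) ^ (n - K * (t + 1))) / (m : ℝ) ^ 2
      = n * (m : ℝ) ^ 2 / (q : ℝ) ^ (2 * t) + n / (m : ℝ) ^ 2 * (1 - 1 / Q) ^ K := by
    rw [mul_add, add_div]
    congr 1
    · rw [e1]; field_simp
    · have : (1 - 1 / Q) ^ K = (Q - 1) ^ K / Q ^ K := by rw [← div_pow]; congr 1; field_simp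
      rw [e2, this]; field_simp
  have B1 : n * (m : ℝ) ^ 2 / (q : ℝ) ^ (2 * t) ≤ 512 * (q : ℝ) ^ 2 * (1 / (m : ℝ)) := by
    rw [div_le_iff₀ (by positivity)]
    have h12 : (m : ℝ) ^ 12 ≤ (q : ℝ) ^ (2 * t) * (q : ℝ) ^ 2 := by
      calc (m : ℝ) ^ 12 = ((m : ℝ) ^ 6) ^ 2 := by ring
        _ ≤ ((q : ℝ) ^ t * q) ^ 2 := by gcongr
        _ = _ := by ring
    calc n * (m : ℝ) ^ 2 ≤ 512 * (m : ℝ) ^ 9 * (m : ℝ) ^ 2 := by gcongr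
      _ = 512 * (m : ℝ) ^ 12 * (1 / (m : ℝ)) := by field_simp
      _ ≤ 512 * ((q : ℝ) ^ (2 * t) * (q : ℝ) ^ 2) * (1 / (m : ℝ)) := by gcongr
      _ = _ := by ring
  have B2 : (1 - 1 / Q) ^ K ≤ (Real.exp (-(1 / (q : ℝ)))) ^ m := by
    have h1 : 1 - 1 / Q ≤ Real.exp (-(1 / Q)) := by
      have := Real.add_one_le_exp (-(1 / Q)); linarith
    have h0 : 0 ≤ 1 - 1 / Q := by
      have : 1 / Q ≤ 1 := by rw [div_le_one hQ0]; exact hQ1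
      linarith
    refine (pow_le_pow_left₀ h0 h1 K).trans ?_
    rw [← Real.exp_nat_mul, ← Real.exp_nat_mul, Real.exp_le_exp]
    have hQm : Q ≤ q * (m : ℝ) ^ 6 := by
      rw [hQ, pow_succ]; nlinarith
    have : (m : ℝ) * (1 / q) ≤ K * (1 / Q) := by
      rw [mul_one_div, mul_one_div, div_le_div_iff₀ hq0 hQ0]
      calc (m : ℝ) * Q ≤ m * (q * (m : ℝ) ^ 6) := by gcongr
        _ = (m : ℝ) ^ 7 * q := by ring
        _ ≤ (m : ℝ) ^ 8 * q := by gcongr <;> first | exact hm1 | norm_num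
        _ ≤ K * q := by gcongr
    linarith
  have B3 : (n : ℝ) / (m : ℝ) ^ 2 ≤ 512 * (m : ℝ) ^ 9 :=
    (div_le_self (by positivity) (one_le_pow₀ hm1)).trans hn
  calc (n : ℝ) / (q : ℝ) ^ n * Nr / (m : ℝ) ^ 2
      ≤ (n : ℝ) / (q : ℝ) ^ n * (((m : ℝ) ^ 2) ^ 2 * (q : ℝ) ^ (n - 2 * t)
        + (Q - 1) ^ K * (q : ℝ) ^ (n - K * (t + 1))) / (m : ℝ) ^ 2 := by gcongr
    _ = n * (m : ℝ) ^ 2 / (q : ℝ) ^ (2 * t) + n / (m : ℝ) ^ 2 * (1 - 1 / Q) ^ K := E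
    _ ≤ 512 * (q : ℝ) ^ 2 * (1 / (m : ℝ)) +
        512 * (m : ℝ) ^ 9 * (Real.exp (-(1 / (q : ℝ)))) ^ m := by
      refine add_le_add B1 ?_
      refine (mul_le_mul_of_nonneg_left B2 (by positivity)).trans ?_
      gcongr
    _ = _ := by ring

theorem main (q : ℕ) (hq : 2 ≤ q) (k : ℕ) :
    Tendsto (fun n : ℕ =>
        (∑ w ∈ lyndonWords q n, ((srfLen (List.ofFn w) : ℝ) / n) ^ k)
          / ((lyndonWords q n).card : ℝ))
      atTop
      (𝓝 (1 / (q : ℝ) + ((q : ℝ) - 1) / ((q : ℝ) * ((k : ℝ) + 1)))) := by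
  have hq0 : (0 : ℝ) < q := by exact_mod_cast (by omega : 0 < q)
  have hMr : Tendsto (fun n => (M9 n : ℝ)) atTop atTop :=
    tendsto_natCast_atTop_atTop.comp tendsto_M9
  have hMi : Tendsto (fun n => 1 / (M9 n : ℝ)) atTop (𝓝 0) := by
    exact hMr.inv_tendsto_atTop.congr fun n => by rw [one_div]; rfl
  have hconds : ∀ᶠ n : ℕ in atTop, 2 ≤ M9 n ∧ M9 n ^ 6 < q ^ (M9 n - 1) :=
    (tendsto_M9.eventually (eventually_ge_atTop 2)).and (tendsto_M9.eventually (ev_small q hq))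
  let t : ℕ → ℕ := fun n => Nat.log q (M9 n ^ 6)
  let K : ℕ → ℕ := fun n => n / (t n + 1)
  have hpar : ∀ᶠ n : ℕ in atTop, 2 ≤ M9 n ∧ 3 ≤ n ∧ 2 * M9 n ≤ n ∧ M9 n ^ 2 < n ∧
      M9 n ≤ M9 n ^ 2 ∧ t n + 1 ≤ M9 n ∧ M9 n ^ 2 + t n ≤ n ∧ K n * (t n + 1) ≤ n ∧
      2 * t n ≤ n ∧ M9 n ^ 8 ≤ K n ∧ q ^ t n ≤ M9 n ^ 6 ∧ M9 n ^ 6 < q ^ (t n + 1) := by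
    filter_upwards [hconds] with n ⟨h2, h6⟩
    have h9 := M9_le n
    have ht : t n + 1 ≤ M9 n := by
      have : t n < M9 n - 1 := Nat.log_lt_of_lt_pow (by positivity) h6
      omega
    have hsq : M9 n ^ 2 * 8 ≤ M9 n ^ 9 := by
      calc M9 n ^ 2 * 8 = M9 n ^ 2 * 2 ^ 3 := by norm_num
        _ ≤ M9 n ^ 2 * M9 n ^ 3 := by gcongr
        _ = M9 n ^ 5 := by ring
        _ ≤ M9 n ^ 9 := Nat.pow_le_pow_right (by omega) (by norm_num)
    have hm2 : 2 * M9 n ≤ M9 n ^ 2 := by nlinarith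
    refine ⟨h2, by omega, by omega, by omega, by omega, ht, by omega,
      Nat.div_mul_le_self _ _, by omega, ?_, ?_, ?_⟩
    · rw [Nat.le_div_iff_mul_le (by omega)]
      calc M9 n ^ 8 * (t n + 1) ≤ M9 n ^ 8 * M9 n := by gcongr
        _ = M9 n ^ 9 := by ring
        _ ≤ n := h9
    · exact Nat.pow_log_le_self q (by positivity)
    · exact Nat.lt_pow_succ_log_self (by omega) _
  have hpack := fun n (hn : _ ∧ _) => finite_pack q k n (M9 n) (M9 n ^ 2) (t n) (K n) hq
    (hn : 2 ≤ M9 n ∧ 3 ≤ n ∧ 2 * M9 n ≤ n ∧ M9 n ^ 2 < n ∧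
      M9 n ≤ M9 n ^ 2 ∧ t n + 1 ≤ M9 n ∧ M9 n ^ 2 + t n ≤ n ∧ K n * (t n + 1) ≤ n ∧
      2 * t n ≤ n ∧ M9 n ^ 8 ≤ K n ∧ q ^ t n ≤ M9 n ^ 6 ∧ M9 n ^ 6 < q ^ (t n + 1)).2.1
    hn.2.2.1 hn.2.2.2.1 hn.2.2.2.2.1 hn.2.2.2.2.2.1 hn.2.2.2.2.2.2.1 hn.2.2.2.2.2.2.2.1
  choose! L' s G Nr C A B S hall using hpack
  have hh0 : ∀ᶠ n : ℕ in atTop, 0 < ((M9 n ^ 2 : ℕ) : ℝ) := by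
    filter_upwards [hpar] with n hn
    have : 0 < M9 n := by omega
    positivity
  have hsqi : Tendsto (fun n => 1 / ((M9 n ^ 2 : ℕ) : ℝ)) atTop (𝓝 0) := by
    have := hMi.mul hMi
    rw [mul_zero] at this
    refine this.congr fun n => ?_
    push_cast
    rw [div_mul_div_comm, one_mul, sq]
  refine asym q k hq (fun n => ((lyndonWords q n).card : ℝ))
    (fun n => ∑ w ∈ lyndonWords q n, ((srfLen (List.ofFn w) : ℝ) / n) ^ k)
    (fun n => ((M9 n ^ 2 : ℕ) : ℝ)) (fun n => (M9 n : ℝ)) L' s G Nr C A B S hh0 ?_ hsqi ?_ ?_ ?_ ?_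
  · refine hMi.congr' ?_
    filter_upwards [hpar] with n hn
    have : 0 < (M9 n : ℝ) := by exact_mod_cast (by omega : 0 < M9 n)
    push_cast
    field_simp
  · refine squeeze_zero' (Eventually.of_forall fun n => by positivity) ?_ hMi
    filter_upwards [hpar] with n hn
    have h0 : 0 < (M9 n : ℝ) := by exact_mod_cast (by omega : 0 < M9 n)
    have hn0 : 0 < (n : ℝ) := by exact_mod_cast (by omega : 0 < n)
    rw [div_le_div_iff₀ hn0 h0, one_mul]
    have : M9 n ^ 2 * M9 n ≤ n := by
      refine le_trans ?_ (M9_le n)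
      rw [← pow_succ]
      exact Nat.pow_le_pow_right (by omega) (by norm_num)
    exact_mod_cast this
  · have hlim : Tendsto (fun n => 512 ^ 3 * ((M9 n : ℝ) ^ 27 * (1 / 2 : ℝ) ^ M9 n)) atTop (𝓝 0) := by
      have := ((tendsto_pow_const_mul_const_pow_of_abs_lt_one (r := (1 / 2 : ℝ)) 27
        (by rw [abs_of_pos] <;> norm_num)).comp tendsto_M9).const_mul (512 ^ 3)
      rw [mul_zero] at this
      exact this
    refine squeeze_zero' ?_ ?_ hlim
    · filter_upwards [hpar] with n hn
      have := (hall n hn).1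
      positivity
    · filter_upwards [hpar] with n hn
      exact G_bound q n (G n) hq (by omega) (hall n hn).2.1
  · have hlim : Tendsto (fun n => 512 * (q : ℝ) ^ 2 * (1 / (M9 n : ℝ)) +
        512 * ((M9 n : ℝ) ^ 9 * (Real.exp (-(1 / (q : ℝ)))) ^ M9 n)) atTop (𝓝 0) := by
      have h1 := hMi.const_mul (512 * (q : ℝ) ^ 2)
      have h2 := ((tendsto_pow_const_mul_const_pow_of_abs_lt_one
        (r := Real.exp (-(1 / (q : ℝ)))) 9
        (by
          rw [abs_of_pos (Real.exp_pos _), Real.exp_lt_one_iff]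
          have : 0 < 1 / (q : ℝ) := by positivity
          linarith)).comp tendsto_M9).const_mul 512
      have := h1.add h2
      rw [mul_zero, mul_zero, add_zero] at this
      exact this
    refine squeeze_zero' ?_ ?_ hlim
    · filter_upwards [hpar] with n hn
      have := (hall n hn).2.2.2.2.2.2.2.1
      positivity
    · filter_upwards [hpar] with n hn
      have h9 := (hall n hn).2.2.2.2.2.2.2.2.1
      obtain ⟨a1, a2, a3, a4, a5, a6, a7, a8, a9, a10, a11, a12⟩ := hn
      exact N_bound q n (t n) (K n) (Nr n) hq (by omega) a11 a12 a9 a8 a10 h9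
  · filter_upwards [hpar] with n hn
    obtain ⟨b1, b2, b3, b4, b5, b6, b7, b8, b9, b10, b11, b12, b13, b14, b15, b16, b17⟩ := hall n hn
    exact ⟨b1, b3, b4, b5, b6, b7, b8, b10, b11, b12, b13, b14, b15, b16, b17⟩

end LW

theorem stmt_2 (q : ℕ) (hq : 2 ≤ q) (k : ℕ) (hk : 1 ≤ k) :
    Filter.Tendsto (fun n : ℕ =>
        (∑ w ∈ lyndonWords q n, ((srfLen (List.ofFn w) : ℝ) / n) ^ k)
          / ((lyndonWords q n).card : ℝ))
      Filter.atTop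
      (nhds (1 / (q : ℝ) + ((q : ℝ) - 1) / ((q : ℝ) * ((k : ℝ) + 1)))) := by
  exact LW.main q hq k
end

section
/- For a two-letter totally ordered alphabet, let R_n denote the length of the standard right factor of a uniformly random Lyndon word of length n. Then E[R_n]/n converges to 3/4 as n → ∞. -/
open scoped Classical

namespace LyndonProof

/-- Value of the binary word `c i, ..., c (i+L-1)`. -/
def W (c : ℕ → ℕ) : ℕ → ℕ → ℕ
  | 0, _ => 0
  | (L+1), i => 2 * W c L i + c (i+L)

lemma W_add (c : ℕ → ℕ) (L M i : ℕ) : W c (L+M) i = 2^M * W c L i + W c M (i+L) := by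
  induction M with
  | zero => simp [W]
  | succ M ih =>
    rw [← Nat.add_assoc]
    simp only [W]
    rw [ih, Nat.add_assoc i L M]
    ring

lemma W_lt {c : ℕ → ℕ} (hc : ∀ i, c i ≤ 1) (L i : ℕ) : W c L i < 2^L := by
  induction L with
  | zero => simp [W]
  | succ M ih =>
    simp only [W]
    have := hc (i+M)
    rw [pow_succ]; omega

lemma W_congr {c c' : ℕ → ℕ} {L i j : ℕ} (h : ∀ t, t < L → c (i+t) = c' (j+t)) :
    W c L i = W c' L j := by
  induction L with
  | zero => simp [W]
  | succ M ih =>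
    simp only [W]
    rw [ih (fun t ht => h t (by omega)), h M (by omega)]

lemma W_inj {c c' : ℕ → ℕ} (hc : ∀ i, c i ≤ 1) (hc' : ∀ i, c' i ≤ 1) {L i j : ℕ}
    (h : W c L i = W c' L j) : ∀ t, t < L → c (i+t) = c' (j+t) := by
  induction L with
  | zero => intro t ht; omega
  | succ M ih =>
    simp only [W] at h
    have h1 := hc (i+M)
    have h2 := hc' (j+M)
    intro t ht
    rcases Nat.lt_succ_iff_lt_or_eq.mp ht with h3 | h3
    · exact ih (by omega) t h3
    · subst h3; omega

lemma W_lt_prefix {c : ℕ → ℕ} (hc : ∀ i, c i ≤ 1) {m L i j : ℕ} (hmL : m ≤ L)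
    (h : W c m i < W c m j) : W c L i < W c L j := by
  obtain ⟨r, rfl⟩ := Nat.exists_eq_add_of_le hmL
  rw [W_add, W_add]
  have h1 := W_lt hc r (i+m)
  have h2 : 2^r * (W c m i + 1) ≤ 2^r * W c m j := Nat.mul_le_mul_left _ h
  rw [Nat.mul_add] at h2
  omega

lemma W_le_prefix {c : ℕ → ℕ} (hc : ∀ i, c i ≤ 1) {m L i j : ℕ} (hmL : m ≤ L)
    (h : W c L i ≤ W c L j) : W c m i ≤ W c m j := by
  by_contra h'
  have := W_lt_prefix hc hmL (not_le.mp h')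
  omega

lemma W_prev {c : ℕ → ℕ} (L i : ℕ) (h : c i = 0) : W c L i ≤ W c L (i+1) := by
  have h1 := W_add c 1 L i
  have h2 := W_add c L 1 i
  rw [Nat.add_comm 1 L] at h1
  have h3 : W c 1 i = 0 := by simp [W, h]
  rw [h3] at h1
  omega

lemma W_zero_iff {c : ℕ → ℕ} {L i : ℕ} : W c L i = 0 ↔ ∀ t, t < L → c (i+t) = 0 := by
  induction L with
  | zero => simp [W]
  | succ M ih =>
    simp only [W]
    constructor
    · intro h t ht
      rcases Nat.lt_succ_iff_lt_or_eq.mp ht with h3 | h3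
      · exact ih.mp (by omega) t h3
      · subst h3; omega
    · intro h
      rw [ih.mpr (fun t ht => h t (by omega)), h M (by omega)]

section
variable {n : ℕ} [NeZero n]

/-- periodic extension -/
def ex (x : Fin n → Fin 2) (i : ℕ) : ℕ := (x (Fin.ofNat n i)).val

lemma ex_le (x : Fin n → Fin 2) (i : ℕ) : ex x i ≤ 1 := by
  unfold ex; omega

lemma ex_congr (x : Fin n → Fin 2) {i j : ℕ} (h : i % n = j % n) : ex x i = ex x j := by
  unfold ex
  congr 2
  exact Fin.ext h

lemma ex_lt (x : Fin n → Fin 2) {i : ℕ} (h : i < n) : ex x i = (x ⟨i, h⟩).val := by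
  unfold ex
  congr 2
  exact Fin.ext (Nat.mod_eq_of_lt h)

lemma ex_ext {x y : Fin n → Fin 2} (h : ∀ i, i < n → ex x i = ex y i) : x = y := by
  funext i
  have := h i i.2
  rw [ex_lt x i.2, ex_lt y i.2] at this
  exact Fin.ext this

lemma W_mod (x : Fin n → Fin 2) (L : ℕ) {i j : ℕ} (h : i % n = j % n) :
    W (ex x) L i = W (ex x) L j :=
  W_congr (fun t _ => ex_congr x (by rw [Nat.add_mod, h, ← Nat.add_mod]))

/-- rotation -/
def sh (x : Fin n → Fin 2) (k : ℕ) : Fin n → Fin 2 := fun i => x (Fin.ofNat n (i + k))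

lemma ex_sh (x : Fin n → Fin 2) (k i : ℕ) : ex (sh x k) i = ex x (i+k) := by
  unfold ex sh
  congr 2
  exact Fin.ext (by simp)

lemma W_sh (x : Fin n → Fin 2) (k L i : ℕ) : W (ex (sh x k)) L i = W (ex x) L (i+k) :=
  W_congr (fun t _ => by rw [ex_sh]; congr 1; omega)

lemma lexA (w : Fin n → Fin 2) {i j : ℕ} (hi : i < n) (hj : j < n) :
    List.Lex (· < ·) ((List.ofFn w).drop j) ((List.ofFn w).drop i) ↔
      (W (ex w) (n - max i j) j < W (ex w) (n - max i j) i ∨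
        (i < j ∧ W (ex w) (n-j) j = W (ex w) (n-j) i)) := by
  have key : List.Lex (· < ·) ((List.ofFn w).drop j) ((List.ofFn w).drop i) ↔
      (List.ofFn w).drop j < (List.ofFn w).drop i := Iff.rfl
  have hg : ∀ (a t : ℕ) (h : a + t < n) (h' : t < ((List.ofFn w).drop a).length),
      (((List.ofFn w).drop a)[t]).val = ex w (a+t) := by
    intro a t h h'
    rw [ex_lt w h]; simp
  rw [key, List.lt_iff_exists]
  constructor
  · rintro (⟨h1, h2⟩ | ⟨t, h1, h2, h3, h4⟩)
    · simp at h2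
      right
      refine ⟨by omega, ?_⟩
      apply W_congr
      intro t ht
      have a1 : t < ((List.ofFn w).drop j).length := by simp; omega
      have a2 : t < ((List.ofFn w).drop i).length := by simp; omega
      rw [← hg j t (by omega) a1, ← hg i t (by omega) a2]
      congr 1
      conv_lhs => rw [List.getElem_of_eq h1]
      simp
    · left
      have b1 : j + t < n := by simp at h1; omega
      have b2 : i + t < n := by simp at h2; omega
      apply W_lt_prefix (ex_le w) (m := t+1) (by omega)
      simp only [W]
      have e1 : W (ex w) t j = W (ex w) t i := by
        apply W_congr
        intro s hs
        have a1 : s < ((List.ofFn w).drop j).length := by simp; omega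
        have a2 : s < ((List.ofFn w).drop i).length := by simp; omega
        rw [← hg j s (by omega) a1, ← hg i s (by omega) a2]
        exact congrArg _ (h3 s hs)
      rw [e1, ← hg j t b1 h1, ← hg i t b2 h2]
      have := Fin.lt_def.mp h4
      omega
  · intro h
    by_cases hd : ∃ t, i + t < n ∧ j + t < n ∧ ex w (j+t) ≠ ex w (i+t)
    · right
      have hs := Nat.find_spec hd
      have hm := fun s => Nat.find_min hd (m := s)
      set t := Nat.find hd
      obtain ⟨b2, b1, h3⟩ := hs
      have a1 : t < ((List.ofFn w).drop j).length := by simp; omega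
      have a2 : t < ((List.ofFn w).drop i).length := by simp; omega
      have heq : ∀ s, s < t → ex w (j+s) = ex w (i+s) := by
        intro s hs
        have := hm s hs
        by_contra h'
        exact this ⟨by omega, by omega, h'⟩
      refine ⟨t, a1, a2, ?_, ?_⟩
      · intro s hs
        apply Fin.ext
        rw [hg j s (by omega), hg i s (by omega)]
        exact heq s hs
      · rw [Fin.lt_def, hg j t b1, hg i t b2]
        by_contra hlt
        have h5 : ex w (i+t) < ex w (j+t) := by omega
        have h6 : W (ex w) (t+1) i < W (ex w) (t+1) j := by
          simp only [W]
          rw [W_congr (c := ex w) (c' := ex w) heq]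
          omega
        rcases h with h | ⟨h7, h⟩
        · have := W_lt_prefix (ex_le w) (L := n - max i j) (by omega) h6
          omega
        · have := W_lt_prefix (ex_le w) (L := n - j) (by omega) h6
          omega
    · push Not at hd
      have hlt : i < j := by
        rcases h with h | h
        · exfalso
          have : W (ex w) (n - max i j) j = W (ex w) (n - max i j) i :=
            W_congr (fun t ht => hd t (by omega) (by omega))
          omega
        · exact h.1
      left
      refine ⟨?_, by simp; omega⟩
      apply List.ext_getElem
      · simp; omega
      · intro t a1 a2
        apply Fin.ext
        have b1 : j + t < n := by simp at a1; omega
        rw [hg j t b1, hd t (by omega) b1, List.getElem_take, hg i t (by omega)]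

lemma lyndon_iff (w : Fin n → Fin 2) : IsLyndon (List.ofFn w) ↔
    ∀ i, 0 < i → i < n → W (ex w) (n-i) 0 < W (ex w) (n-i) i := by
  unfold IsLyndon
  have hn : 0 < n := Nat.pos_of_ne_zero (NeZero.ne n)
  simp only [List.length_ofFn]
  refine forall_congr' fun i => forall_congr' fun h0 => forall_congr' fun h1 => ?_
  have := lexA w h1 hn
  rw [List.drop_zero] at this
  rw [this]
  simp

/-- `k` is the position of the least rotation, `e` that of the second least one -/
def Q (x : Fin n → Fin 2) (k e : ℕ) : Prop :=
  k < n ∧ e < n ∧ k ≠ e ∧ (∀ i, i < n → i ≠ k → W (ex x) n k < W (ex x) n i) ∧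
    (∀ i, i < n → i ≠ k → i ≠ e → W (ex x) n e < W (ex x) n i)

lemma Q_unique {x : Fin n → Fin 2} {k e k' e' : ℕ} (h : Q x k e) (h' : Q x k' e') :
    k = k' ∧ e = e' := by
  obtain ⟨h1, h2, h3, h4, h5⟩ := h
  obtain ⟨g1, g2, g3, g4, g5⟩ := h'
  have hk : k = k' := by
    by_contra hne
    have := h4 k' g1 (Ne.symm hne)
    have := g4 k h1 hne
    omega
  subst hk
  refine ⟨rfl, ?_⟩
  by_contra hne
  have := h5 e' g2 (Ne.symm g3) (Ne.symm hne)
  have := g5 e h2 (Ne.symm h3) hne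
  omega

lemma Q_lyndon {w : Fin n → Fin 2} {e : ℕ} (h : Q w 0 e) : IsLyndon (List.ofFn w) := by
  rw [lyndon_iff]
  intro i h0 hi
  obtain ⟨h1, h2, h3, h4, h5⟩ := h
  have a1 := h4 i hi (by omega)
  have a2 := h4 (n-i) (by omega) (by omega)
  have b1 := W_le_prefix (ex_le w) (m := n - i) (by omega) a1.le
  have b2 := W_le_prefix (ex_le w) (m := i) (by omega) a2.le
  rcases b1.lt_or_eq with b1 | b1
  · exact b1
  · exfalso
    have c1 := W_add (ex w) (n-i) i 0
    have c2 := W_add (ex w) (n-i) i i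
    rw [Nat.sub_add_cancel hi.le, b1] at c1
    rw [Nat.sub_add_cancel hi.le, W_mod w i (j := 0) (by simp [Nat.add_sub_cancel' hi.le])] at c2
    rw [Nat.zero_add] at c1
    omega

lemma lyndon_lt0 {w : Fin n → Fin 2} (h : IsLyndon (List.ofFn w)) {i : ℕ} (h0 : 0 < i)
    (hi : i < n) : W (ex w) n 0 < W (ex w) n i :=
  W_lt_prefix (ex_le w) (m := n - i) (by omega) ((lyndon_iff w).mp h i h0 hi)

lemma lyndon_lt {w : Fin n → Fin 2} (h : IsLyndon (List.ofFn w)) {i j : ℕ} (h0 : 0 < i)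
    (hi : i < n) (hj : j < n)
    (hl : List.Lex (· < ·) ((List.ofFn w).drop j) ((List.ofFn w).drop i)) :
    W (ex w) n j < W (ex w) n i := by
  rw [lexA w hi hj] at hl
  rcases hl with hl | ⟨hij, hl⟩
  · exact W_lt_prefix (ex_le w) (by omega) hl
  · have c1 := W_add (ex w) (n-j) j j
    have c2 := W_add (ex w) (n-j) j i
    have h3 := (lyndon_iff w).mp h (i + (n-j)) (by omega) (by omega)
    have h4 := W_lt_prefix (ex_le w) (L := j) (by omega) h3
    rw [Nat.sub_add_cancel hj.le] at c1 c2
    rw [W_mod w j (i := j + (n-j)) (j := 0) (by simp [Nat.add_sub_cancel' hj.le]), hl] at c1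
    omega

lemma lyndon_Q {w : Fin n → Fin 2} (hn : 2 ≤ n) (h : IsLyndon (List.ofFn w)) :
    ∃ e, Q w 0 e ∧ srfLen (List.ofFn w) = n - e := by
  have hlt : ∀ i j, 0 < i → i < n → j < n →
      List.Lex (· < ·) ((List.ofFn w).drop j) ((List.ofFn w).drop i) →
      W (ex w) n j < W (ex w) n i := fun i j a b c d => lyndon_lt h a b c d
  have htri : ∀ i j, i < n → j < n → i ≠ j →
      List.Lex (· < ·) ((List.ofFn w).drop j) ((List.ofFn w).drop i) ∨
      List.Lex (· < ·) ((List.ofFn w).drop i) ((List.ofFn w).drop j) := by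
    intro i j hi hj hij
    rcases lt_trichotomy ((List.ofFn w).drop j) ((List.ofFn w).drop i) with h1 | h1 | h1
    · exact Or.inl h1
    · exfalso
      have := congrArg List.length h1
      simp at this
      omega
    · exact Or.inr h1
  obtain ⟨e, he, hmin⟩ := Finset.exists_min_image (Finset.Ico 1 n) (fun i => W (ex w) n i)
    ⟨1, by simp; omega⟩
  simp only [Finset.mem_Ico] at he hmin
  have hstrict : ∀ i, 0 < i → i < n → i ≠ e → W (ex w) n e < W (ex w) n i := by
    intro i h0 hi hne
    have := hmin i ⟨h0, hi⟩
    rcases htri i e hi he.2 hne with h1 | h1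
    · exact hlt i e h0 hi he.2 h1
    · have := hlt e i (by omega) he.2 hi h1
      omega
  refine ⟨e, ⟨by omega, he.2, by omega, fun i hi h0 => lyndon_lt0 h (by omega) hi,
    fun i hi h0 hne => hstrict i (by omega) hi hne⟩, ?_⟩
  unfold srfLen
  have hset : {i | 0 < i ∧ i < (List.ofFn w).length ∧
    ∀ j, 0 < j → j < (List.ofFn w).length →
      ¬ List.Lex (· < ·) ((List.ofFn w).drop j) ((List.ofFn w).drop i)} = {e} := by
    ext i
    simp only [List.length_ofFn, Set.mem_ofPred_eq, Set.mem_singleton_iff]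
    constructor
    · rintro ⟨h0, hi, hall⟩
      by_contra hne
      rcases htri i e hi he.2 hne with h1 | h1
      · exact hall e (by omega) he.2 h1
      · have := hlt e i (by omega) he.2 hi h1
        have := hstrict i h0 hi hne
        omega
    · rintro rfl
      refine ⟨by omega, he.2, fun j h0 hj hl => ?_⟩
      have := hlt i j (by omega) he.2 hj hl
      have := hmin j ⟨h0, hj⟩
      omega
  rw [hset]
  simp

end

section
variable {n : ℕ} [NeZero n]

lemma Q_sh {w : Fin n → Fin 2} {e k : ℕ} (hk : k < n) (h : Q w 0 e) :
    Q (sh w (n-k)) k ((k+e) % n) := by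
  obtain ⟨h1, h2, h3, h4, h5⟩ := h
  have hW : ∀ i, W (ex (sh w (n-k))) n i = W (ex w) n ((i + (n-k)) % n) := by
    intro i
    rw [W_sh]
    exact W_mod w n (by simp)
  have hval : ∀ i, i < n → (i + (n-k)) % n = if i < k then i + (n-k) else i - k := by
    intro i hi
    split_ifs with hik
    · exact Nat.mod_eq_of_lt (by omega)
    · have : i + (n-k) = (i-k) + n := by omega
      rw [this, Nat.add_mod_right]
      exact Nat.mod_eq_of_lt (by omega)
  have hke : (k+e) % n = if k + e < n then k + e else k + e - n := by
    split_ifs with hik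
    · exact Nat.mod_eq_of_lt (by omega)
    · rw [Nat.mod_eq_sub_mod (by omega)]
      exact Nat.mod_eq_of_lt (by omega)
  have hk0 : (k + (n-k)) % n = 0 := by rw [hval k hk]; simp
  have hken : (k+e) % n < n := Nat.mod_lt _ h1
  have hke0 : ((k+e) % n + (n-k)) % n = e := by
    rw [hval _ hken, hke]
    split_ifs <;> omega
  refine ⟨hk, hken, ?_, ?_, ?_⟩
  · rw [hke]; split_ifs <;> omega
  · intro i hi hne
    rw [hW, hW, hk0]
    apply h4 _ (Nat.mod_lt _ h1)
    rw [hval i hi]; split_ifs <;> omega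
  · intro i hi hne hne2
    rw [hW, hW, hke0]
    apply h5 _ (Nat.mod_lt _ h1)
    · rw [hval i hi]; split_ifs <;> omega
    · rw [hke] at hne2
      rw [hval i hi]; split_ifs at hne2 ⊢ <;> omega

lemma Q_sh' {x : Fin n → Fin 2} {e k : ℕ} (h : Q x k e) : ∃ e', Q (sh x k) 0 e' := by
  have hk := h.1
  obtain ⟨h1, h2, h3, h4, h5⟩ := h
  have hW : ∀ i, W (ex (sh x k)) n i = W (ex x) n ((i + k) % n) := by
    intro i
    rw [W_sh]
    exact W_mod x n (by simp)
  have hval : ∀ i, i < n → (i + k) % n = if i + k < n then i + k else i + k - n := by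
    intro i hi
    split_ifs with hik
    · exact Nat.mod_eq_of_lt (by omega)
    · rw [Nat.mod_eq_sub_mod (by omega)]
      exact Nat.mod_eq_of_lt (by omega)
  have hn : 0 < n := by omega
  refine ⟨if k ≤ e then e - k else e + n - k, hn, ?_, ?_, ?_, ?_⟩
  · split_ifs <;> omega
  · split_ifs <;> omega
  · intro i hi hne
    rw [hW, hW, hval 0 hn, hval i hi]
    rw [if_pos (by omega), Nat.zero_add]
    apply h4
    · split_ifs <;> omega
    · split_ifs <;> omega
  · intro i hi hne hne2
    have : ((if k ≤ e then e - k else e + n - k) + k) % n = e := by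
      split_ifs
      · rw [Nat.sub_add_cancel (by assumption)]; exact Nat.mod_eq_of_lt h2
      · rw [Nat.sub_add_cancel (by omega), Nat.add_mod_right]; exact Nat.mod_eq_of_lt h2
    rw [hW, hW, this, hval i hi]
    apply h5
    · split_ifs <;> omega
    · split_ifs <;> omega
    · split_ifs at hne2 ⊢ <;> omega

lemma sh_sh (x : Fin n → Fin 2) {k : ℕ} (hk : k ≤ n) : sh (sh x k) (n-k) = x := by
  apply ex_ext
  intro i _
  rw [ex_sh, ex_sh]
  apply ex_congr
  rw [show i + (n-k) + k = i + n by omega, Nat.add_mod_right]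

lemma sh_sh' (x : Fin n → Fin 2) {k : ℕ} (hk : k ≤ n) : sh (sh x (n-k)) k = x := by
  apply ex_ext
  intro i _
  rw [ex_sh, ex_sh]
  apply ex_congr
  rw [show i + k + (n-k) = i + n by omega, Nat.add_mod_right]

/-- length of right factor in terms of positions -/
def Rr (n k e : ℕ) : ℕ := if k < e then n - (e-k) else k - e

noncomputable def F (x : Fin n → Fin 2) : ℕ :=
  if h : ∃ p : ℕ × ℕ, Q x p.1 p.2 then Rr n h.choose.1 h.choose.2 else 0

lemma F_eq {x : Fin n → Fin 2} {k e : ℕ} (h : Q x k e) : F x = Rr n k e := by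
  have hex : ∃ p : ℕ × ℕ, Q x p.1 p.2 := ⟨(k,e), h⟩
  unfold F
  rw [dif_pos hex]
  obtain ⟨h1, h2⟩ := Q_unique hex.choose_spec h
  rw [h1, h2]

lemma F_le (x : Fin n → Fin 2) : F x ≤ n := by
  unfold F
  split_ifs with h
  · have := h.choose_spec.1
    unfold Rr
    split_ifs <;> omega
  · omega

variable (n) in
noncomputable def Y : Finset (Fin n → Fin 2) := Finset.univ.filter fun x => ∃ k e, Q x k e

lemma sum_Y (hn : 2 ≤ n) (g : (Fin n → Fin 2) → ℕ) :
    ∑ x ∈ Y n, g x = ∑ w ∈ lyndonWords 2 n, ∑ k ∈ Finset.range n, g (sh w (n-k)) := by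
  rw [← Finset.sum_product']
  symm
  apply Finset.sum_bij (fun p _ => sh p.1 (n - p.2))
  · rintro ⟨w, k⟩ hp
    simp only [Finset.mem_product, lyndonWords, Finset.mem_filter, Finset.mem_univ, true_and,
      Finset.mem_range] at hp
    obtain ⟨e, he, _⟩ := lyndon_Q hn hp.1
    simp only [Y, Finset.mem_filter, Finset.mem_univ, true_and]
    exact ⟨_, _, Q_sh hp.2 he⟩
  · rintro ⟨w, k⟩ hp ⟨w', k'⟩ hp' heq
    simp only [Finset.mem_product, lyndonWords, Finset.mem_filter, Finset.mem_univ, true_and,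
      Finset.mem_range] at hp hp' heq
    obtain ⟨e, he, _⟩ := lyndon_Q hn hp.1
    obtain ⟨e', he', _⟩ := lyndon_Q hn hp'.1
    have q1 := Q_sh hp.2 he
    have q2 := Q_sh hp'.2 he'
    rw [heq] at q1
    have hk := (Q_unique q1 q2).1
    subst hk
    have := congrArg (fun z => sh z k) heq
    simp only [sh_sh' _ hp.2.le] at this
    rw [this]
  · intro x hx
    simp only [Y, Finset.mem_filter, Finset.mem_univ, true_and] at hx
    obtain ⟨k, e, h⟩ := hx
    obtain ⟨e', he'⟩ := Q_sh' h
    refine ⟨(sh x k, k), ?_, sh_sh x h.1.le⟩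
    simp only [Finset.mem_product, lyndonWords, Finset.mem_filter, Finset.mem_univ, true_and,
      Finset.mem_range]
    exact ⟨Q_lyndon he', h.1⟩
  · rintro ⟨w, k⟩ hp
    rfl

lemma card_Y (hn : 2 ≤ n) : (Y n).card = n * (lyndonWords 2 n).card := by
  rw [Finset.card_eq_sum_ones, sum_Y hn]
  simp [mul_comm]

lemma F_sh (hn : 2 ≤ n) {w : Fin n → Fin 2} (hw : w ∈ lyndonWords 2 n) {k : ℕ} (hk : k < n) :
    F (sh w (n-k)) = srfLen (List.ofFn w) := by
  simp only [lyndonWords, Finset.mem_filter, Finset.mem_univ, true_and] at hw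
  obtain ⟨e, he, hs⟩ := lyndon_Q hn hw
  rw [F_eq (Q_sh hk he), hs]
  obtain ⟨_, h2, h3, _⟩ := he
  have hke : (k+e) % n = if k + e < n then k + e else k + e - n := by
    split_ifs with hik
    · exact Nat.mod_eq_of_lt (by omega)
    · rw [Nat.mod_eq_sub_mod (by omega)]
      exact Nat.mod_eq_of_lt (by omega)
  rw [hke]
  unfold Rr
  split_ifs <;> omega

lemma sum_F (hn : 2 ≤ n) :
    ∑ x ∈ Y n, F x = n * ∑ w ∈ lyndonWords 2 n, srfLen (List.ofFn w) := by
  rw [sum_Y hn, Finset.mul_sum]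
  apply Finset.sum_congr rfl
  intro w hw
  rw [Finset.sum_congr rfl (fun k hk => F_sh hn hw (Finset.mem_range.mp hk))]
  simp

lemma card_T (hn : 2 ≤ n) (r : ℕ) :
    ((Y n).filter fun x => F x = r).card =
      n * ((lyndonWords 2 n).filter fun w => srfLen (List.ofFn w) = r).card := by
  rw [Finset.card_filter, Finset.card_filter, sum_Y hn, Finset.mul_sum]
  apply Finset.sum_congr rfl
  intro w hw
  rw [Finset.sum_congr rfl (fun k hk => by rw [F_sh hn hw (Finset.mem_range.mp hk)])]
  simp

lemma card_nonint (hn : 2 ≤ n) (p : ℕ → Prop) :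
    n * ((Y n).filter fun x => ∃ k e, Q x k e ∧ (p k ∨ p e)).card ≤
      2 * ((Finset.range n).filter p).card * (Y n).card := by
  rw [Finset.card_filter, sum_Y hn, card_Y hn]
  have key : ∀ w ∈ lyndonWords 2 n, (∑ k ∈ Finset.range n,
      if ∃ k_1 e, Q (sh w (n - k)) k_1 e ∧ (p k_1 ∨ p e) then 1 else 0) ≤
        2 * ((Finset.range n).filter p).card := by
    intro w hw
    simp only [lyndonWords, Finset.mem_filter, Finset.mem_univ, true_and] at hw
    obtain ⟨e, he, hs⟩ := lyndon_Q hn hw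
    have : (∑ k ∈ Finset.range n,
      if ∃ k_1 e, Q (sh w (n - k)) k_1 e ∧ (p k_1 ∨ p e) then 1 else 0) ≤
        ∑ k ∈ Finset.range n, ((if p k then 1 else 0) + (if p ((k+e) % n) then 1 else 0)) := by
      apply Finset.sum_le_sum
      intro k hk
      have hq := Q_sh (Finset.mem_range.mp hk) he
      by_cases hex : ∃ k_1 e, Q (sh w (n - k)) k_1 e ∧ (p k_1 ∨ p e)
      · obtain ⟨k1, e1, h1, h2⟩ := hex
        obtain ⟨rfl, rfl⟩ := Q_unique h1 hq
        rw [if_pos ⟨_, _, h1, h2⟩]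
        rcases h2 with h2 | h2
        · rw [if_pos h2]; omega
        · rw [if_pos h2]; omega
      · rw [if_neg hex]; omega
    refine this.trans ?_
    rw [Finset.sum_add_distrib, ← Finset.card_filter, ← Finset.card_filter, two_mul]
    apply Nat.add_le_add_left
    apply Finset.card_le_card_of_injOn (fun k => (k+e) % n)
    · intro k hk
      simp only [Finset.coe_filter, Finset.mem_range, Set.mem_ofPred_eq] at hk ⊢
      exact ⟨Nat.mod_lt _ (by omega), hk.2⟩
    · intro k hk k' hk' heq
      simp only [Finset.coe_filter, Finset.mem_range, Set.mem_ofPred_eq] at hk hk' heq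
      have : k ≡ k' [MOD n] := Nat.ModEq.add_right_cancel' e heq
      exact Nat.ModEq.eq_of_lt_of_lt this hk.1 hk'.1
  calc _ ≤ n * ∑ w ∈ lyndonWords 2 n, 2 * ((Finset.range n).filter p).card :=
        Nat.mul_le_mul_left _ (Finset.sum_le_sum key)
    _ = _ := by simp; ring

end

lemma lyndon_cons {u : List (Fin 2)} (h2 : 2 ≤ u.length) (hu : IsLyndon u) :
    IsLyndon (0 :: u) ∧ srfLen ((0 : Fin 2) :: u) = u.length := by
  have h0 : (0 :: u) < u := by
    match u, h2, hu with
    | a :: u', h2, hu =>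
      by_cases ha : a = 0
      · subst ha
        apply List.Lex.cons
        have := hu 1 (by omega) (by omega)
        simpa using this
      · apply List.Lex.rel
        omega
  have hL : IsLyndon ((0 : Fin 2) :: u) := by
    intro i hi hi'
    obtain ⟨j, rfl⟩ : ∃ j, i = j + 1 := ⟨i-1, by omega⟩
    rw [List.drop_succ_cons]
    simp at hi'
    rcases Nat.eq_zero_or_pos j with rfl | hj
    · simpa using h0
    · have h1 : u < u.drop j := hu j hj hi'
      exact lt_trans h0 h1
  refine ⟨hL, ?_⟩
  unfold srfLen
  have hset : {i | 0 < i ∧ i < ((0 : Fin 2) :: u).length ∧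
    ∀ j, 0 < j → j < ((0 : Fin 2) :: u).length →
      ¬ List.Lex (· < ·) (((0 : Fin 2) :: u).drop j) (((0 : Fin 2) :: u).drop i)} = {1} := by
    ext i
    simp only [List.length_cons, Set.mem_ofPred_eq, Set.mem_singleton_iff]
    constructor
    · rintro ⟨h0, hi, hall⟩
      by_contra hne
      obtain ⟨j, rfl⟩ : ∃ j, i = j + 1 := ⟨i-1, by omega⟩
      apply hall 1 (by omega) (by omega)
      simp only [List.drop_succ_cons, List.drop_zero]
      exact hu j (by omega) (by omega)
    · rintro rfl
      refine ⟨by omega, by omega, fun j h0 hj hl => ?_⟩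
      obtain ⟨j, rfl⟩ : ∃ i, j = i + 1 := ⟨j-1, by omega⟩
      simp only [List.drop_succ_cons, List.drop_zero] at hl
      rcases Nat.eq_zero_or_pos j with rfl | hj'
      · exact lt_irrefl u hl
      · have h1 : u < u.drop j := hu j hj' (by omega)
        exact lt_asymm h1 hl
  rw [hset]
  simp

lemma lyndon_uncons {a : Fin 2} {u : List (Fin 2)} (h2 : 2 ≤ u.length) (hw : IsLyndon (a :: u))
    (hs : srfLen (a :: u) = u.length) : a = 0 ∧ IsLyndon u := by
  constructor
  · have h1 : (a :: u) < (a :: u).drop u.length := hw u.length (by omega) (by simp)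
    obtain ⟨b, hb⟩ : ∃ b, (a :: u).drop u.length = [b] := by
      apply List.length_eq_one_iff.mp
      simp
    rw [hb] at h1
    rcases List.cons_lt_cons_iff.mp h1 with h | h
    · omega
    · exact absurd h.2 (List.not_lt_nil _)
  · unfold srfLen at hs
    set S := {i | 0 < i ∧ i < (a :: u).length ∧
      ∀ j, 0 < j → j < (a :: u).length →
      ¬ List.Lex (· < ·) ((a :: u).drop j) ((a :: u).drop i)} with hS
    simp only [List.length_cons] at hs
    have h1 : sInf S = 1 := by omega
    have hne : S.Nonempty := Nat.nonempty_of_pos_sInf (by omega)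
    have h3 := Nat.sInf_mem hne
    rw [h1, hS] at h3
    obtain ⟨_, _, h4⟩ := h3
    intro i hi hi'
    have h5 := h4 (i+1) (by omega) (by simp; omega)
    simp only [List.drop_succ_cons, List.drop_zero] at h5
    rcases lt_trichotomy u (u.drop i) with h | h | h
    · exact h
    · have := congrArg List.length h
      simp at this
      omega
    · exact absurd h h5

lemma card_lyndon_succ {n : ℕ} (hn : 2 ≤ n) :
    ((lyndonWords 2 (n+1)).filter fun w => srfLen (List.ofFn w) = n).card =
      (lyndonWords 2 n).card := by
  symm
  apply Finset.card_bij (fun u _ => (Fin.cons 0 u : Fin (n+1) → Fin 2))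
  · intro u hu
    simp only [lyndonWords, Finset.mem_filter, Finset.mem_univ, true_and] at hu ⊢
    have := lyndon_cons (u := List.ofFn u) (by simpa using hn) hu
    rw [List.ofFn_cons]
    simpa using this
  · intro u _ v _ h
    exact Fin.cons_right_injective (α := fun _ => Fin 2) _ h
  · intro w hw
    simp only [lyndonWords, Finset.mem_filter, Finset.mem_univ, true_and] at hw
    have hw' : List.ofFn w = w 0 :: List.ofFn (Fin.tail w) := by
      rw [List.ofFn_succ]; rfl
    rw [hw'] at hw
    obtain ⟨h1, h2⟩ := lyndon_uncons (by simpa using hn) hw.1 (by simpa using hw.2)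
    refine ⟨Fin.tail w, ?_, ?_⟩
    · simpa [lyndonWords] using h2
    · rw [← h1]; exact Fin.cons_self_tail w

def x01 (a : ℕ) : Fin 2 := Fin.ofNat 2 a

lemma x01_inj {a b : ℕ} (ha : a ≤ 1) (hb : b ≤ 1) (h : x01 a = x01 b) : a = b := by
  have := congrArg Fin.val h
  simp only [x01, Fin.val_ofNat] at this
  omega

section
variable {n : ℕ} [NeZero n]

lemma card_det (S : Finset (Fin n → Fin 2)) (s : Finset ℕ) (hs : ∀ i ∈ s, i < n)
    (h : ∀ x ∈ S, ∀ y ∈ S, (∀ i, i < n → i ∉ s → ex x i = ex y i) → x = y) :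
    S.card * 2 ^ s.card ≤ 2 ^ n := by
  set T : Finset (Fin n) := s.attachFin hs with hT
  have hTc : T.card = s.card := Finset.card_attachFin s hs
  have h1 : S.card ≤ (Finset.univ : Finset ({i : Fin n // i ∉ T} → Fin 2)).card := by
    apply Finset.card_le_card_of_injOn (fun x i => x i.1)
    · intro x _; simp
    · intro x hx y hy hxy
      apply h x hx y hy
      intro i hi his
      rw [ex_lt x hi, ex_lt y hi]
      have := congrFun hxy ⟨⟨i, hi⟩, by simp [hT, his]⟩
      exact congrArg _ this
  rw [Finset.card_univ, Fintype.card_fun, Fintype.card_fin, Fintype.card_subtype_compl,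
    Fintype.card_fin, Fintype.card_coe, hTc] at h1
  have hle : s.card ≤ n := by
    rw [← hTc]; simpa using Finset.card_le_univ T
  calc _ ≤ 2 ^ (n - s.card) * 2 ^ s.card := Nat.mul_le_mul_right _ h1
    _ = _ := by rw [← pow_add, Nat.sub_add_cancel hle]

/-- all cyclic windows of length `L` are distinct -/
def D (L : ℕ) (x : Fin n → Fin 2) : Prop :=
  ∀ i, i < n → ∀ j, j < n → i ≠ j → W (ex x) L i ≠ W (ex x) L j

lemma card_win (L p δ : ℕ) (hδ : 0 < δ) (hL : δ + L ≤ n) :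
    (Finset.univ.filter fun x : Fin n → Fin 2 =>
      ∀ t, t < L → ex x (p+t) = ex x (p+δ+t)).card * 2 ^ L ≤ 2 ^ n := by
  have hn : 0 < n := by omega
  set s := (Finset.range L).image (fun t => (p+δ+t) % n) with hs
  have hsc : s.card = L := by
    rw [hs, Finset.card_image_of_injOn, Finset.card_range]
    intro a ha b hb hab
    simp only [Finset.coe_range, Set.mem_Iio] at ha hb hab
    have : a ≡ b [MOD n] := Nat.ModEq.add_left_cancel' (p+δ) hab
    exact Nat.ModEq.eq_of_lt_of_lt this (by omega) (by omega)
  have := card_det (n := n) (Finset.univ.filter fun x : Fin n → Fin 2 =>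
      ∀ t, t < L → ex x (p+t) = ex x (p+δ+t)) s (by
        intro i hi
        rw [hs, Finset.mem_image] at hi
        obtain ⟨t, _, rfl⟩ := hi
        exact Nat.mod_lt _ hn) (by
        intro x hx y hy hxy
        simp only [Finset.mem_filter, Finset.mem_univ, true_and] at hx hy
        have key : ∀ u, u < n → ex x (p+u) = ex y (p+u) := by
          intro u
          induction u using Nat.strong_induction_on with
          | _ u ih =>
            intro hu
            by_cases hc : δ ≤ u ∧ u < δ + L
            · have h1 := hx (u-δ) (by omega)
              have h2 := hy (u-δ) (by omega)
              have h3 := ih (u-δ) (by omega) (by omega)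
              rw [show p + δ + (u-δ) = p + u by omega] at h1 h2
              rw [← h1, ← h2, h3]
            · have h1 := hxy ((p+u) % n) (Nat.mod_lt _ hn) (by
                rw [hs, Finset.mem_image]
                rintro ⟨t, ht, heq⟩
                rw [Finset.mem_range] at ht
                rw [Nat.add_assoc] at heq
                have h2 : δ + t ≡ u [MOD n] := Nat.ModEq.add_left_cancel' p heq
                have := Nat.ModEq.eq_of_lt_of_lt h2 (by omega) hu
                omega)
              rw [ex_congr x (j := p+u) (by simp), ex_congr y (j := p+u) (by simp)] at h1
              exact h1
        apply ex_ext
        intro i hi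
        have h1 := key ((i + (n - p % n)) % n) (Nat.mod_lt _ hn)
        have hmod : (p + (i + (n - p % n)) % n) % n = i % n := by
          have hp := Nat.mod_lt p hn
          rw [Nat.add_mod_mod, ← Nat.mod_add_mod,
            show p % n + (i + (n - p % n)) = i + n by omega, Nat.add_mod_right]
        rw [ex_congr x hmod, ex_congr y hmod] at h1
        exact h1)
  rw [hsc] at this
  exact this

lemma card_not_D (L : ℕ) (hL : 2 * L ≤ n) :
    (Finset.univ.filter fun x : Fin n → Fin 2 => ¬ D L x).card * 2 ^ L ≤ n * n * 2 ^ n := by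
  have hsub : (Finset.univ.filter fun x : Fin n → Fin 2 => ¬ D L x) ⊆
      ((Finset.range n) ×ˢ ((Finset.range n).filter fun δ => 0 < δ ∧ δ + L ≤ n)).biUnion
        (fun q => Finset.univ.filter fun x : Fin n → Fin 2 =>
          ∀ t, t < L → ex x (q.1+t) = ex x (q.1+q.2+t)) := by
    intro x hx
    simp only [Finset.mem_filter, Finset.mem_univ, true_and] at hx
    unfold D at hx
    push Not at hx
    obtain ⟨i, hi, j, hj, hij, heq⟩ := hx
    simp only [Finset.mem_biUnion, Finset.mem_product, Finset.mem_range, Finset.mem_filter,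
      Finset.mem_univ, true_and, Prod.exists]
    wlog hlt : i < j generalizing i j
    · exact this j hj i hi hij.symm heq.symm (by omega)
    have h0 := W_inj (ex_le x) (ex_le x) heq
    by_cases hc : (j - i) + L ≤ n
    · refine ⟨i, j - i, ⟨hi, by omega, by omega, hc⟩, fun t ht => ?_⟩
      rw [h0 t ht]; congr 1; omega
    · refine ⟨j, n - (j - i), ⟨hj, by omega, by omega, by omega⟩, fun t ht => ?_⟩
      rw [← h0 t ht]
      apply ex_congr
      rw [show j + (n - (j-i)) + t = i + t + n by omega, Nat.add_mod_right]
  have h1 := Finset.card_le_card hsub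
  calc _ ≤ (∑ q ∈ ((Finset.range n) ×ˢ ((Finset.range n).filter fun δ => 0 < δ ∧ δ + L ≤ n)),
        (Finset.univ.filter fun x : Fin n → Fin 2 =>
          ∀ t, t < L → ex x (q.1+t) = ex x (q.1+q.2+t)).card) * 2 ^ L :=
        Nat.mul_le_mul_right _ (h1.trans Finset.card_biUnion_le)
    _ ≤ ∑ q ∈ ((Finset.range n) ×ˢ ((Finset.range n).filter fun δ => 0 < δ ∧ δ + L ≤ n)),
        2 ^ n := by
        rw [Finset.sum_mul]
        apply Finset.sum_le_sum
        rintro ⟨p, δ⟩ hq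
        simp only [Finset.mem_product, Finset.mem_range, Finset.mem_filter] at hq
        exact card_win L p δ hq.2.2.1 hq.2.2.2
    _ ≤ _ := by
        rw [Finset.sum_const, smul_eq_mul, Finset.card_product, Finset.card_range]
        apply Nat.mul_le_mul_right
        apply Nat.mul_le_mul_left
        exact (Finset.card_filter_le _ _).trans (by simp)

/-- two close disjoint long runs of zeros -/
def E3 (B m : ℕ) (x : Fin n → Fin 2) : Prop :=
  ∃ i δ, m ≤ δ ∧ δ < B ∧ i + δ + m ≤ n ∧ ∀ t, t < m → ex x (i+t) = 0 ∧ ex x (i+δ+t) = 0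

lemma card_E3 (B m : ℕ) (hm : 0 < m) :
    (Finset.univ.filter fun x : Fin n → Fin 2 => E3 B m x).card * 2 ^ (2*m) ≤ n * B * 2 ^ n := by
  have hsub : (Finset.univ.filter fun x : Fin n → Fin 2 => E3 B m x) ⊆
      (((Finset.range n) ×ˢ (Finset.range B)).filter
          fun q => m ≤ q.2 ∧ q.1 + q.2 + m ≤ n).biUnion
        (fun q => Finset.univ.filter fun x : Fin n → Fin 2 =>
          ∀ t, t < m → ex x (q.1+t) = 0 ∧ ex x (q.1+q.2+t) = 0) := by
    intro x hx
    simp only [Finset.mem_filter, Finset.mem_univ, true_and] at hx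
    obtain ⟨i, δ, h1, h2, h3, h4⟩ := hx
    simp only [Finset.mem_biUnion, Finset.mem_product, Finset.mem_range, Finset.mem_filter,
      Finset.mem_univ, true_and, Prod.exists]
    exact ⟨i, δ, ⟨⟨by omega, h2⟩, h1, h3⟩, h4⟩
  have h1 := Finset.card_le_card hsub
  calc _ ≤ (∑ q ∈ (((Finset.range n) ×ˢ (Finset.range B)).filter
          fun q => m ≤ q.2 ∧ q.1 + q.2 + m ≤ n),
        (Finset.univ.filter fun x : Fin n → Fin 2 =>
          ∀ t, t < m → ex x (q.1+t) = 0 ∧ ex x (q.1+q.2+t) = 0).card) * 2 ^ (2*m) :=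
        Nat.mul_le_mul_right _ (h1.trans Finset.card_biUnion_le)
    _ ≤ ∑ q ∈ (((Finset.range n) ×ˢ (Finset.range B)).filter
          fun q => m ≤ q.2 ∧ q.1 + q.2 + m ≤ n), 2 ^ n := by
        rw [Finset.sum_mul]
        apply Finset.sum_le_sum
        rintro ⟨i, δ⟩ hq
        simp only [Finset.mem_product, Finset.mem_range, Finset.mem_filter] at hq
        have hdisj : Disjoint (Finset.Ico i (i+m)) (Finset.Ico (i+δ) (i+δ+m)) := by
          rw [Finset.disjoint_left]
          intro a ha hb
          simp only [Finset.mem_Ico] at ha hb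
          omega
        have hc : (Finset.Ico i (i+m) ∪ Finset.Ico (i+δ) (i+δ+m)).card = 2*m := by
          rw [Finset.card_union_of_disjoint hdisj]
          simp; omega
        have := card_det (n := n) (Finset.univ.filter fun x : Fin n → Fin 2 =>
          ∀ t, t < m → ex x (i+t) = 0 ∧ ex x (i+δ+t) = 0)
          (Finset.Ico i (i+m) ∪ Finset.Ico (i+δ) (i+δ+m)) (by
            intro a ha
            simp only [Finset.mem_union, Finset.mem_Ico] at ha
            omega) (by
            intro x hx y hy hxy
            simp only [Finset.mem_filter, Finset.mem_univ, true_and] at hx hy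
            apply ex_ext
            intro a ha
            by_cases h1 : a ∈ (Finset.Ico i (i+m) ∪ Finset.Ico (i+δ) (i+δ+m))
            · simp only [Finset.mem_union, Finset.mem_Ico] at h1
              rcases h1 with h1 | h1
              · have e1 := (hx (a-i) (by omega)).1
                have e2 := (hy (a-i) (by omega)).1
                rw [show i + (a-i) = a by omega] at e1 e2
                rw [e1, e2]
              · have e1 := (hx (a-(i+δ)) (by omega)).2
                have e2 := (hy (a-(i+δ)) (by omega)).2
                rw [show i + δ + (a-(i+δ)) = a by omega] at e1 e2
                rw [e1, e2]
            · exact hxy a ha h1)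
        rw [hc] at this
        exact this
    _ ≤ _ := by
        rw [Finset.sum_const, smul_eq_mul]
        apply Nat.mul_le_mul_right
        exact (Finset.card_filter_le _ _).trans (by simp)

/-- no block of zeros among `q` disjoint blocks of length `m` -/
def E2 (q m : ℕ) (x : Fin n → Fin 2) : Prop :=
  ∀ b, b < q → ∃ t, t < m ∧ ex x (b*m+t) ≠ 0

lemma card_E2 (q m : ℕ) (hq : q * m ≤ n) :
    (Finset.univ.filter fun x : Fin n → Fin 2 => E2 q m x).card * q ≤ 2 ^ m * 2 ^ n := by
  have hblk : ∀ b t, b < q → t < m → b*m+t < n := by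
    intro b t hb ht
    have : (b+1)*m ≤ q*m := Nat.mul_le_mul_right _ hb
    rw [Nat.add_mul] at this
    omega
  set Z : (Fin n → Fin 2) → ℕ → (Fin n → Fin 2) :=
    fun x b i => if b*m ≤ i.val ∧ i.val < b*m+m then 0 else x i with hZ
  have hZin : ∀ x b t, b < q → t < m → ex (Z x b) (b*m+t) = 0 := by
    intro x b t hb ht
    rw [ex_lt _ (hblk b t hb ht)]
    simp [hZ, ht]
  have hZout : ∀ x b i, i < n → ¬ (b*m ≤ i ∧ i < b*m+m) → ex (Z x b) i = ex x i := by
    intro x b i hi h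
    rw [ex_lt _ hi, ex_lt _ hi]
    simp only [hZ]
    rw [if_neg h]
  have hbl : ∀ b b' t : ℕ, t < m → b ≠ b' → ¬ (b*m ≤ b'*m+t ∧ b'*m+t < b*m+m) := by
    intro b b' t ht hne
    rcases Nat.lt_or_gt_of_ne hne with h | h
    · have : (b+1)*m ≤ b'*m := Nat.mul_le_mul_right _ h
      rw [Nat.add_mul] at this
      omega
    · have : (b'+1)*m ≤ b*m := Nat.mul_le_mul_right _ h
      rw [Nat.add_mul] at this
      omega
  have h1 : ((Finset.univ.filter fun x : Fin n → Fin 2 => E2 q m x) ×ˢ (Finset.range q)).card ≤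
      (Finset.univ : Finset ((Fin m → Fin 2) × (Fin n → Fin 2))).card := by
    apply Finset.card_le_card_of_injOn
      (fun p => (fun t => x01 (ex p.1 (p.2*m+t.val)), Z p.1 p.2))
    · intro x _; simp
    · rintro ⟨x, b⟩ hx ⟨y, b'⟩ hy hxy
      simp only [Finset.coe_product, Finset.coe_filter, Finset.mem_univ, true_and,
        Finset.coe_range, Set.mem_prod, Set.mem_ofPred_eq, Set.mem_Iio, Prod.mk.injEq] at hx hy hxy
      obtain ⟨e1, e2⟩ := hxy
      have hbb : b = b' := by
        by_contra hne
        obtain ⟨t, ht, h⟩ := hx.1 b' hy.2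
        apply h
        rw [← hZout x b _ (hblk b' t hy.2 ht) (hbl b b' t ht hne), e2]
        exact hZin y b' t hy.2 ht
      subst hbb
      have : x = y := by
        apply ex_ext
        intro i hi
        by_cases hc : b*m ≤ i ∧ i < b*m+m
        · have := congrFun e1 ⟨i-b*m, by omega⟩
          simp only [show b*m + (i-b*m) = i by omega] at this
          exact x01_inj (ex_le x i) (ex_le y i) this
        · rw [← hZout x b i hi hc, e2, hZout y b i hi hc]
      rw [this]
  rw [Finset.card_product, Finset.card_range] at h1
  simpa using h1

end

/-- block reversal of positions -/
def sg (K B i : ℕ) : ℕ := if i < K*B then (K-1-i/B)*B + i%B else i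

/-- positions whose `L`-window lies inside a block -/
def Ins (K B L i : ℕ) : Prop := i < K*B ∧ i%B + L ≤ B

lemma sg_block {K B b r : ℕ} (hb : b < K) (hr : r < B) : sg K B (b*B+r) = (K-1-b)*B + r := by
  have h1 : b*B + r < K*B := by
    have : (b+1)*B ≤ K*B := Nat.mul_le_mul_right _ hb
    rw [Nat.add_mul] at this
    omega
  have h2 : (b*B+r)/B = b := by
    rw [Nat.add_comm, Nat.add_mul_div_right _ _ (by omega), Nat.div_eq_of_lt hr]; omega
  have h3 : (b*B+r)%B = r := by
    rw [Nat.add_comm, Nat.add_mul_mod_self_right, Nat.mod_eq_of_lt hr]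
  unfold sg
  rw [if_pos h1, h2, h3]

lemma block_repr {K B i : ℕ} (h : i < K*B) : ∃ b r, b < K ∧ r < B ∧ i = b*B + r := by
  have hB : 0 < B := by
    rcases Nat.eq_zero_or_pos B with h0 | h0
    · subst h0; simp at h
    · exact h0
  exact ⟨i/B, i%B, (Nat.div_lt_iff_lt_mul hB).mpr h, Nat.mod_lt _ hB,
    by rw [Nat.mul_comm]; exact (Nat.div_add_mod i B).symm⟩

lemma block_lt {K B b r : ℕ} (hb : b < K) (hr : r < B) : b*B+r < K*B := by
  have : (b+1)*B ≤ K*B := Nat.mul_le_mul_right _ hb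
  rw [Nat.add_mul] at this
  omega

lemma sg_lt {K B n i : ℕ} (hK : K*B ≤ n) (hi : i < n) : sg K B i < n := by
  by_cases h : i < K*B
  · obtain ⟨b, r, hb, hr, rfl⟩ := block_repr h
    rw [sg_block hb hr]
    have := block_lt (K := K) (B := B) (b := K-1-b) (by omega) hr
    omega
  · unfold sg; rw [if_neg h]; exact hi

lemma sg_sg (K B i : ℕ) : sg K B (sg K B i) = i := by
  by_cases h : i < K*B
  · obtain ⟨b, r, hb, hr, rfl⟩ := block_repr h
    rw [sg_block hb hr, sg_block (by omega) hr, show K-1-(K-1-b) = b by omega]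
  · unfold sg; rw [if_neg h, if_neg h]

lemma Ins_repr {K B L i : ℕ} (h : Ins K B L i) :
    ∃ b r, b < K ∧ r < B ∧ r + L ≤ B ∧ i = b*B + r := by
  have hB : 0 < B := by
    rcases Nat.eq_zero_or_pos B with h0 | h0
    · subst h0; have := h.1; simp at this
    · exact h0
  exact ⟨i/B, i%B, (Nat.div_lt_iff_lt_mul hB).mpr h.1, Nat.mod_lt _ hB, h.2,
    by rw [Nat.mul_comm]; exact (Nat.div_add_mod i B).symm⟩

lemma Ins_block {K B L b r : ℕ} (hb : b < K) (hr : r < B) (hL : r + L ≤ B) :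
    Ins K B L (b*B+r) := by
  refine ⟨block_lt hb hr, ?_⟩
  rw [Nat.add_comm (b*B), Nat.add_mul_mod_self_right, Nat.mod_eq_of_lt hr]
  exact hL

lemma Ins_sg {K B L i : ℕ} (h : Ins K B L i) : Ins K B L (sg K B i) := by
  obtain ⟨b, r, hb, hr, hL, rfl⟩ := Ins_repr h
  rw [sg_block hb hr]
  exact Ins_block (by omega) hr hL

lemma sg_add {K B L i t : ℕ} (h : Ins K B L i) (ht : t < L) : sg K B (i+t) = sg K B i + t := by
  obtain ⟨b, r, hb, hr, hL, rfl⟩ := Ins_repr h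
  rw [sg_block hb hr, Nat.add_assoc, sg_block hb (by omega), Nat.add_assoc]

lemma card_notInt (n B L : ℕ) (hB : 0 < B) :
    ((Finset.range n).filter fun i => ¬ Ins (n/B) B L i).card ≤ (n/B)*L + B := by
  have hsub : ((Finset.range n).filter fun i => ¬ Ins (n/B) B L i) ⊆
      ((Finset.range (n/B) ×ˢ Finset.range L).image fun p => p.1*B + (B-1-p.2)) ∪
        Finset.Ico ((n/B)*B) n := by
    intro i hi
    simp only [Finset.mem_filter, Finset.mem_range] at hi
    rw [Finset.mem_union]
    by_cases h : i < (n/B)*B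
    · left
      obtain ⟨b, r, hb, hr, rfl⟩ := block_repr h
      have : ¬ (r + L ≤ B) := fun h' => hi.2 (Ins_block hb hr h')
      rw [Finset.mem_image]
      refine ⟨(b, B-1-r), ?_, ?_⟩
      · simp only [Finset.mem_product, Finset.mem_range]
        omega
      · simp only []
        omega
    · right
      simp only [Finset.mem_Ico]
      omega
  have h1 := (Finset.card_le_card hsub).trans (Finset.card_union_le _ _)
  have h2 := Finset.card_image_le (s := Finset.range (n/B) ×ˢ Finset.range L)
    (f := fun p => p.1*B + (B-1-p.2))
  rw [Finset.card_product, Finset.card_range, Finset.card_range] at h2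
  rw [Nat.card_Ico] at h1
  have h3 := Nat.div_add_mod n B
  have h4 := Nat.mod_lt n hB
  rw [Nat.mul_comm] at h3
  omega

lemma Rr_sum {K B L n k e : ℕ} (hK : K*B ≤ n) (hk : Ins K B L k) (he : Ins K B L e)
    (hne : k/B ≠ e/B) :
    Rr n k e + Rr n (sg K B k) (sg K B e) ≤ n + 2*B ∧
    n ≤ Rr n k e + Rr n (sg K B k) (sg K B e) + 2*B ∧
    sg K B k / B ≠ sg K B e / B := by
  obtain ⟨b, r, hb, hr, hL, rfl⟩ := Ins_repr hk
  obtain ⟨b', r', hb', hr', hL', rfl⟩ := Ins_repr he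
  have hd : ∀ b r, r < B → (b*B+r)/B = b := by
    intro b r hr
    rw [Nat.add_comm, Nat.add_mul_div_right _ _ (by omega), Nat.div_eq_of_lt hr]; omega
  rw [hd b r hr, hd b' r' hr'] at hne
  rw [sg_block hb hr, sg_block hb' hr', hd _ r hr, hd _ r' hr']
  have s1 : (K-1-b)*B + b*B + B = K*B := by
    rw [← Nat.add_mul, ← Nat.succ_mul]; congr 1; omega
  have s2 : (K-1-b')*B + b'*B + B = K*B := by
    rw [← Nat.add_mul, ← Nat.succ_mul]; congr 1; omega
  have hlt : (b < b' ∧ b*B + B ≤ b'*B) ∨ (b' < b ∧ b'*B + B ≤ b*B) := by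
    rcases Nat.lt_or_gt_of_ne hne with h | h
    · left
      have : (b+1)*B ≤ b'*B := Nat.mul_le_mul_right _ h
      rw [Nat.add_mul] at this
      omega
    · right
      have : (b'+1)*B ≤ b*B := Nat.mul_le_mul_right _ h
      rw [Nat.add_mul] at this
      omega
  generalize (K-1-b)*B = u at *
  generalize (K-1-b')*B = u' at *
  generalize b*B = v at *
  generalize b'*B = v' at *
  generalize K*B = z at *
  unfold Rr
  refine ⟨?_, ?_, by omega⟩
  · split_ifs <;> omega
  · split_ifs <;> omega

section
variable {n : ℕ} [NeZero n]

lemma D_Q {L : ℕ} {x : Fin n → Fin 2} (hn : 2 ≤ n) (hL : L ≤ n) (h : D L x) :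
    ∃ k e, Q x k e := by
  have hs : ∀ i, i < n → ∀ j, j < n → i ≠ j → W (ex x) n i ≠ W (ex x) n j := by
    intro i hi j hj hij heq
    apply h i hi j hj hij
    exact le_antisymm (W_le_prefix (ex_le x) hL heq.le) (W_le_prefix (ex_le x) hL heq.ge)
  obtain ⟨k, hk, hmin⟩ := Finset.exists_min_image (Finset.range n) (fun i => W (ex x) n i)
    ⟨0, by simp; omega⟩
  obtain ⟨e, he, hmin'⟩ := Finset.exists_min_image ((Finset.range n).erase k)
    (fun i => W (ex x) n i) (by
      by_cases h0 : k = 0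
      · exact ⟨1, by simp; omega⟩
      · exact ⟨0, by simp; omega⟩)
  simp only [Finset.mem_range, Finset.mem_erase] at hk hmin he hmin'
  refine ⟨k, e, hk, he.2, he.1.symm, ?_, ?_⟩
  · intro i hi hne
    exact lt_of_le_of_ne (hmin i hi) (hs k hk i hi hne.symm)
  · intro i hi hne hne'
    exact lt_of_le_of_ne (hmin' i ⟨hne, hi⟩) (hs e he.2 i hi hne'.symm)

lemma QL1 {L : ℕ} {x : Fin n → Fin 2} (hL : L ≤ n) (h : D L x) {k e : ℕ} (hq : Q x k e)
    {i : ℕ} (hi : i < n) (hne : i ≠ k) : W (ex x) L k < W (ex x) L i :=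
  lt_of_le_of_ne (W_le_prefix (ex_le x) hL (hq.2.2.2.1 i hi hne).le) (h k hq.1 i hi hne.symm)

lemma QL2 {L : ℕ} {x : Fin n → Fin 2} (hL : L ≤ n) (h : D L x) {k e : ℕ} (hq : Q x k e)
    {i : ℕ} (hi : i < n) (hne : i ≠ k) (hne' : i ≠ e) : W (ex x) L e < W (ex x) L i :=
  lt_of_le_of_ne (W_le_prefix (ex_le x) hL (hq.2.2.2.2 i hi hne hne').le)
    (h e hq.2.1 i hi hne'.symm)

/-- block reversal of words -/
def ph (K B : ℕ) (x : Fin n → Fin 2) : Fin n → Fin 2 := fun i => x (Fin.ofNat n (sg K B i))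

lemma ex_ph {K B : ℕ} (x : Fin n → Fin 2) {i : ℕ} (hi : i < n) :
    ex (ph K B x) i = ex x (sg K B i) := by
  rw [ex_lt _ hi]; rfl

lemma ph_ph {K B : ℕ} (hK : K*B ≤ n) (x : Fin n → Fin 2) : ph K B (ph K B x) = x := by
  apply ex_ext
  intro i hi
  rw [ex_ph _ hi, ex_ph _ (sg_lt hK hi), sg_sg]

lemma Ins_lt {K B L i : ℕ} (h : Ins K B L i) (hK : K*B ≤ n) : i + L ≤ n := by
  obtain ⟨b, r, hb, hr, hL, rfl⟩ := Ins_repr h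
  have : (b+1)*B ≤ K*B := Nat.mul_le_mul_right _ hb
  rw [Nat.add_mul] at this
  omega

lemma W_ph {K B L : ℕ} (hK : K*B ≤ n) (x : Fin n → Fin 2) {i : ℕ} (h : Ins K B L i) :
    W (ex (ph K B x)) L i = W (ex x) L (sg K B i) := by
  apply W_congr
  intro t ht
  have := Ins_lt h hK
  rw [ex_ph _ (by omega), sg_add h ht]

lemma Q_ph {K B L : ℕ} (hK : K*B ≤ n) (hL : L ≤ n) {x : Fin n → Fin 2} {k e k' e' : ℕ}
    (hD : D L x) (hq : Q x k e) (hk : Ins K B L k) (he : Ins K B L e)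
    (hD' : D L (ph K B x)) (hq' : Q (ph K B x) k' e') (hk' : Ins K B L k')
    (he' : Ins K B L e') : k' = sg K B k ∧ e' = sg K B e := by
  have w1 : ∀ i, Ins K B L i → W (ex (ph K B x)) L (sg K B i) = W (ex x) L i := by
    intro i hi
    rw [W_ph hK x (Ins_sg hi), sg_sg]
  have hkk : k' = sg K B k := by
    by_contra hne
    have h1 := QL1 hL hD' hq' (sg_lt hK hq.1) (Ne.symm hne)
    rw [w1 k hk, W_ph hK x hk'] at h1
    have h2 := QL1 hL hD hq (i := sg K B k') (sg_lt hK hq'.1) (by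
      rintro rfl
      exact hne (sg_sg K B k').symm)
    omega
  subst hkk
  refine ⟨rfl, ?_⟩
  by_contra hne
  have hke := hq.2.2.1
  have hke' := hq'.2.2.1
  have h1 := QL2 hL hD' hq' (i := sg K B e) (sg_lt hK hq.2.1) (by
      intro h
      have := congrArg (sg K B) h
      rw [sg_sg, sg_sg] at this
      exact hke this.symm) (Ne.symm hne)
  rw [w1 e he, W_ph hK x he'] at h1
  have h2 := QL2 hL hD hq (i := sg K B e') (sg_lt hK hq'.2.1) (by
      rintro rfl
      exact hke' (sg_sg K B e')) (by
      rintro rfl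
      exact hne (sg_sg K B e').symm)
  omega

lemma same_block {K B L q m : ℕ} (hK : K*B ≤ n) (hL : L ≤ n) (hmL : m + 1 ≤ L)
    (hq : q*(m+1) ≤ n) {x : Fin n → Fin 2} {k e : ℕ} (hm : 0 < m)
    (hD : D L x) (hQ : Q x k e) (hk : Ins K B L k) (he : Ins K B L e)
    (h2 : ¬ E2 q (m+1) x) (h3 : ¬ E3 B m x) (hb : k/B = e/B) : e = k+1 := by
  by_contra hne
  have hkn := Ins_lt hk hK
  have hen := Ins_lt he hK
  -- run at k
  have hk0 : W (ex x) (m+1) k = 0 := by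
    unfold E2 at h2
    push Not at h2
    obtain ⟨b, hb, h⟩ := h2
    have hbn := block_lt (K := q) (B := m+1) (r := 0) hb (by omega)
    have h0 : W (ex x) (m+1) (b*(m+1)) = 0 := W_zero_iff.mpr h
    by_cases hbk : b*(m+1) = k
    · rw [← hbk]; exact h0
    · have := W_le_prefix (ex_le x) hmL (QL1 hL hD hQ (by omega) hbk).le
      omega
  have hk0' := W_zero_iff.mp hk0
  have he0 : W (ex x) m e = 0 := by
    have h0 : W (ex x) m (k+1) = 0 := by
      apply W_zero_iff.mpr
      intro t ht
      rw [Nat.add_assoc]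
      exact hk0' (1+t) (by omega)
    have := W_le_prefix (ex_le x) (m := m) (by omega)
      (QL2 hL hD hQ (i := k+1) (by omega) (by omega) (Ne.symm hne)).le
    omega
  have he0' := W_zero_iff.mp he0
  have hprevk : 0 < k → ex x (k-1) ≠ 0 := by
    intro h0 h
    have h1 := W_prev L _ h
    have h4 := QL1 hL hD hQ (i := k-1) (by omega) (by omega)
    rw [Nat.sub_add_cancel h0] at h1
    omega
  have hpreve : 0 < e → ex x (e-1) ≠ 0 := by
    intro h0 h
    have h1 := W_prev L _ h
    have h4 := QL2 hL hD hQ (i := e-1) (by omega) (by omega) (by omega)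
    rw [Nat.sub_add_cancel h0] at h1
    omega
  have hBe : k + 0 < e + B ∧ e < k + B := by
    obtain ⟨b, r, hb1, hr, hL, rfl⟩ := Ins_repr hk
    obtain ⟨b', r', hb', hr', hL', rfl⟩ := Ins_repr he
    have hd : ∀ b r, r < B → (b*B+r)/B = b := by
      intro b r hr
      rw [Nat.add_comm, Nat.add_mul_div_right _ _ (by omega), Nat.div_eq_of_lt hr]; omega
    rw [hd b r hr, hd b' r' hr'] at hb
    subst hb
    omega
  apply h3
  rcases Nat.lt_or_gt_of_ne hQ.2.2.1 with hlt | hlt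
  · have hge : k + m ≤ e := by
      by_contra hc
      apply hpreve (by omega)
      have := hk0' (e-1-k) (by omega)
      rwa [show k + (e-1-k) = e-1 by omega] at this
    refine ⟨k, e-k, by omega, by omega, by omega, fun t ht => ⟨hk0' t (by omega), ?_⟩⟩
    rw [show k + (e-k) + t = e + t by omega]
    exact he0' t ht
  · have hge : e + m ≤ k := by
      by_contra hc
      apply hprevk (by omega)
      have := he0' (k-1-e) (by omega)
      rwa [show e + (k-1-e) = k-1 by omega] at this
    refine ⟨e, k-e, by omega, by omega, by omega, fun t ht => ⟨he0' t (by omega), ?_⟩⟩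
    rw [show e + (k-e) + t = k + t by omega]
    exact hk0' t (by omega)

end

section
variable {n : ℕ} [NeZero n]

def Gd (K B L q m : ℕ) (x : Fin n → Fin 2) : Prop :=
  D L x ∧ ¬ E2 q (m+1) x ∧ ¬ E3 B m x ∧ ∃ k e, Q x k e ∧ Ins K B L k ∧ Ins K B L e

lemma Gd_F {K B L q m : ℕ} (hK : K*B ≤ n) (hL : L ≤ n) (hmL : m + 1 ≤ L)
    (hq : q*(m+1) ≤ n) (hm : 0 < m) {x : Fin n → Fin 2} (h : Gd K B L q m x)
    (h' : Gd K B L q m (ph K B x)) (hF : F x ≠ n-1) :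
    F x + F (ph K B x) ≤ n + 2*B ∧ n ≤ F x + F (ph K B x) + 2*B ∧ F (ph K B x) ≠ n-1 := by
  obtain ⟨hD, h2, h3, k, e, hQ, hk, he⟩ := h
  obtain ⟨hD', _, _, k', e', hQ', hk', he'⟩ := h'
  obtain ⟨rfl, rfl⟩ := Q_ph hK hL hD hQ hk he hD' hQ' hk' he'
  rw [F_eq hQ] at hF ⊢
  rw [F_eq hQ']
  have hne : k/B ≠ e/B := by
    intro hb
    have := same_block hK hL hmL hq hm hD hQ hk he h2 h3 hb
    apply hF
    unfold Rr
    rw [if_pos (by omega)]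
    omega
  obtain ⟨r1, r2, r3⟩ := Rr_sum hK hk he hne
  refine ⟨r1, r2, ?_⟩
  intro hR
  apply r3
  have hlt := Ins_lt hk' hK
  have hee := hQ'.2.1
  generalize sg K B k = a at *
  generalize sg K B e = b at *
  have hab : b = a + 1 := by
    unfold Rr at hR
    split_ifs at hR <;> omega
  subst hab
  obtain ⟨c, r, hc, hr, hL, rfl⟩ := Ins_repr hk'
  have hd : ∀ b r, r < B → (b*B+r)/B = b := by
    intro b r hr
    rw [Nat.add_comm, Nat.add_mul_div_right _ _ (by omega), Nat.div_eq_of_lt hr]; omega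
  rw [Nat.add_assoc, hd _ _ hr, hd _ _ (by omega)]

lemma nat_core {K B L q m : ℕ} (hK : K*B ≤ n) (hL : L ≤ n) (hmL : m + 1 ≤ L)
    (hq : q*(m+1) ≤ n) (hm : 0 < m) :
    ∃ H SH : ℕ,
      2^n ≤ (Y n).card + (Finset.univ.filter fun x : Fin n → Fin 2 => ¬ Gd K B L q m x).card ∧
      (Y n).card ≤ ((Y n).filter fun x => F x = n-1).card + H +
        2 * (Finset.univ.filter fun x : Fin n → Fin 2 => ¬ Gd K B L q m x).card ∧
      ((Y n).filter fun x => F x = n-1).card + H ≤ (Y n).card ∧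
      2 * SH ≤ (n+2*B) * H ∧ n * H ≤ 2 * SH + 2*B*H ∧
      (n-1) * ((Y n).filter fun x => F x = n-1).card + SH ≤ ∑ x ∈ Y n, F x ∧
      ∑ x ∈ Y n, F x ≤ (n-1) * ((Y n).filter fun x => F x = n-1).card + SH +
        n * (2 * (Finset.univ.filter fun x : Fin n → Fin 2 => ¬ Gd K B L q m x).card) := by
  set bad := Finset.univ.filter fun x : Fin n → Fin 2 => ¬ Gd K B L q m x with hbad
  set T := (Y n).filter fun x => F x = n-1 with hT
  set H := Finset.univ.filter fun x : Fin n → Fin 2 =>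
    Gd K B L q m x ∧ Gd K B L q m (ph K B x) ∧ F x ≠ n-1 with hH
  have hHmem : ∀ x, x ∈ H ↔ Gd K B L q m x ∧ Gd K B L q m (ph K B x) ∧ F x ≠ n-1 := by
    intro x; rw [hH]; simp
  have hGY : ∀ x : Fin n → Fin 2, Gd K B L q m x → x ∈ Y n := by
    intro x hx
    obtain ⟨_, _, _, k, e, h, _⟩ := hx
    simp only [Y, Finset.mem_filter, Finset.mem_univ, true_and]
    exact ⟨k, e, h⟩
  have hTY : T ⊆ Y n := Finset.filter_subset _ _
  have hHY : H ⊆ Y n := fun x hx => hGY x ((hHmem x).mp hx).1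
  have hdisj : Disjoint T H := by
    rw [Finset.disjoint_left]
    intro x h1 h2
    rw [hT, Finset.mem_filter] at h1
    exact ((hHmem x).mp h2).2.2 h1.2
  have hTH : T ∪ H ⊆ Y n := Finset.union_subset hTY hHY
  set bad' := bad.image (ph K B) with hbad'
  have hb' : bad'.card ≤ bad.card := Finset.card_image_le
  set R := Y n \ (T ∪ H) with hR
  have hRsub : R ⊆ bad ∪ bad' := by
    intro x hx
    rw [hR, Finset.mem_sdiff, Finset.mem_union, not_or] at hx
    obtain ⟨h1, h2, h3⟩ := hx
    have h2' : F x ≠ n-1 := fun h => h2 (by rw [hT, Finset.mem_filter]; exact ⟨h1, h⟩)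
    rw [hHmem] at h3
    rw [Finset.mem_union]
    by_cases g1 : Gd K B L q m x
    · right
      rw [hbad', Finset.mem_image]
      refine ⟨ph K B x, ?_, ph_ph hK x⟩
      rw [hbad, Finset.mem_filter]
      exact ⟨Finset.mem_univ _, fun g2 => h3 ⟨g1, g2, h2'⟩⟩
    · left
      rw [hbad, Finset.mem_filter]
      exact ⟨Finset.mem_univ _, g1⟩
  have hRc : R.card ≤ 2 * bad.card := by
    have := (Finset.card_le_card hRsub).trans (Finset.card_union_le _ _)
    omega
  have hcard : R.card + (T.card + H.card) = (Y n).card := by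
    rw [← Finset.card_union_of_disjoint hdisj, hR]
    exact Finset.card_sdiff_add_card_eq_card hTH
  have hsumT : ∑ x ∈ T, F x = (n-1) * T.card := by
    rw [Finset.sum_congr rfl (g := fun _ => n-1) (fun x hx => by
      rw [hT, Finset.mem_filter] at hx; exact hx.2)]
    simp [mul_comm]
  have hsum : ∑ x ∈ R, F x + ((n-1) * T.card + ∑ x ∈ H, F x) = ∑ x ∈ Y n, F x := by
    rw [← hsumT, ← Finset.sum_union hdisj, hR]
    exact Finset.sum_sdiff hTH
  have hsumR : ∑ x ∈ R, F x ≤ n * (2 * bad.card) := by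
    calc _ ≤ ∑ x ∈ R, n := Finset.sum_le_sum (fun x _ => F_le x)
      _ = n * R.card := by simp [mul_comm]
      _ ≤ _ := Nat.mul_le_mul_left _ hRc
  have hinv : ∑ x ∈ H, F x = ∑ x ∈ H, F (ph K B x) := by
    have hmap : ∀ x ∈ H, ph K B x ∈ H := by
      intro x hx
      rw [hHmem] at hx ⊢
      rw [ph_ph hK]
      exact ⟨hx.2.1, hx.1, (Gd_F hK hL hmL hq hm hx.1 hx.2.1 hx.2.2).2.2⟩
    exact Finset.sum_nbij' (ph K B) (ph K B) hmap hmap (fun x _ => ph_ph hK x)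
      (fun x _ => ph_ph hK x) (fun x _ => by rw [ph_ph hK])
  have h2sum : 2 * ∑ x ∈ H, F x = ∑ x ∈ H, (F x + F (ph K B x)) := by
    rw [Finset.sum_add_distrib, ← hinv]; ring
  refine ⟨H.card, ∑ x ∈ H, F x, ?_, by omega, by omega, ?_, ?_, by omega, by omega⟩
  · have h1 : (Finset.univ : Finset (Fin n → Fin 2)) ⊆ Y n ∪ bad := by
      intro x _
      rw [Finset.mem_union]
      by_cases g1 : Gd K B L q m x
      · left; exact hGY x g1
      · right
        rw [hbad, Finset.mem_filter]
        exact ⟨Finset.mem_univ _, g1⟩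
    have := (Finset.card_le_card h1).trans (Finset.card_union_le _ _)
    simpa using this
  · rw [h2sum]
    calc _ ≤ ∑ x ∈ H, (n + 2*B) := Finset.sum_le_sum (fun x hx => by
          rw [hHmem] at hx
          exact (Gd_F hK hL hmL hq hm hx.1 hx.2.1 hx.2.2).1)
      _ = _ := by simp [mul_comm]
  · rw [h2sum]
    calc n * H.card = ∑ x ∈ H, n := by simp [mul_comm]
      _ ≤ ∑ x ∈ H, ((F x + F (ph K B x)) + 2*B) := Finset.sum_le_sum (fun x hx => by
          rw [hHmem] at hx
          exact (Gd_F hK hL hmL hq hm hx.1 hx.2.1 hx.2.2).2.1)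
      _ = _ := by rw [Finset.sum_add_distrib]; simp [mul_comm]

lemma bad_le {K B L q m : ℕ} (hn : 2 ≤ n) (hL : L ≤ n) :
    (Finset.univ.filter fun x : Fin n → Fin 2 => ¬ Gd K B L q m x).card ≤
      (Finset.univ.filter fun x : Fin n → Fin 2 => ¬ D L x).card +
      (Finset.univ.filter fun x : Fin n → Fin 2 => E2 q (m+1) x).card +
      (Finset.univ.filter fun x : Fin n → Fin 2 => E3 B m x).card +
      ((Y n).filter fun x => ∃ k e, Q x k e ∧ (¬ Ins K B L k ∨ ¬ Ins K B L e)).card := by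
  have hsub : (Finset.univ.filter fun x : Fin n → Fin 2 => ¬ Gd K B L q m x) ⊆
      (((Finset.univ.filter fun x : Fin n → Fin 2 => ¬ D L x) ∪
      (Finset.univ.filter fun x : Fin n → Fin 2 => E2 q (m+1) x)) ∪
      (Finset.univ.filter fun x : Fin n → Fin 2 => E3 B m x)) ∪
      ((Y n).filter fun x => ∃ k e, Q x k e ∧ (¬ Ins K B L k ∨ ¬ Ins K B L e)) := by
    intro x hx
    simp only [Y, Finset.mem_union, Finset.mem_filter, Finset.mem_univ, true_and] at hx ⊢
    by_contra hc
    simp only [not_or, not_not] at hc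
    obtain ⟨⟨⟨c1, c2⟩, c3⟩, c4⟩ := hc
    obtain ⟨k, e, hQ⟩ := D_Q hn hL c1
    apply hx
    refine ⟨c1, c2, c3, k, e, hQ, ?_⟩
    by_contra hI
    rw [not_and_or] at hI
    exact c4 ⟨⟨k, e, hQ⟩, k, e, hQ, hI⟩
  refine (Finset.card_le_card hsub).trans ((Finset.card_union_le _ _).trans ?_)
  apply Nat.add_le_add_right
  refine (Finset.card_union_le _ _).trans ?_
  apply Nat.add_le_add_right
  exact Finset.card_union_le _ _

lemma real_core {N y bad t H SH S n B : ℝ} (hn : 1 ≤ n) (hN : 0 < N)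
    (h1 : N ≤ y + bad) (h1' : y ≤ N) (h2 : y ≤ t + H + 2*bad) (h3 : t + H ≤ y)
    (h4 : 2*SH ≤ (n+2*B)*H) (h5 : n*H ≤ 2*SH+2*B*H) (h6 : (n-1)*t+SH ≤ S)
    (h7 : S ≤ (n-1)*t + SH + n*(2*bad)) (ht : 0 ≤ t) (hH : 0 ≤ H)
    {ε : ℝ} (hb : bad ≤ ε * N) (hBn : B ≤ ε * n) (hn1 : 1 ≤ ε * n) :
    |y/N - 1| ≤ ε ∧ |S/(n*N) - (t/N/2 + 1/2)| ≤ 6*ε := by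
  have hn0 : 0 < n := by linarith
  have hnN : 0 < n * N := by positivity
  constructor
  · rw [abs_le]
    constructor
    · rw [le_sub_iff_add_le, le_div_iff₀ hN]; linarith
    · rw [sub_le_iff_le_add, div_le_iff₀ hN]; nlinarith
  · have hε : 0 ≤ ε := by
      by_contra h
      nlinarith
    have e1 : S/(n*N) - (t/N/2 + 1/2) = (2*S - n*t - n*N)/(2*(n*N)) := by
      field_simp
      ring
    have hHN : H ≤ N := by linarith
    have htN : t ≤ N := by linarith
    have b1 : B*H ≤ ε*n*N := by
      calc B*H ≤ (ε*n)*H := mul_le_mul_of_nonneg_right hBn hH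
        _ ≤ _ := mul_le_mul_of_nonneg_left hHN (by positivity)
    have b2 : t ≤ ε*n*N := by
      calc t ≤ 1*N := by linarith
        _ ≤ _ := mul_le_mul_of_nonneg_right hn1 hN.le
    have b3 : n*bad ≤ ε*n*N := by
      calc n*bad ≤ n*(ε*N) := mul_le_mul_of_nonneg_left hb hn0.le
        _ = _ := by ring
    have b4 : n*N ≤ n*(y+bad) := mul_le_mul_of_nonneg_left h1 hn0.le
    have b5 : n*y ≤ n*(t+H+2*bad) := mul_le_mul_of_nonneg_left h2 hn0.le
    have b6 : n*(t+H) ≤ n*y := mul_le_mul_of_nonneg_left h3 hn0.le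
    have b7 : n*y ≤ n*N := mul_le_mul_of_nonneg_left h1' hn0.le
    rw [e1, abs_le]
    constructor
    · rw [le_div_iff₀ (by positivity)]; nlinarith
    · rw [div_le_iff₀ (by positivity)]; nlinarith

end

lemma aux_pow (s : ℕ) (hs : 2 ≤ s) : 24*s+24 ≤ 2^(4*s) := by
  induction s, hs using Nat.le_induction with
  | base => norm_num
  | succ s hs ih =>
    rw [show 4*(s+1) = 4*s+4 by ring, pow_add]
    omega

lemma bad_real {n : ℕ} [NeZero n] {s : ℕ} (hs : 2 ≤ s) (h1 : 2^(4*s) ≤ n) (h2 : n < 2^(4*s+4)) :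
    ((Finset.univ.filter fun x : Fin n → Fin 2 =>
      ¬ Gd (n/2^s) (2^s) (12*s+12) (n/(3*s)) (3*s-1) x).card : ℝ) ≤
        (100*(s+1)/2^s) * 2^n := by
  have hp := aux_pow s hs
  have hn2 : 2 ≤ n := by omega
  have hb := bad_le (n := n) (K := n/2^s) (B := 2^s) (L := 12*s+12) (q := n/(3*s)) (m := 3*s-1)
    hn2 (by omega)
  have c1 := card_not_D (n := n) (12*s+12) (by omega)
  have c2 := card_E2 (n := n) (n/(3*s)) (3*s) (Nat.div_mul_le_self _ _)
  have c3 := card_E3 (n := n) (2^s) (3*s-1) (by omega)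
  have c5 := card_notInt n (2^s) (12*s+12) (by positivity)
  have c4 := (card_nonint (n := n) hn2 (fun i => ¬ Ins (n/2^s) (2^s) (12*s+12) i)).trans
    (Nat.mul_le_mul_right _ (Nat.mul_le_mul_left 2 (by convert c5)))
  have c6 : (Y n).card ≤ 2^n := by
    have := Finset.card_le_univ (Y n)
    simpa using this
  rw [show 3*s-1+1 = 3*s by omega] at hb
  generalize (Finset.univ.filter fun x : Fin n → Fin 2 =>
      ¬ Gd (n/2^s) (2^s) (12*s+12) (n/(3*s)) (3*s-1) x).card = b0 at *
  generalize (Finset.univ.filter fun x : Fin n → Fin 2 => ¬ D (12*s+12) x).card = b1 at *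
  generalize (Finset.univ.filter fun x : Fin n → Fin 2 => E2 (n/(3*s)) (3*s) x).card = b2 at *
  generalize (Finset.univ.filter fun x : Fin n → Fin 2 => E3 (2^s) (3*s-1) x).card = b3 at *
  generalize ((Y n).filter fun x => ∃ k e, Q x k e ∧
    (¬ Ins (n/2^s) (2^s) (12*s+12) k ∨ ¬ Ins (n/2^s) (2^s) (12*s+12) e)).card = b4 at *
  generalize (Y n).card = y at *
  have d1 : b1 * 2^s ≤ 2^n := by
    have e1 : n * n ≤ 2^(8*s+8) := by
      calc n * n ≤ 2^(4*s+4) * 2^(4*s+4) := Nat.mul_le_mul h2.le h2.le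
        _ = _ := by rw [← pow_add]; congr 1; ring
    have e2 : 2^(12*s+12) = 2^s * 2^(3*s+4) * 2^(8*s+8) := by
      rw [← pow_add, ← pow_add]; congr 1; ring
    have e3 : b1 * 2^s * 2^(3*s+4) * 2^(8*s+8) ≤ 2^n * 2^(8*s+8) := by
      calc b1 * 2^s * 2^(3*s+4) * 2^(8*s+8) = b1 * 2^(12*s+12) := by rw [e2]; ring
        _ ≤ n * n * 2^n := c1
        _ ≤ 2^(8*s+8) * 2^n := Nat.mul_le_mul_right _ e1
        _ = _ := by ring
    have e4 := Nat.le_of_mul_le_mul_right e3 (by positivity)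
    exact (Nat.le_mul_of_pos_right _ (by positivity)).trans e4
  have d2 : b2 * 2^s ≤ 6 * s * 2^n := by
    have q1 : n ≤ (n/(3*s)) * (6*s) := by
      have a1 := Nat.div_add_mod n (3*s)
      have a2 := Nat.mod_lt n (show 3*s > 0 by omega)
      have a3 : 1 ≤ n/(3*s) := (Nat.one_le_div_iff (by omega)).mpr (by omega)
      have a4 : 3*s * 1 ≤ 3*s*(n/(3*s)) := Nat.mul_le_mul_left _ a3
      have a5 : (n/(3*s)) * (6*s) = 3*s*(n/(3*s)) + 3*s*(n/(3*s)) := by ring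
      omega
    have e1 : b2 * 2^s * 2^(3*s) ≤ (6*s*2^n) * 2^(3*s) := by
      calc b2 * 2^s * 2^(3*s) = b2 * 2^(4*s) := by
            rw [mul_assoc, ← pow_add]; congr 2; ring
        _ ≤ b2 * ((n/(3*s)) * (6*s)) := Nat.mul_le_mul_left _ (h1.trans q1)
        _ = (b2 * (n/(3*s))) * (6*s) := by ring
        _ ≤ (2^(3*s) * 2^n) * (6*s) := Nat.mul_le_mul_right _ c2
        _ = _ := by ring
    exact Nat.le_of_mul_le_mul_right e1 (by positivity)
  have d3 : b3 * 2^s ≤ 64 * 2^n := by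
    have e0 : 2^(2*(3*s-1)) * 4 = 2^(6*s) := by
      rw [show (4:ℕ) = 2^2 by norm_num, ← pow_add]; congr 1; omega
    have e1 : b3 * 2^s * 2^(5*s) ≤ (64*2^n) * 2^(5*s) := by
      calc b3 * 2^s * 2^(5*s) = (b3 * 2^(2*(3*s-1))) * 4 := by
            rw [mul_assoc, mul_assoc, e0, ← pow_add]; congr 2; ring
        _ ≤ (n * 2^s * 2^n) * 4 := Nat.mul_le_mul_right _ c3
        _ ≤ (2^(4*s+4) * 2^s * 2^n) * 4 := by gcongr
        _ = _ := by
          rw [← pow_add, show 4*s+4+s = 5*s + 4 by ring, pow_add]; ring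
    exact Nat.le_of_mul_le_mul_right e1 (by positivity)
  have d4 : b4 * 2^s ≤ (24*s+26) * 2^n := by
    have e0 : 2^s * 2^s ≤ n := by
      calc 2^s*2^s = 2^(2*s) := by rw [← pow_add]; congr 1; ring
        _ ≤ 2^(4*s) := Nat.pow_le_pow_right (by norm_num) (by omega)
        _ ≤ n := h1
    have e2 : ((n/2^s)*(12*s+12) + 2^s) * 2^s ≤ n * (12*s+13) := by
      calc ((n/2^s)*(12*s+12) + 2^s) * 2^s = ((n/2^s) * 2^s) * (12*s+12) + 2^s*2^s := by ring
        _ ≤ n * (12*s+12) + n :=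
          Nat.add_le_add (Nat.mul_le_mul_right _ (Nat.div_mul_le_self _ _)) e0
        _ = _ := by ring
    have e1 : n * (b4 * 2^s) ≤ n * ((24*s+26) * 2^n) := by
      calc n * (b4 * 2^s) = (n * b4) * 2^s := by ring
        _ ≤ (2 * ((n/2^s)*(12*s+12) + 2^s) * y) * 2^s := Nat.mul_le_mul_right _ c4
        _ = 2 * (((n/2^s)*(12*s+12) + 2^s) * 2^s) * y := by ring
        _ ≤ 2 * (n * (12*s+13)) * 2^n := by gcongr
        _ = _ := by ring
    exact Nat.le_of_mul_le_mul_left e1 (by omega)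
  have d : b0 * 2^s ≤ 100*(s+1) * 2^n := by
    calc b0 * 2^s ≤ (b1 + b2 + b3 + b4) * 2^s := Nat.mul_le_mul_right _ hb
      _ = b1 * 2^s + b2 * 2^s + b3 * 2^s + b4 * 2^s := by ring
      _ ≤ 2^n + 6 * s * 2^n + 64 * 2^n + (24*s+26) * 2^n := by omega
      _ = (30*s+91) * 2^n := by ring
      _ ≤ _ := Nat.mul_le_mul_right _ (by omega)
  have d' : (b0 : ℝ) * 2^s ≤ 100*(s+1) * 2^n := by exact_mod_cast d
  rw [div_mul_eq_mul_div, le_div_iff₀ (by positivity)]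
  exact d'

lemma final_n {n s : ℕ} (hs : 2 ≤ s) (h1 : 2^(4*s) ≤ n) (h2 : n < 2^(4*s+4)) :
    |(n * (lyndonWords 2 n).card : ℝ) / 2^n - 1| ≤ 100*(s+1)/2^s ∧
    |(∑ w ∈ lyndonWords 2 n, (srfLen (List.ofFn w) : ℝ)) / 2^n -
      ((n * (lyndonWords 2 (n-1)).card : ℝ) / 2^n / 2 + 1/2)| ≤ 6 * (100*(s+1)/2^s) := by
  have hp := aux_pow s hs
  have hn2 : 2 ≤ n := by omega
  have : NeZero n := ⟨by omega⟩
  have hbad := bad_real hs h1 h2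
  obtain ⟨H, SH, a1, a2, a3, a4, a5, a6, a7⟩ := nat_core (n := n) (K := n/2^s) (B := 2^s)
    (L := 12*s+12) (q := n/(3*s)) (m := 3*s-1) (Nat.div_mul_le_self _ _) (by omega) (by omega)
    (by rw [show 3*s-1+1 = 3*s by omega]; exact Nat.div_mul_le_self _ _) (by omega)
  have hy : (Y n).card ≤ 2^n := by
    have := Finset.card_le_univ (Y n)
    simpa using this
  have hT : ((Y n).filter fun x => F x = n-1).card = n * (lyndonWords 2 (n-1)).card := by
    rw [card_T hn2]
    congr 1
    obtain ⟨k, rfl⟩ : ∃ k, n = k + 1 := ⟨n-1, by omega⟩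
    simp only [Nat.add_sub_cancel]
    exact card_lyndon_succ (by omega)
  rw [hT, card_Y hn2] at a2 a3
  rw [card_Y hn2] at a1 hy
  rw [hT, sum_F hn2] at a6 a7
  generalize (Finset.univ.filter fun x : Fin n → Fin 2 =>
      ¬ Gd (n/2^s) (2^s) (12*s+12) (n/(3*s)) (3*s-1) x).card = b at *
  have hsn : 2^s * 2^s ≤ n := by
    calc 2^s*2^s = 2^(2*s) := by rw [← pow_add]; congr 1; ring
      _ ≤ 2^(4*s) := Nat.pow_le_pow_right (by norm_num) (by omega)
      _ ≤ n := h1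
  have hsn' : (2:ℝ)^s * 2^s ≤ n := by exact_mod_cast hsn
  have hBn : (2:ℝ)^s ≤ 100*(s+1)/2^s * n := by
    rw [div_mul_eq_mul_div, le_div_iff₀ (by positivity)]
    have : (0:ℝ) ≤ s * n := by positivity
    have : (0:ℝ) ≤ n := by positivity
    nlinarith
  have h1s : (1:ℝ) ≤ 2^s := one_le_pow₀ (by norm_num)
  have hsub : ((n - 1 : ℕ) : ℝ) = (n:ℝ) - 1 := by
    rw [Nat.cast_sub (by omega)]; simp
  have key := real_core (N := 2^n) (y := n * (lyndonWords 2 n).card) (bad := b)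
    (t := n * (lyndonWords 2 (n-1)).card) (H := H) (SH := SH)
    (S := n * ∑ w ∈ lyndonWords 2 n, (srfLen (List.ofFn w) : ℝ)) (n := n) (B := 2^s)
    (ε := 100*(s+1)/2^s) (by exact_mod_cast (by omega : 1 ≤ n)) (by positivity)
    (by exact_mod_cast a1) (by exact_mod_cast hy) (by exact_mod_cast a2) (by exact_mod_cast a3)
    (by exact_mod_cast a4) (by exact_mod_cast a5)
    (by rw [← hsub]; exact_mod_cast a6) (by rw [← hsub]; exact_mod_cast a7)
    (by positivity) (by positivity) hbad hBn (h1s.trans hBn)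
  have hn0 : (n:ℝ) ≠ 0 := by exact_mod_cast (by omega : n ≠ 0)
  rw [mul_div_mul_left _ _ hn0] at key
  exact key

lemma tendsto_eps : Filter.Tendsto (fun n : ℕ =>
    (100*(((Nat.log 2 n / 4 : ℕ) : ℝ)+1)/2^(Nat.log 2 n / 4))) Filter.atTop (nhds 0) := by
  have h1 : Filter.Tendsto (fun s : ℕ => (100*((s : ℝ)+1)/2^s)) Filter.atTop (nhds 0) := by
    have a := tendsto_pow_const_div_const_pow_of_one_lt 1 (show (1:ℝ) < 2 by norm_num)
    have b := tendsto_pow_const_div_const_pow_of_one_lt 0 (show (1:ℝ) < 2 by norm_num)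
    have := (a.add b).const_mul 100
    simp only [add_zero, mul_zero] at this
    refine this.congr (fun s => ?_)
    simp only [pow_one, pow_zero]
    ring
  have h2 : Filter.Tendsto (fun n : ℕ => Nat.log 2 n / 4) Filter.atTop Filter.atTop := by
    rw [Filter.tendsto_atTop]
    intro b
    filter_upwards [Filter.eventually_ge_atTop (2^(4*b))] with n hn
    have := Nat.le_log_of_pow_le (by norm_num) hn
    omega
  exact h1.comp h2

lemma final_ev : ∀ᶠ n : ℕ in Filter.atTop,
    |(n * (lyndonWords 2 n).card : ℝ) / 2^n - 1| ≤
      (100*(((Nat.log 2 n / 4 : ℕ) : ℝ)+1)/2^(Nat.log 2 n / 4)) ∧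
    |(∑ w ∈ lyndonWords 2 n, (srfLen (List.ofFn w) : ℝ)) / 2^n -
      ((n * (lyndonWords 2 (n-1)).card : ℝ) / 2^n / 2 + 1/2)| ≤
      6 * (100*(((Nat.log 2 n / 4 : ℕ) : ℝ)+1)/2^(Nat.log 2 n / 4)) := by
  filter_upwards [Filter.eventually_ge_atTop (2^8)] with n hn
  have h0 := Nat.le_log_of_pow_le (by norm_num) hn
  apply final_n (by omega)
  · exact (Nat.pow_le_pow_right (by norm_num) (by omega)).trans
      (Nat.pow_log_le_self 2 (by omega))
  · exact (Nat.lt_pow_succ_log_self (by norm_num) n).trans_le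
      (Nat.pow_le_pow_right (by norm_num) (by omega))

lemma tendsto_y : Filter.Tendsto (fun n : ℕ => (n * (lyndonWords 2 n).card : ℝ) / 2^n)
    Filter.atTop (nhds 1) := by
  rw [tendsto_iff_norm_sub_tendsto_zero]
  refine squeeze_zero' (Filter.Eventually.of_forall fun n => norm_nonneg _) ?_ tendsto_eps
  filter_upwards [final_ev] with n hn
  exact hn.1

lemma tendsto_t : Filter.Tendsto (fun n : ℕ => (n * (lyndonWords 2 (n-1)).card : ℝ) / 2^n)
    Filter.atTop (nhds (1/2)) := by
  rw [← Filter.tendsto_add_atTop_iff_nat 1]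
  have h1 : Filter.Tendsto (fun n : ℕ => (1 + 1/(n:ℝ))) Filter.atTop (nhds (1+0)) :=
    tendsto_const_nhds.add tendsto_one_div_atTop_nhds_zero_nat
  have h2 := (h1.mul tendsto_y).mul_const (1/2)
  rw [show ((1:ℝ)+0)*1*(1/2) = 1/2 by norm_num] at h2
  refine h2.congr' ?_
  filter_upwards [Filter.eventually_ge_atTop 1] with n hn
  have : (n:ℝ) ≠ 0 := by exact_mod_cast (by omega : n ≠ 0)
  change _ = (((n+1 : ℕ) : ℝ) * (lyndonWords 2 n).card : ℝ) / 2^(n+1)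
  push_cast
  rw [pow_succ]
  field_simp

lemma tendsto_f : Filter.Tendsto (fun n : ℕ =>
    (∑ w ∈ lyndonWords 2 n, (srfLen (List.ofFn w) : ℝ)) / 2^n)
    Filter.atTop (nhds (3/4)) := by
  have h0 : Filter.Tendsto (fun n : ℕ =>
    (∑ w ∈ lyndonWords 2 n, (srfLen (List.ofFn w) : ℝ)) / 2^n -
      ((n * (lyndonWords 2 (n-1)).card : ℝ) / 2^n / 2 + 1/2)) Filter.atTop (nhds 0) := by
    rw [tendsto_zero_iff_norm_tendsto_zero]
    have he := tendsto_eps.const_mul 6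
    rw [mul_zero] at he
    refine squeeze_zero' (Filter.Eventually.of_forall fun n => norm_nonneg _) ?_ he
    filter_upwards [final_ev] with n hn
    exact hn.2
  have h1 := h0.add ((tendsto_t.div_const 2).add_const (1/2))
  rw [show (0:ℝ) + (1/2/2+1/2) = 3/4 by norm_num] at h1
  refine h1.congr (fun n => ?_)
  ring

end LyndonProof

theorem stmt_3 :
    Filter.Tendsto (fun n : ℕ =>
        ((∑ w ∈ lyndonWords 2 n, (srfLen (List.ofFn w) : ℝ))
            / ((lyndonWords 2 n).card : ℝ)) / n)
      Filter.atTop (nhds (3 / 4)) := by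
  have h := LyndonProof.tendsto_f.div LyndonProof.tendsto_y (by norm_num)
  rw [div_one] at h
  refine h.congr (fun n => ?_)
  rw [Pi.div_apply]
  rw [div_div_div_cancel_right₀ (by positivity), div_div, mul_comm]
end
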